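/- Let b : [0,T] × ℝ^d × ℝ → ℝ^d and a : [0,T] × ℝ^d × ℝ → ℝ^{d×d} be bounded Borel functions with a(t,x,r) symmetric positive semidefinite for all (t,x,r). Let v̄ : [0,T] × ℝ^d → [0,∞) be Borel, with v̄ ∈ L¹([0,T] × ℝ^d) and with v̄(t,·) a probability density on ℝ^d for each t, such that for every φ ∈ 𝒮(ℝ^d) and every t ∈ [0,T]: ∫ φ(x) v̄(t,x) dx = ∫ φ(x) v̄(0,x) dx + ∫₀ᵗ ∫ [ Σ_{i=1}^d b_i(s,x,v̄(s,x)) ∂_i φ(x) + ½ Σ_{i,j=1}^d a_{ij}(s,x,v̄(s,x)) ∂_{ij} φ(x) ] v̄(s,x) dx ds. Then there exists a Borel probability measure ℙ on Ω_T such that the law of Z_t under ℙ has density v̄(t,·) for every t ∈ [0,T], and for every φ ∈ C²_c(ℝ^d) the process φ(Z_t) − φ(Z_0) − ∫₀ᵗ [ Σ_i b_i(s,Z_s,v̄(s,Z_s)) ∂_i φ(Z_s) + ½ Σ_{i,j} a_{ij}(s,Z_s,v̄(s,Z_s)) ∂_{ij} φ(Z_s) ] ds is a ℙ-martingale with respect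 to the canonical filtration; that is, (Z, ℙ) is a solution in law of the McKean–Vlasov SDE with pointwise dependence on the marginal law density. -/

import Mathlib

open MeasureTheory Set

noncomputable section

/-- Euclidean space `ℝ^d`. -/
abbrev Euc (d : ℕ) := EuclideanSpace ℝ (Fin d)

/-- The canonical path space `Ω_T = C([0,T]; ℝ^d)`. -/
abbrev PathSpace (d : ℕ) (T : ℝ) := C(Set.Icc (0:ℝ) T, Euc d)

instance (d : ℕ) (T : ℝ) : MeasurableSpace (PathSpace d T) := borel _
instance (d : ℕ) (T : ℝ) : BorelSpace (PathSpace d T) := ⟨rfl⟩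

/-- Evaluation of a path at time `s ∈ [0,T]` (times outside `[0,T]` are clamped). -/
def evalAt {d : ℕ} {T : ℝ} (hT : 0 ≤ T) (s : ℝ) (ω : PathSpace d T) : Euc d :=
  ω (Set.projIcc 0 T hT s)

/-- Partial derivative `∂_i φ`. -/
def pd {d : ℕ} (i : Fin d) (φ : Euc d → ℝ) (x : Euc d) : ℝ :=
  fderiv ℝ φ x (EuclideanSpace.single i 1)

/-- Second partial derivative `∂_{ij} φ`. -/
def pd2 {d : ℕ} (i j : Fin d) (φ : Euc d → ℝ) (x : Euc d) : ℝ :=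
  fderiv ℝ (fun y => fderiv ℝ φ y (EuclideanSpace.single j 1)) x (EuclideanSpace.single i 1)

/-- The canonical filtration on path space: `𝔉_t` is generated by evaluations up to time `t`. -/
def canFilt (d : ℕ) (T : ℝ) (hT : 0 ≤ T) (t : ℝ) : MeasurableSpace (PathSpace d T) :=
  ⨆ (s : ℝ) (_ : s ∈ Set.Icc 0 t), MeasurableSpace.comap (evalAt hT s) inferInstance

/-- The action of the McKean generator, with coefficients evaluated at the density value
`v̄(s,x)`:
`Σ_i b_i(s,x,v̄(s,x)) ∂_i φ(x) + ½ Σ_{i,j} a_{ij}(s,x,v̄(s,x)) ∂_{ij} φ(x)`. -/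
def mkGenAction {d : ℕ} (b : ℝ → Euc d → ℝ → Euc d)
    (a : ℝ → Euc d → ℝ → Matrix (Fin d) (Fin d) ℝ) (vbar : ℝ → Euc d → ℝ)
    (φ : Euc d → ℝ) (s : ℝ) (x : Euc d) : ℝ :=
  (∑ i, b s x (vbar s x) i * pd i φ x)
    + (1/2 : ℝ) * ∑ i, ∑ j, a s x (vbar s x) i j * pd2 i j φ x

/-- The candidate martingale for the McKean--Vlasov SDE with pointwise density dependence. -/
def mkMgProcess {d : ℕ} {T : ℝ} (hT : 0 ≤ T) (b : ℝ → Euc d → ℝ → Euc d)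
    (a : ℝ → Euc d → ℝ → Matrix (Fin d) (Fin d) ℝ) (vbar : ℝ → Euc d → ℝ)
    (φ : Euc d → ℝ) (t : ℝ) (ω : PathSpace d T) : ℝ :=
  φ (evalAt hT t ω) - φ (evalAt hT 0 ω)
    - ∫ s in Set.Icc (0:ℝ) t, mkGenAction b a vbar φ s (evalAt hT s ω)

section SuperpositionPrinciple

open ProbabilityTheory
open scoped ENNReal NNReal Topology

section PolygonalPaths

variable {d : ℕ} {T : ℝ} (hT : 0 ≤ T)

theorem continuous_evalAt_uncurry :
    Continuous (fun p : ℝ × PathSpace d T => evalAt hT p.1 p.2) := by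
  unfold evalAt
  have : Continuous (fun p : ℝ × PathSpace d T => projIcc 0 T hT p.1) :=
    continuous_projIcc.comp continuous_fst
  fun_prop

theorem continuous_evalAt (s : ℝ) : Continuous (evalAt (d := d) hT s) := by
  unfold evalAt; fun_prop

theorem measurable_evalAt (s : ℝ) : Measurable (evalAt (d := d) hT s) :=
  (continuous_evalAt hT s).measurable

theorem continuous_evalAt_left (ω : PathSpace d T) : Continuous fun s => evalAt hT s ω :=
  (continuous_evalAt_uncurry hT).comp (by fun_prop : Continuous fun s : ℝ => (s, ω))

/-- Restriction of a real number to `[0,1]`. -/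
def unitClamp (x : ℝ) : ℝ := max 0 (min x 1)

theorem continuous_unitClamp : Continuous unitClamp := by unfold unitClamp; fun_prop

theorem unitClamp_of_nonpos {x : ℝ} (hx : x ≤ 0) : unitClamp x = 0 := by
  simp [unitClamp, hx]

theorem unitClamp_of_mem {x : ℝ} (h0 : 0 ≤ x) (h1 : x ≤ 1) : unitClamp x = x := by
  simp [unitClamp, h0, h1]

/-- The path stopped at time `j h` and then continued linearly on `[j h, (j+1) h]` with
increment `z`. -/
def extendPath (h : ℝ) (j : ℕ) (p : PathSpace d T × Euc d) : PathSpace d T where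
  toFun t := evalAt hT (min t (j * h)) p.1 + unitClamp ((t - j * h) / h) • p.2
  continuous_toFun := by
    have h1 : Continuous fun t : Set.Icc (0:ℝ) T => evalAt hT (min t (j * h)) p.1 :=
      (continuous_evalAt_left hT p.1).comp (by fun_prop)
    have h2 : Continuous fun t : Set.Icc (0:ℝ) T => unitClamp ((t - j * h) / h) :=
      continuous_unitClamp.comp (by fun_prop)
    fun_prop

theorem continuous_extendPath (h : ℝ) (j : ℕ) :
    Continuous (extendPath (d := d) hT h j) := by
  apply ContinuousMap.continuous_of_continuous_uncurry
  change Continuous fun q : (PathSpace d T × Euc d) × Set.Icc (0:ℝ) T =>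
    evalAt hT (min q.2 (j * h)) q.1.1 + unitClamp ((q.2 - j * h) / h) • q.1.2
  have h1 : Continuous fun q : (PathSpace d T × Euc d) × Set.Icc (0:ℝ) T =>
      evalAt hT (min q.2 (j * h)) q.1.1 :=
    (continuous_evalAt_uncurry hT).comp
      (by fun_prop : Continuous fun q : (PathSpace d T × Euc d) × Set.Icc (0:ℝ) T =>
        (min (q.2 : ℝ) (j * h), q.1.1))
  have h2 : Continuous fun q : (PathSpace d T × Euc d) × Set.Icc (0:ℝ) T =>
      unitClamp (((q.2 : ℝ) - j * h) / h) :=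
    continuous_unitClamp.comp (by fun_prop)
  fun_prop

theorem measurable_extendPath (h : ℝ) (j : ℕ) :
    Measurable (extendPath (d := d) hT h j) :=
  (continuous_extendPath hT h j).measurable

theorem evalAt_extendPath_of_le {h : ℝ} (hh : 0 < h) {j : ℕ} {t : ℝ} (ht : t ≤ j * h)
    (ω : PathSpace d T) (z : Euc d) :
    evalAt hT t (extendPath hT h j (ω, z)) = evalAt hT t ω := by
  have hc : (projIcc 0 T hT t : ℝ) ≤ j * h := by
    rw [coe_projIcc]
    exact max_le (by positivity) ((min_le_right _ _).trans ht)
  change evalAt hT (min (projIcc 0 T hT t : ℝ) (j * h)) ω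
    + unitClamp (((projIcc 0 T hT t : ℝ) - j * h) / h) • z = _
  rw [min_eq_left hc, unitClamp_of_nonpos
    (div_nonpos_of_nonpos_of_nonneg (by linarith) hh.le)]
  simp [evalAt]

theorem evalAt_extendPath_of_mem {h : ℝ} (hh : 0 < h) {j : ℕ} {t : ℝ} (ht : j * h ≤ t)
    (ht' : t ≤ (j + 1 : ℕ) * h) (htT : t ≤ T) (ω : PathSpace d T) (z : Euc d) :
    evalAt hT t (extendPath hT h j (ω, z))
      = evalAt hT (j * h) ω + ((t - j * h) / h) • z := by
  have h0 : 0 ≤ t := le_trans (by positivity) ht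
  have hc : (projIcc 0 T hT t : ℝ) = t := by
    rw [projIcc_of_mem hT ⟨h0, htT⟩]
  change evalAt hT (min (projIcc 0 T hT t : ℝ) (j * h)) ω
    + unitClamp (((projIcc 0 T hT t : ℝ) - j * h) / h) • z = _
  rw [hc, min_eq_right ht, unitClamp_of_mem]
  · exact div_nonneg (by linarith) hh.le
  · rw [div_le_one hh]; push_cast at ht'; linarith

theorem evalAt_extendPath_succ {h : ℝ} (hh : 0 < h) {j : ℕ}
    (htT : (j + 1 : ℕ) * h ≤ T) (ω : PathSpace d T) (z : Euc d) :
    evalAt hT ((j + 1 : ℕ) * h) (extendPath hT h j (ω, z)) = evalAt hT (j * h) ω + z := by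
  rw [evalAt_extendPath_of_mem hT hh (by push_cast; nlinarith) le_rfl htT]
  have : (((j + 1 : ℕ) : ℝ) * h - j * h) / h = 1 := by
    push_cast; field_simp; ring
  rw [this, one_smul]

/-- A functional of the path which only depends on its restriction to times at most `s`. -/
def DependsUpTo {α : Type*} (s : ℝ) (F : PathSpace d T → α) : Prop :=
  ∀ ω ω' : PathSpace d T, (∀ t ≤ s, evalAt hT t ω = evalAt hT t ω') → F ω = F ω'

theorem DependsUpTo.mono {α : Type*} {s t : ℝ} (hst : s ≤ t) {F : PathSpace d T → α}
    (hF : DependsUpTo hT s F) : DependsUpTo hT t F :=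
  fun ω ω' h => hF ω ω' fun r hr => h r (hr.trans hst)

theorem dependsUpTo_evalAt {s t : ℝ} (hst : s ≤ t) :
    DependsUpTo hT t (evalAt (d := d) hT s) := fun _ _ h => h s hst

theorem DependsUpTo.comp₂ {α β γ : Type*} {s : ℝ} {F : PathSpace d T → α}
    {G : PathSpace d T → β} (hF : DependsUpTo hT s F) (hG : DependsUpTo hT s G)
    (f : α → β → γ) : DependsUpTo hT s (fun ω => f (F ω) (G ω)) :=
  fun ω ω' h => by simp only [hF ω ω' h, hG ω ω' h]

theorem DependsUpTo.comp {α β : Type*} {s : ℝ} {F : PathSpace d T → α}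
    (hF : DependsUpTo hT s F) (f : α → β) : DependsUpTo hT s (fun ω => f (F ω)) :=
  fun ω ω' h => by simp only [hF ω ω' h]

theorem DependsUpTo.extendPath {α : Type*} {h : ℝ} (hh : 0 < h) {j : ℕ}
    {F : PathSpace d T → α} (hF : DependsUpTo hT (j * h) F) (ω : PathSpace d T) (z : Euc d) :
    F (extendPath hT h j (ω, z)) = F ω :=
  hF _ _ fun _ ht => evalAt_extendPath_of_le hT hh ht ω z

/-- The law of the polygonal interpolation of the Markov chain with initial law `μ₀` and increment
kernels `Q`, with time step `h`, stopped after `j` steps. -/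
def chainLaw (μ₀ : Measure (Euc d)) (Q : ℕ → Kernel (Euc d) (Euc d)) (h : ℝ) :
    ℕ → Measure (PathSpace d T)
  | 0 => μ₀.map (fun x => ContinuousMap.const _ x)
  | j + 1 => ((chainLaw μ₀ Q h j) ⊗ₘ ((Q j).comap (evalAt hT (j * h))
      (measurable_evalAt hT _))).map (extendPath hT h j)

variable (μ₀ : Measure (Euc d)) [IsProbabilityMeasure μ₀]
  (Q : ℕ → Kernel (Euc d) (Euc d)) [∀ j, IsMarkovKernel (Q j)] {h : ℝ}

theorem measurable_constPath :
    Measurable (fun x : Euc d => (ContinuousMap.const _ x : PathSpace d T)) :=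
  (ContinuousMap.continuous_const' : Continuous _).measurable

instance isProbabilityMeasure_chainLaw (j : ℕ) :
    IsProbabilityMeasure (chainLaw hT μ₀ Q h j) := by
  induction j with
  | zero => exact Measure.isProbabilityMeasure_map measurable_constPath.aemeasurable
  | succ j ih =>
    exact Measure.isProbabilityMeasure_map (measurable_extendPath hT h j).aemeasurable

theorem map_chainLaw_succ {α : Type*} [MeasurableSpace α] (hh : 0 < h) {j : ℕ}
    {F : PathSpace d T → α} (hF : DependsUpTo hT (j * h) F) (hFm : Measurable F) :
    (chainLaw hT μ₀ Q h (j + 1)).map F = (chainLaw hT μ₀ Q h j).map F := by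
  rw [chainLaw, Measure.map_map hFm (measurable_extendPath hT h j)]
  have : F ∘ extendPath hT h j = F ∘ Prod.fst := by
    ext ⟨ω, z⟩; exact hF.extendPath hT hh ω z
  rw [this, ← Measure.map_map hFm measurable_fst]
  congr 1
  exact Measure.fst_compProd _ _

theorem map_chainLaw_of_le {α : Type*} [MeasurableSpace α] (hh : 0 < h) {j J : ℕ} (hj : j ≤ J)
    {F : PathSpace d T → α} (hF : DependsUpTo hT (j * h) F) (hFm : Measurable F) :
    (chainLaw hT μ₀ Q h J).map F = (chainLaw hT μ₀ Q h j).map F := by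
  induction J, hj using Nat.le_induction with
  | base => rfl
  | succ J hJ ih =>
    rw [map_chainLaw_succ hT μ₀ Q hh _ hFm, ih]
    exact hF.mono hT (by gcongr)

theorem lintegral_chainLaw_of_le (hh : 0 < h) {j J : ℕ} (hj : j ≤ J)
    {F : PathSpace d T → ℝ≥0∞} (hF : DependsUpTo hT (j * h) F) (hFm : Measurable F) :
    ∫⁻ ω, F ω ∂(chainLaw hT μ₀ Q h J) = ∫⁻ ω, F ω ∂(chainLaw hT μ₀ Q h j) := by
  have := map_chainLaw_of_le hT μ₀ Q hh hj hF hFm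
  have h2 := congrArg (fun μ => ∫⁻ x, x ∂μ) this
  rwa [lintegral_map measurable_id' hFm, lintegral_map measurable_id' hFm] at h2

theorem integral_chainLaw_of_le (hh : 0 < h) {j J : ℕ} (hj : j ≤ J)
    {F : PathSpace d T → ℝ} (hF : DependsUpTo hT (j * h) F) (hFm : Measurable F) :
    ∫ ω, F ω ∂(chainLaw hT μ₀ Q h J) = ∫ ω, F ω ∂(chainLaw hT μ₀ Q h j) := by
  have := map_chainLaw_of_le hT μ₀ Q hh hj hF hFm
  have h2 := congrArg (fun μ => ∫ x, x ∂μ) this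
  rwa [integral_map hFm.aemeasurable (f := fun x => x) measurable_id'.aestronglyMeasurable,
    integral_map hFm.aemeasurable (f := fun x => x) measurable_id'.aestronglyMeasurable] at h2

theorem lintegral_chainLaw_succ {j : ℕ} {F : PathSpace d T → ℝ≥0∞} (hFm : Measurable F) :
    ∫⁻ ω, F ω ∂(chainLaw hT μ₀ Q h (j + 1))
      = ∫⁻ ω, ∫⁻ z, F (extendPath hT h j (ω, z)) ∂(Q j (evalAt hT (j * h) ω))
        ∂(chainLaw hT μ₀ Q h j) := by
  rw [chainLaw, lintegral_map hFm (measurable_extendPath hT h j)]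
  exact Measure.lintegral_compProd (hFm.comp (measurable_extendPath hT h j))

theorem integral_chainLaw_succ {j : ℕ} {F : PathSpace d T → ℝ} (hFm : Measurable F)
    {C : ℝ} (hC : ∀ ω, |F ω| ≤ C) :
    ∫ ω, F ω ∂(chainLaw hT μ₀ Q h (j + 1))
      = ∫ ω, ∫ z, F (extendPath hT h j (ω, z)) ∂(Q j (evalAt hT (j * h) ω))
        ∂(chainLaw hT μ₀ Q h j) := by
  rw [chainLaw, integral_map (measurable_extendPath hT h j).aemeasurable
    hFm.aestronglyMeasurable, Measure.integral_compProd]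
  · rfl
  · exact Integrable.of_bound (hFm.comp (measurable_extendPath hT h j)).aestronglyMeasurable C
      (ae_of_all _ fun p => hC _)

/-- The Markov property of the chain along its grid. -/
theorem integral_chainLaw_markov (hh : 0 < h) {j J : ℕ} (hj : j + 1 ≤ J)
    (hJT : (J : ℝ) * h ≤ T) {G : PathSpace d T → ℝ} (hGm : Measurable G)
    (hG : DependsUpTo hT (j * h) G) {CG : ℝ} (hCG : ∀ ω, |G ω| ≤ CG)
    {ψ : Euc d → Euc d → ℝ} (hψ : Measurable (Function.uncurry ψ)) {Cψ : ℝ}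
    (hCψ : ∀ x y, |ψ x y| ≤ Cψ) :
    ∫ ω, G ω * ψ (evalAt hT (j * h) ω) (evalAt hT ((j + 1 : ℕ) * h) ω)
        ∂(chainLaw hT μ₀ Q h J)
      = ∫ ω, G ω * ∫ z, ψ (evalAt hT (j * h) ω) (evalAt hT (j * h) ω + z)
          ∂(Q j (evalAt hT (j * h) ω)) ∂(chainLaw hT μ₀ Q h J) := by
  have hjT : (j + 1 : ℕ) * h ≤ T := le_trans (by gcongr) hJT
  have hle : (j : ℝ) * h ≤ (j + 1 : ℕ) * h := by push_cast; nlinarith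
  have hm1 : Measurable fun ω => G ω * ψ (evalAt hT (j * h) ω)
      (evalAt hT ((j + 1 : ℕ) * h) ω) :=
    hGm.mul (hψ.comp ((measurable_evalAt hT _).prodMk (measurable_evalAt hT _)))
  have hm2 : Measurable fun x => ∫ z, ψ x (x + z) ∂(Q j x) := by
    have : StronglyMeasurable (fun p : Euc d × Euc d => ψ p.1 (p.1 + p.2)) :=
      (hψ.comp (measurable_fst.prodMk (measurable_fst.add measurable_snd))).stronglyMeasurable
    exact (StronglyMeasurable.integral_kernel_prod_right' (κ := Q j) this).measurable
  have hm3 : Measurable fun ω => G ω * ∫ z, ψ (evalAt hT (j * h) ω) (evalAt hT (j * h) ω + z)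
          ∂(Q j (evalAt hT (j * h) ω)) := hGm.mul (hm2.comp (measurable_evalAt hT _))
  rw [integral_chainLaw_of_le hT μ₀ Q hh hj _ hm1,
    integral_chainLaw_succ hT μ₀ Q hm1 (C := CG * Cψ),
    integral_chainLaw_of_le hT μ₀ Q hh (by omega : j ≤ J) _ hm3]
  · congr 1 with ω
    rw [← integral_const_mul]
    congr 1 with z
    rw [evalAt_extendPath_succ hT hh hjT, evalAt_extendPath_of_le hT hh le_rfl,
      hG.extendPath hT hh]
  · exact hG.comp₂ hT ((dependsUpTo_evalAt hT le_rfl).comp hT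
      fun x => ∫ z, ψ x (x + z) ∂(Q j x)) (fun x y => x * y)
  · intro ω
    rw [abs_mul]
    exact mul_le_mul (hCG _) (hCψ _ _) (abs_nonneg _) ((abs_nonneg _).trans (hCG ω))
  · exact (hG.mono hT hle).comp₂ hT
      (((dependsUpTo_evalAt hT hle).comp₂ hT (dependsUpTo_evalAt hT le_rfl)) ψ)
      (fun x y => x * y)

theorem map_evalAt_zero_chainLaw (hh : 0 < h) (J : ℕ) :
    (chainLaw hT μ₀ Q h J).map (evalAt hT 0) = μ₀ := by
  rw [map_chainLaw_of_le hT μ₀ Q hh (Nat.zero_le J)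
    (dependsUpTo_evalAt hT (by simp)) (measurable_evalAt hT _), chainLaw,
    Measure.map_map (measurable_evalAt hT _) measurable_constPath]
  exact Measure.map_id

end PolygonalPaths

section Moments

variable {d : ℕ} {T : ℝ} (hT : 0 ≤ T) (μ₀ : Measure (Euc d)) [IsProbabilityMeasure μ₀]
  (Q : ℕ → Kernel (Euc d) (Euc d)) [∀ j, IsMarkovKernel (Q j)] {h : ℝ}

theorem add_three_pow_four_le (a b c : ℝ) :
    (a + b + c) ^ 4 ≤ 27 * (a ^ 4 + b ^ 4 + c ^ 4) := by
  have h1 : (a + b + c) ^ 2 ≤ 3 * (a ^ 2 + b ^ 2 + c ^ 2) := by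
    nlinarith [sq_nonneg (a - b), sq_nonneg (b - c), sq_nonneg (a - c)]
  have h2 : (a ^ 2 + b ^ 2 + c ^ 2) ^ 2 ≤ 3 * (a ^ 4 + b ^ 4 + c ^ 4) := by
    nlinarith [sq_nonneg (a ^ 2 - b ^ 2), sq_nonneg (b ^ 2 - c ^ 2), sq_nonneg (a ^ 2 - c ^ 2)]
  calc (a + b + c) ^ 4 = ((a + b + c) ^ 2) ^ 2 := by ring
    _ ≤ (3 * (a ^ 2 + b ^ 2 + c ^ 2)) ^ 2 := by gcongr
    _ = 9 * (a ^ 2 + b ^ 2 + c ^ 2) ^ 2 := by ring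
    _ ≤ 27 * (a ^ 4 + b ^ 4 + c ^ 4) := by linarith

theorem norm_add_three_pow_four_le {E : Type*} [NormedAddCommGroup E] (x y z : E) :
    ‖x + y + z‖ ^ 4 ≤ 27 * (‖x‖ ^ 4 + ‖y‖ ^ 4 + ‖z‖ ^ 4) :=
  (pow_le_pow_left₀ (norm_nonneg _) norm_add₃_le 4).trans (add_three_pow_four_le _ _ _)

variable {c : ℝ} (hc : 0 ≤ c)
  (hQ2 : ∀ j x S, ∫⁻ z, ENNReal.ofReal (‖S + z‖ ^ 2) ∂(Q j x)
    ≤ ENNReal.ofReal ((1 + c * h) * ‖S‖ ^ 2 + c * h))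
  (hQ4 : ∀ j x S, ∫⁻ z, ENNReal.ofReal (‖S + z‖ ^ 4) ∂(Q j x)
    ≤ ENNReal.ofReal ((1 + c * h) * ‖S‖ ^ 4 + c * h * ‖S‖ ^ 2 + c * h ^ 2))

theorem measurable_evalAt_sub (s t : ℝ) (n : ℕ) :
    Measurable fun ω : PathSpace d T => ENNReal.ofReal (‖evalAt hT s ω - evalAt hT t ω‖ ^ n) :=
  ENNReal.measurable_ofReal.comp
    (((measurable_evalAt hT s).sub (measurable_evalAt hT t)).norm.pow_const n)

include hc hQ2 in
theorem lintegral_grid_increment_sq_le (hh : 0 < h) (k l : ℕ) (hl : (k + l : ℕ) * h ≤ T) :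
    ∫⁻ ω, ENNReal.ofReal (‖evalAt hT ((k + l : ℕ) * h) ω - evalAt hT (k * h) ω‖ ^ 2)
        ∂(chainLaw hT μ₀ Q h (k + l))
      ≤ ENNReal.ofReal (c * (l * h) * (1 + c * h) ^ l) := by
  induction l with
  | zero => simp
  | succ l ih =>
    have hkl : ((k + l : ℕ) : ℝ) * h ≤ (k + (l + 1) : ℕ) * h := by gcongr; omega
    specialize ih (hkl.trans hl)
    rw [← add_assoc, lintegral_chainLaw_succ hT μ₀ Q (measurable_evalAt_sub hT _ _ _)]
    have h1 : ∀ ω : PathSpace d T, ∫⁻ z, ENNReal.ofReal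
        (‖evalAt hT ((k + l + 1 : ℕ) * h) (extendPath hT h (k + l) (ω, z))
          - evalAt hT (k * h) (extendPath hT h (k + l) (ω, z))‖ ^ 2)
          ∂(Q (k + l) (evalAt hT ((k + l : ℕ) * h) ω))
        ≤ ENNReal.ofReal (1 + c * h) * ENNReal.ofReal
          (‖evalAt hT ((k + l : ℕ) * h) ω - evalAt hT (k * h) ω‖ ^ 2) + ENNReal.ofReal (c * h) := by
      intro ω
      rw [← ENNReal.ofReal_mul (by positivity), ← ENNReal.ofReal_add (by positivity)
        (by positivity)]
      refine le_trans (le_of_eq ?_) (hQ2 (k + l) (evalAt hT ((k + l : ℕ) * h) ω) _)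
      congr 1 with z
      have hl' : ((k + l + 1 : ℕ) : ℝ) * h ≤ T := hl
      rw [evalAt_extendPath_succ hT hh (j := k + l) hl', evalAt_extendPath_of_le hT hh
        (by gcongr; omega)]
      congr 3; abel
    refine (lintegral_mono h1).trans ?_
    rw [lintegral_add_right _ measurable_const, lintegral_const_mul _
      (measurable_evalAt_sub hT _ _ _)]
    simp only [lintegral_const, measure_univ, mul_one]
    refine (add_le_add_left (mul_le_mul_right ih _) _).trans ?_
    rw [← ENNReal.ofReal_mul (by positivity), ← ENNReal.ofReal_add (by positivity) (by positivity)]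
    apply ENNReal.ofReal_le_ofReal
    have hE : 1 ≤ (1 + c * h) ^ (l + 1) := one_le_pow₀ (by nlinarith [mul_nonneg hc hh.le])
    have : c * h ≤ c * h * (1 + c * h) ^ (l + 1) := le_mul_of_one_le_right (by positivity) hE
    push_cast
    calc _ = c * (l * h) * (1 + c * h) ^ (l + 1) + c * h := by ring
      _ ≤ _ := by linarith

include hc hQ2 hQ4 in
theorem lintegral_grid_increment_pow_four_le (hh : 0 < h) (k l : ℕ) (hl : (k + l : ℕ) * h ≤ T) :
    ∫⁻ ω, ENNReal.ofReal (‖evalAt hT ((k + l : ℕ) * h) ω - evalAt hT (k * h) ω‖ ^ 4)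
        ∂(chainLaw hT μ₀ Q h (k + l))
      ≤ ENNReal.ofReal ((c ^ 2 + c) * (l * h) ^ 2 * (1 + c * h) ^ l) := by
  induction l with
  | zero => simp
  | succ l ih =>
    have hkl : ((k + l : ℕ) : ℝ) * h ≤ (k + (l + 1) : ℕ) * h := by gcongr; omega
    specialize ih (hkl.trans hl)
    have ih2 := lintegral_grid_increment_sq_le hT μ₀ Q hc hQ2 hh k l (hkl.trans hl)
    rw [← add_assoc, lintegral_chainLaw_succ hT μ₀ Q (measurable_evalAt_sub hT _ _ _)]
    have h1 : ∀ ω : PathSpace d T, ∫⁻ z, ENNReal.ofReal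
        (‖evalAt hT ((k + l + 1 : ℕ) * h) (extendPath hT h (k + l) (ω, z))
          - evalAt hT (k * h) (extendPath hT h (k + l) (ω, z))‖ ^ 4)
          ∂(Q (k + l) (evalAt hT ((k + l : ℕ) * h) ω))
        ≤ ENNReal.ofReal (1 + c * h) * ENNReal.ofReal
          (‖evalAt hT ((k + l : ℕ) * h) ω - evalAt hT (k * h) ω‖ ^ 4)
          + ENNReal.ofReal (c * h) * ENNReal.ofReal
          (‖evalAt hT ((k + l : ℕ) * h) ω - evalAt hT (k * h) ω‖ ^ 2)
          + ENNReal.ofReal (c * h ^ 2) := by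
      intro ω
      rw [← ENNReal.ofReal_mul (by positivity), ← ENNReal.ofReal_mul (by positivity),
        ← ENNReal.ofReal_add (by positivity) (by positivity),
        ← ENNReal.ofReal_add (by positivity) (by positivity)]
      refine le_trans (le_of_eq ?_) (hQ4 (k + l) (evalAt hT ((k + l : ℕ) * h) ω) _)
      congr 1 with z
      have hl' : ((k + l + 1 : ℕ) : ℝ) * h ≤ T := hl
      rw [evalAt_extendPath_succ hT hh (j := k + l) hl', evalAt_extendPath_of_le hT hh
        (by gcongr; omega)]
      congr 3; abel
    refine (lintegral_mono h1).trans ?_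
    rw [lintegral_add_right _ measurable_const, lintegral_add_right _
      ((measurable_evalAt_sub hT _ _ _).const_mul _), lintegral_const_mul _
      (measurable_evalAt_sub hT _ _ _), lintegral_const_mul _
      (measurable_evalAt_sub hT _ _ _)]
    simp only [lintegral_const, measure_univ, mul_one]
    refine (add_le_add_left (add_le_add (mul_le_mul_right ih _) (mul_le_mul_right ih2 _)) _).trans
      ?_
    rw [← ENNReal.ofReal_mul (by positivity), ← ENNReal.ofReal_mul (by positivity),
      ← ENNReal.ofReal_add (by positivity) (by positivity),
      ← ENNReal.ofReal_add (by positivity) (by positivity)]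
    apply ENNReal.ofReal_le_ofReal
    have hE1 : 1 ≤ (1 + c * h) := by nlinarith [mul_nonneg hc hh.le]
    have hE : 1 ≤ (1 + c * h) ^ (l + 1) := one_le_pow₀ hE1
    have h2 : c * h ^ 2 ≤ c * h ^ 2 * (1 + c * h) ^ (l + 1) :=
      le_mul_of_one_le_right (by positivity) hE
    have h3 : (1 + c * h) ^ l ≤ (1 + c * h) ^ (l + 1) := pow_le_pow_right₀ hE1 (by omega)
    have h4 : c * h * (c * (l * h) * (1 + c * h) ^ l)
        ≤ c * h * (c * (l * h) * (1 + c * h) ^ (l + 1)) := by gcongr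
    have h5 : 0 ≤ (c ^ 2 + c) * h ^ 2 * l * (1 + c * h) ^ (l + 1) := by positivity
    have h6 : 0 ≤ c ^ 2 * h ^ 2 * (1 + c * h) ^ (l + 1) := by positivity
    have h7 : 0 ≤ c * h ^ 2 * l * (1 + c * h) ^ (l + 1) := by positivity
    push_cast
    calc _ = (c ^ 2 + c) * (l * h) ^ 2 * (1 + c * h) ^ (l + 1)
          + c * h * (c * (l * h) * (1 + c * h) ^ l) + c * h ^ 2 := by ring
      _ ≤ (c ^ 2 + c) * (l * h) ^ 2 * (1 + c * h) ^ (l + 1)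
          + c * h * (c * (l * h) * (1 + c * h) ^ (l + 1))
          + c * h ^ 2 * (1 + c * h) ^ (l + 1) := by gcongr
      _ ≤ _ := by nlinarith

include hc hQ4 in
theorem lintegral_cell_increment_pow_four_le (hh : 0 < h) {j J : ℕ} (hj : j + 1 ≤ J)
    (hJ : (J : ℝ) * h ≤ T) {s t : ℝ} (hs : j * h ≤ s) (hst : s ≤ t) (ht : t ≤ (j + 1 : ℕ) * h) :
    ∫⁻ ω, ENNReal.ofReal (‖evalAt hT t ω - evalAt hT s ω‖ ^ 4) ∂(chainLaw hT μ₀ Q h J)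
      ≤ ENNReal.ofReal (c * (t - s) ^ 2) := by
  have hjT : ((j + 1 : ℕ) : ℝ) * h ≤ T := le_trans (by gcongr) hJ
  rw [lintegral_chainLaw_of_le hT μ₀ Q hh hj _ (measurable_evalAt_sub hT _ _ _),
    lintegral_chainLaw_succ hT μ₀ Q (measurable_evalAt_sub hT _ _ _)]
  · have h1 : ∀ ω : PathSpace d T, ∫⁻ z, ENNReal.ofReal
        (‖evalAt hT t (extendPath hT h j (ω, z))
          - evalAt hT s (extendPath hT h j (ω, z))‖ ^ 4)
          ∂(Q j (evalAt hT (j * h) ω)) ≤ ENNReal.ofReal (c * (t - s) ^ 2) := by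
      intro ω
      have h2 := hQ4 j (evalAt hT (j * h) ω) 0
      have h3 : ∀ z : Euc d, ENNReal.ofReal (‖evalAt hT t (extendPath hT h j (ω, z))
          - evalAt hT s (extendPath hT h j (ω, z))‖ ^ 4)
          = ENNReal.ofReal (((t - s) / h) ^ 4) * ENNReal.ofReal (‖0 + z‖ ^ 4) := by
        intro z
        rw [evalAt_extendPath_of_mem hT hh (hs.trans hst) ht (ht.trans hjT),
          evalAt_extendPath_of_mem hT hh hs (hst.trans ht) ((hst.trans ht).trans hjT),
          ← ENNReal.ofReal_mul (by positivity), add_sub_add_left_eq_sub, ← sub_smul, norm_smul,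
          zero_add, mul_pow]
        congr 2
        rw [Real.norm_eq_abs, Even.pow_abs (by decide)]
        congr 1
        ring
      simp_rw [h3]
      rw [lintegral_const_mul _ (by fun_prop)]
      refine (mul_le_mul_right h2 _).trans ?_
      rw [← ENNReal.ofReal_mul (by positivity)]
      apply ENNReal.ofReal_le_ofReal
      have h4 : ((t - s) / h) ^ 2 ≤ 1 := by
        rw [sq_le_one_iff_abs_le_one, abs_of_nonneg (div_nonneg (by linarith) hh.le),
          div_le_one hh]
        push_cast at ht; linarith
      have h5 : (t - s) ^ 2 = ((t - s) / h) ^ 2 * h ^ 2 := by field_simp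
      rw [h5]
      simp only [norm_zero]
      have h6 : 0 ≤ c * ((t - s) / h) ^ 2 * h ^ 2 := by positivity
      nlinarith
    refine (lintegral_mono h1).trans ?_
    simp
  · exact ((dependsUpTo_evalAt hT ht).comp₂ hT (dependsUpTo_evalAt hT (hst.trans ht))
      fun x y => ENNReal.ofReal (‖x - y‖ ^ 4))

/-- The constant of the fourth moment bound for the increments of the chain. -/
def momentConst (c T : ℝ) : ℝ := 81 * ((c ^ 2 + c) * Real.exp (c * T))

include hc hQ2 hQ4 in
theorem lintegral_increment_pow_four_le (hh : 0 < h) {J : ℕ} (hJ : (J : ℝ) * h = T) {s t : ℝ}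
    (hs : 0 ≤ s) (hst : s ≤ t) (ht : t ≤ T) :
    ∫⁻ ω, ENNReal.ofReal (‖evalAt hT t ω - evalAt hT s ω‖ ^ 4) ∂(chainLaw hT μ₀ Q h J)
      ≤ ENNReal.ofReal (momentConst c T * (t - s) ^ 2) := by
  have hexp : 1 ≤ Real.exp (c * T) := Real.one_le_exp (by positivity)
  set K := (c ^ 2 + c) * Real.exp (c * T) with hK
  have hcK : c ≤ K := by
    calc c ≤ c ^ 2 + c := by nlinarith [sq_nonneg c]
      _ ≤ K := le_mul_of_one_le_right (by positivity) hexp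
  have hK0 : 0 ≤ K := hc.trans hcK
  rcases hst.eq_or_lt with rfl | hlt
  · simp
  set j := ⌊s / h⌋₊ with hj
  have hj1 : j * h ≤ s := by
    rw [← le_div_iff₀ hh]; exact Nat.floor_le (by positivity)
  have hj2 : s < (j + 1 : ℕ) * h := by
    rw [← div_lt_iff₀ hh]; push_cast; exact Nat.lt_floor_add_one _
  have hjJ : j + 1 ≤ J := by
    have : (j : ℝ) < J := by
      by_contra! hcon
      have : (J : ℝ) * h ≤ j * h := by gcongr
      linarith
    exact_mod_cast this
  by_cases hcell : t ≤ (j + 1 : ℕ) * h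
  · refine (lintegral_cell_increment_pow_four_le hT μ₀ Q hc hQ4 hh hjJ hJ.le hj1 hst hcell).trans
      (ENNReal.ofReal_le_ofReal ?_)
    unfold momentConst
    gcongr
    linarith
  push Not at hcell
  obtain ⟨l, hl⟩ : ∃ l, ⌈t / h⌉₊ = l + 1 := by
    refine ⟨⌈t / h⌉₊ - 1, ?_⟩
    have : 0 < ⌈t / h⌉₊ := Nat.ceil_pos.mpr (div_pos (by linarith) hh)
    omega
  have hl2 : t ≤ (l + 1 : ℕ) * h := by
    rw [← div_le_iff₀ hh, ← hl]; exact Nat.le_ceil _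
  have hl1 : l * h ≤ t := by
    rw [← le_div_iff₀ hh]
    have := Nat.ceil_lt_add_one (a := t / h) (div_nonneg (by linarith) hh.le)
    rw [hl] at this; push_cast at this; linarith
  have hlJ : l + 1 ≤ J := by
    rw [← hl, Nat.ceil_le, div_le_iff₀ hh]; linarith
  have hjl : j + 1 ≤ l := by
    have : j + 1 < ⌈t / h⌉₊ := by rw [Nat.lt_ceil, lt_div_iff₀ hh]; exact hcell
    omega
  obtain ⟨m, rfl⟩ := Nat.exists_eq_add_of_le hjl
  have hA := lintegral_cell_increment_pow_four_le hT μ₀ Q hc hQ4 hh hjJ hJ.le hj1 hj2.le le_rfl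
  have hB := lintegral_cell_increment_pow_four_le hT μ₀ Q hc hQ4 hh hlJ hJ.le le_rfl hl1 hl2
  have hmT : ((j + 1 + m : ℕ) : ℝ) * h ≤ T := hl1.trans ht
  have hC : ∫⁻ ω, ENNReal.ofReal (‖evalAt hT ((j + 1 + m : ℕ) * h) ω
      - evalAt hT ((j + 1 : ℕ) * h) ω‖ ^ 4) ∂(chainLaw hT μ₀ Q h J)
      ≤ ENNReal.ofReal (K * (m * h) ^ 2) := by
    rw [lintegral_chainLaw_of_le hT μ₀ Q hh (by omega : j + 1 + m ≤ J) _
      (measurable_evalAt_sub hT _ _ _)]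
    · refine (lintegral_grid_increment_pow_four_le hT μ₀ Q hc hQ2 hQ4 hh (j + 1) m hmT).trans
        (ENNReal.ofReal_le_ofReal ?_)
      have h1 : (1 + c * h) ^ m ≤ Real.exp (c * T) := by
        calc (1 + c * h) ^ m ≤ (Real.exp (c * h)) ^ m := by
              gcongr; linarith [Real.add_one_le_exp (c * h)]
          _ = Real.exp (c * (m * h)) := by rw [← Real.exp_nat_mul]; ring_nf
          _ ≤ Real.exp (c * T) := by
              gcongr
              refine le_trans ?_ hmT
              gcongr; omega
      calc (c ^ 2 + c) * (m * h) ^ 2 * (1 + c * h) ^ m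
          ≤ (c ^ 2 + c) * (m * h) ^ 2 * Real.exp (c * T) := by gcongr
        _ = K * (m * h) ^ 2 := by rw [hK]; ring
    · exact ((dependsUpTo_evalAt hT le_rfl).comp₂ hT (dependsUpTo_evalAt hT (by gcongr))
        fun x y => ENNReal.ofReal (‖x - y‖ ^ 4))
  have hpt : ∀ ω : PathSpace d T, ENNReal.ofReal (‖evalAt hT t ω - evalAt hT s ω‖ ^ 4)
      ≤ ENNReal.ofReal 27 * (ENNReal.ofReal (‖evalAt hT ((j + 1 : ℕ) * h) ω - evalAt hT s ω‖ ^ 4)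
        + ENNReal.ofReal (‖evalAt hT ((j + 1 + m : ℕ) * h) ω
          - evalAt hT ((j + 1 : ℕ) * h) ω‖ ^ 4)
        + ENNReal.ofReal (‖evalAt hT t ω - evalAt hT ((j + 1 + m : ℕ) * h) ω‖ ^ 4)) := by
    intro ω
    rw [← ENNReal.ofReal_add (by positivity) (by positivity),
      ← ENNReal.ofReal_add (by positivity) (by positivity), ← ENNReal.ofReal_mul (by positivity)]
    apply ENNReal.ofReal_le_ofReal
    refine le_trans (le_of_eq ?_) (norm_add_three_pow_four_le _ _ _)
    congr 2
    abel
  refine (lintegral_mono hpt).trans ?_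
  rw [lintegral_const_mul' _ _ ENNReal.ofReal_ne_top,
    lintegral_add_right _ (measurable_evalAt_sub hT _ _ _),
    lintegral_add_right _ (measurable_evalAt_sub hT _ _ _)]
  refine (mul_le_mul_right (add_le_add (add_le_add hA hC) hB) _).trans ?_
  rw [← ENNReal.ofReal_add (by positivity) (by positivity),
      ← ENNReal.ofReal_add (by positivity) (by positivity), ← ENNReal.ofReal_mul (by positivity)]
  apply ENNReal.ofReal_le_ofReal
  have e1 : (((j + 1 : ℕ) : ℝ) * h - s) ^ 2 ≤ (t - s) ^ 2 := by
    apply pow_le_pow_left₀ <;> linarith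
  have e2 : (m * h) ^ 2 ≤ (t - s) ^ 2 := by
    apply pow_le_pow_left₀ (by positivity)
    push_cast at hl1 hj2
    nlinarith
  have e3 : (t - ((j + 1 + m : ℕ) : ℝ) * h) ^ 2 ≤ (t - s) ^ 2 := by
    apply pow_le_pow_left₀ (by linarith)
    have : ((j + 1 : ℕ) : ℝ) * h ≤ ((j + 1 + m : ℕ) : ℝ) * h := by gcongr
    linarith
  have f1 : c * (((j + 1 : ℕ) : ℝ) * h - s) ^ 2 ≤ K * (t - s) ^ 2 := by gcongr
  have f2 : K * (m * h) ^ 2 ≤ K * (t - s) ^ 2 := by gcongr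
  have f3 : c * (t - ((j + 1 + m : ℕ) : ℝ) * h) ^ 2 ≤ K * (t - s) ^ 2 := by gcongr
  unfold momentConst
  linarith

end Moments

section Noise

variable {d : ℕ}

/-- The average of `f` over the increments `h B ± √(h d) S i`. -/
def noiseAvg (h : ℝ) (B : Euc d) (S : Fin d → Euc d) (f : Euc d → ℝ) : ℝ :=
  ∑ i, (2 * d : ℝ)⁻¹ * (f (h • B + √(h * d) • S i) + f (h • B - √(h * d) • S i))

theorem noiseAvg_le (hd : 1 ≤ d) {h : ℝ} {B : Euc d} {S : Fin d → Euc d} {f : Euc d → ℝ} {C : ℝ}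
    (hf : ∀ i, f (h • B + √(h * d) • S i) + f (h • B - √(h * d) • S i) ≤ 2 * C) :
    noiseAvg h B S f ≤ C := by
  have hd0 : (0 : ℝ) < d := by exact_mod_cast hd
  calc noiseAvg h B S f ≤ ∑ i : Fin d, (2 * d : ℝ)⁻¹ * (2 * C) := by
        unfold noiseAvg; gcongr with i; exact hf i
    _ = C := by simp; field_simp

theorem abs_noiseAvg_le (hd : 1 ≤ d) {h : ℝ} {B : Euc d} {S : Fin d → Euc d} {f : Euc d → ℝ}
    {C : ℝ} (hf : ∀ i, |f (h • B + √(h * d) • S i)| ≤ C ∧ |f (h • B - √(h * d) • S i)| ≤ C) :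
    |noiseAvg h B S f| ≤ C := by
  rw [abs_le]
  constructor
  · have : noiseAvg h B S (fun x => -f x) ≤ C := noiseAvg_le hd fun i => by
      have := abs_le.mp (hf i).1; have := abs_le.mp (hf i).2; linarith
    have e : noiseAvg h B S (fun x => -f x) = - noiseAvg h B S f := by
      unfold noiseAvg; rw [← Finset.sum_neg_distrib]; congr 1; ext i; ring
    linarith
  · exact noiseAvg_le hd fun i => by
      have := abs_le.mp (hf i).1; have := abs_le.mp (hf i).2; linarith

/-- The second order operator with drift `B` and diffusion `∑ S i ⊗ S i`, applied to `φ`. -/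
def diffOp (B : Euc d) (S : Fin d → Euc d) (φ : Euc d → ℝ) (x : Euc d) : ℝ :=
  fderiv ℝ φ x B + (1 / 2) * ∑ i, fderiv ℝ (fderiv ℝ φ) x (S i) (S i)

theorem abs_taylor_two_le {φ : Euc d → ℝ} (hφ : ContDiff ℝ 2 φ) {x v : Euc d} {w : ℝ}
    (hw : ∀ t ∈ Icc (0:ℝ) 1, ‖fderiv ℝ (fderiv ℝ φ) (x + t • v) - fderiv ℝ (fderiv ℝ φ) x‖ ≤ w) :
    |φ (x + v) - φ x - fderiv ℝ φ x v - (1 / 2) * fderiv ℝ (fderiv ℝ φ) x v v|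
      ≤ (1 / 2) * w * ‖v‖ ^ 2 := by
  have h1 : ContDiff ℝ 1 (fderiv ℝ φ) := hφ.fderiv_right (by norm_num)
  have hl : ∀ t : ℝ, HasDerivAt (fun t : ℝ => x + t • v) v t := fun t => by
    simpa using ((hasDerivAt_id t).smul_const v).const_add x
  set g : ℝ → ℝ := fun t => φ (x + t • v) - t * fderiv ℝ φ x v
    - t ^ 2 / 2 * fderiv ℝ (fderiv ℝ φ) x v v with hg
  set g' : ℝ → ℝ := fun t => fderiv ℝ φ (x + t • v) v - fderiv ℝ φ x v
    - t * fderiv ℝ (fderiv ℝ φ) x v v with hg'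
  have d1 : ∀ t, HasDerivAt g (g' t) t := by
    intro t
    have a1 : HasDerivAt (fun t : ℝ => φ (x + t • v)) (fderiv ℝ φ (x + t • v) v) t :=
      ((hφ.differentiable (by norm_num)).differentiableAt.hasFDerivAt).comp_hasDerivAt t (hl t)
    have a2 := ((hasDerivAt_id t).mul_const (fderiv ℝ φ x v))
    have a3 := (((hasDerivAt_pow 2 t).div_const 2).mul_const (fderiv ℝ (fderiv ℝ φ) x v v))
    refine ((a1.sub a2).sub a3).congr_deriv ?_
    simp [hg']
  have d2 : ∀ t, HasDerivAt g' (fderiv ℝ (fderiv ℝ φ) (x + t • v) v v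
      - fderiv ℝ (fderiv ℝ φ) x v v) t := by
    intro t
    have a0 : HasDerivAt (fun t : ℝ => fderiv ℝ φ (x + t • v))
        (fderiv ℝ (fderiv ℝ φ) (x + t • v) v) t :=
      ((h1.differentiable (by norm_num)).differentiableAt.hasFDerivAt).comp_hasDerivAt t (hl t)
    have a1 := (a0.clm_apply (hasDerivAt_const t v))
    have a2 := ((hasDerivAt_id t).mul_const (fderiv ℝ (fderiv ℝ φ) x v v))
    refine ((a1.sub_const (fderiv ℝ φ x v)).sub a2).congr_deriv ?_
    simp
  have b2 : ∀ t ∈ Icc (0:ℝ) 1, |g' t| ≤ w * ‖v‖ ^ 2 * t := by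
    intro t ht
    have := (convex_Icc (0:ℝ) 1).norm_image_sub_le_of_norm_hasDerivWithin_le
      (f := g') (C := w * ‖v‖ ^ 2) (fun s hs => (d2 s).hasDerivWithinAt) (fun s hs => by
        rw [← sub_apply, ← sub_apply]
        calc _ ≤ ‖fderiv ℝ (fderiv ℝ φ) (x + s • v) - fderiv ℝ (fderiv ℝ φ) x‖ * ‖v‖ * ‖v‖ :=
              ContinuousLinearMap.le_opNorm₂ _ _ _
          _ ≤ w * ‖v‖ * ‖v‖ := by gcongr; exact hw s hs
          _ = _ := by ring)
      (left_mem_Icc.mpr zero_le_one) ht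
    have e0 : g' 0 = 0 := by simp [hg']
    rw [e0, sub_zero, sub_zero, Real.norm_eq_abs, Real.norm_eq_abs, abs_of_nonneg ht.1] at this
    exact this
  have hw0 : 0 ≤ w := by
    refine le_trans ?_ (hw 0 (left_mem_Icc.mpr zero_le_one))
    exact ContinuousLinearMap.opNorm_nonneg _
  have key := image_norm_le_of_norm_deriv_right_le_deriv_boundary (a := 0) (b := 1)
    (f := fun t => g t - g 0) (f' := g') (B := fun t => w * ‖v‖ ^ 2 * t ^ 2 / 2)
    (B' := fun t => w * ‖v‖ ^ 2 * t)
    (fun t _ => ((d1 t).continuousAt.sub continuousAt_const).continuousWithinAt)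
    (fun t _ => ((d1 t).sub_const _).hasDerivWithinAt)
    (by simp) (fun t => by
      have := ((hasDerivAt_pow 2 t).const_mul (w * ‖v‖ ^ 2)).div_const 2
      refine this.congr_deriv ?_
      simp; ring)
    (fun t ht => b2 t (Ico_subset_Icc_self ht)) (right_mem_Icc.mpr zero_le_one)
  have e1 : g 1 - g 0 = φ (x + v) - φ x - fderiv ℝ φ x v
      - (1 / 2) * fderiv ℝ (fderiv ℝ φ) x v v := by
    simp [hg]; ring
  rw [e1, Real.norm_eq_abs] at key
  refine key.trans (le_of_eq ?_)
  ring

theorem norm_noise_sq_le {h K : ℝ} (hh : 0 ≤ h) (hh1 : h ≤ 1) {B S : Euc d}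
    (hB : ‖B‖ ≤ K) (hS : ‖S‖ ≤ K) (r : ℝ) (hr : r = √(h * d) ∨ r = -√(h * d)) :
    ‖h • B + r • S‖ ^ 2 ≤ h * (2 * K ^ 2 * (1 + d)) := by
  have hr2 : r ^ 2 = h * d := by
    rcases hr with rfl | rfl
    · exact Real.sq_sqrt (by positivity)
    · rw [neg_sq]; exact Real.sq_sqrt (by positivity)
  have h1 : ‖h • B + r • S‖ ^ 2 ≤ 2 * (‖h • B‖ ^ 2 + ‖r • S‖ ^ 2) := by
    have := norm_add_le (h • B) (r • S)
    have h2 := pow_le_pow_left₀ (norm_nonneg _) this 2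
    nlinarith [sq_nonneg (‖h • B‖ - ‖r • S‖)]
  have h2 : ‖h • B‖ ^ 2 ≤ h * K ^ 2 := by
    rw [norm_smul, mul_pow, Real.norm_eq_abs, sq_abs]
    have : ‖B‖ ^ 2 ≤ K ^ 2 := by gcongr
    calc h ^ 2 * ‖B‖ ^ 2 ≤ h * K ^ 2 := by gcongr; nlinarith
      _ = _ := rfl
  have h3 : ‖r • S‖ ^ 2 ≤ h * d * K ^ 2 := by
    rw [norm_smul, mul_pow, Real.norm_eq_abs, sq_abs, hr2]
    gcongr
  nlinarith

theorem abs_noiseAvg_sub_le (hd : 1 ≤ d) {φ : Euc d → ℝ} (hφ : ContDiff ℝ 2 φ) {x : Euc d}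
    {h K C w : ℝ} (hh : 0 ≤ h) (hh1 : h ≤ 1) {B : Euc d} {S : Fin d → Euc d} (hB : ‖B‖ ≤ K)
    (hS : ∀ i, ‖S i‖ ≤ K) (hC : ‖fderiv ℝ (fderiv ℝ φ) x‖ ≤ C)
    (hw : ∀ v, ‖v‖ ^ 2 ≤ h * (2 * K ^ 2 * (1 + d)) →
      ‖fderiv ℝ (fderiv ℝ φ) (x + v) - fderiv ℝ (fderiv ℝ φ) x‖ ≤ w) :
    |noiseAvg h B S (fun z => φ (x + z)) - φ x - h * diffOp B S φ x|
      ≤ h * (K ^ 2 * (1 + d) * w + h * C * K ^ 2) := by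
  have hd0 : (0 : ℝ) < d := by exact_mod_cast hd
  have hK : 0 ≤ K := (norm_nonneg _).trans hB
  have hw0 : 0 ≤ w := by
    refine le_trans ?_ (hw 0 (by simp; positivity))
    exact ContinuousLinearMap.opNorm_nonneg _
  set D := fderiv ℝ (fderiv ℝ φ) x with hD
  have hR : ∀ i, ∀ r, (r = √(h * d) ∨ r = -√(h * d)) →
      |φ (x + (h • B + r • S i)) - φ x - fderiv ℝ φ x (h • B + r • S i)
        - (1 / 2) * D (h • B + r • S i) (h • B + r • S i)| ≤ h * (K ^ 2 * (1 + d) * w) := by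
    intro i r hr
    have hn := norm_noise_sq_le hh hh1 hB (hS i) r hr
    refine (abs_taylor_two_le hφ (w := w) ?_).trans ?_
    · intro t ht
      apply hw
      rw [norm_smul, mul_pow]
      refine le_trans ?_ hn
      have : ‖t‖ ^ 2 ≤ 1 := by
        rw [Real.norm_eq_abs, sq_abs]; nlinarith [ht.1, ht.2]
      exact mul_le_of_le_one_left (by positivity) this
    · calc _ ≤ (1 / 2) * w * (h * (2 * K ^ 2 * (1 + d))) := by gcongr
        _ = _ := by ring
  have hBB : |h ^ 2 / 2 * D B B| ≤ h ^ 2 * (C * K ^ 2) := by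
    have hC0 : 0 ≤ C := (ContinuousLinearMap.opNorm_nonneg _).trans hC
    have h1 : |D B B| ≤ C * K * K := (ContinuousLinearMap.le_opNorm₂ D B B).trans (by gcongr)
    rw [abs_mul, abs_of_nonneg (by positivity : 0 ≤ h ^ 2 / 2)]
    have : 0 ≤ h ^ 2 * (C * K * K) := by positivity
    nlinarith [mul_le_mul_of_nonneg_left h1 (sq_nonneg h)]
  have hsq : √(h * d) * √(h * d) = h * d := Real.mul_self_sqrt (by positivity)
  have e : noiseAvg h B S (fun z => φ (x + z)) - φ x - h * diffOp B S φ x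
      = noiseAvg h B S (fun z => φ (x + z) - φ x - fderiv ℝ φ x z - (1 / 2) * D z z)
        + h ^ 2 / 2 * D B B := by
    have e1 : noiseAvg h B S (fun z => φ (x + z) - φ x - fderiv ℝ φ x z - (1 / 2) * D z z)
        = noiseAvg h B S (fun z => φ (x + z)) - ∑ i : Fin d, (2 * d : ℝ)⁻¹ * (2 * φ x
          + 2 * h * fderiv ℝ φ x B + h ^ 2 * D B B + h * d * D (S i) (S i)) := by
      unfold noiseAvg
      rw [← Finset.sum_sub_distrib]
      congr 1 with i
      simp only [map_add, map_sub, map_smul, add_apply,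
        sub_apply, smul_apply, smul_eq_mul]
      linear_combination (-(2 * d : ℝ)⁻¹ * (D (S i)) (S i)) * hsq
    rw [e1]
    simp only [← Finset.mul_sum, Finset.sum_add_distrib, Finset.sum_const, Finset.card_univ,
      Fintype.card_fin, nsmul_eq_mul, diffOp]
    field_simp
    ring
  rw [e]
  refine (abs_add_le _ _).trans ?_
  have := abs_noiseAvg_le hd (h := h) (B := B) (S := S) (C := h * (K ^ 2 * (1 + d) * w))
    (f := fun z => φ (x + z) - φ x - fderiv ℝ φ x z - (1 / 2) * D z z) (fun i => by
      refine ⟨hR i _ (Or.inl rfl), ?_⟩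
      have := hR i _ (Or.inr rfl)
      rwa [neg_smul, ← sub_eq_add_neg] at this)
  linarith [this, hBB]

/-- The constant in the conditional moment bounds of one step of the chain. -/
def stepConst (d : ℕ) (K : ℝ) : ℝ := 3 + 8 * K ^ 2 + 12 * d * K ^ 2 + (4 + 12 * d + d ^ 2) * K ^ 4

theorem norm_add_drift_sq_le {h K : ℝ} (hh : 0 ≤ h) (hh1 : h ≤ 1) {B : Euc d} (hB : ‖B‖ ≤ K)
    (x : Euc d) : ‖x + h • B‖ ^ 2 ≤ (1 + h) * ‖x‖ ^ 2 + 2 * h * K ^ 2 := by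
  have hK : 0 ≤ K := (norm_nonneg _).trans hB
  have h1 : ‖x + h • B‖ ≤ ‖x‖ + h * K := by
    refine (norm_add_le _ _).trans ?_
    rw [norm_smul, Real.norm_eq_abs, abs_of_nonneg hh]; gcongr
  have h2 := pow_le_pow_left₀ (norm_nonneg _) h1 2
  have h3 : h ^ 2 * K ^ 2 ≤ h * K ^ 2 := by gcongr; nlinarith
  nlinarith [mul_nonneg hh (sq_nonneg (‖x‖ - K))]

theorem noise_pair_sq {h : ℝ} (hh : 0 ≤ h) (P S : Euc d) :
    ‖P + √(h * d) • S‖ ^ 2 + ‖P - √(h * d) • S‖ ^ 2 = 2 * (‖P‖ ^ 2 + h * d * ‖S‖ ^ 2) := by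
  have := parallelogram_law_with_norm ℝ P (√(h * d) • S)
  have e : ‖√(h * d) • S‖ ^ 2 = h * d * ‖S‖ ^ 2 := by
    rw [norm_smul, mul_pow, Real.norm_eq_abs, sq_abs, Real.sq_sqrt (by positivity)]
  rw [← e]; nlinarith

theorem noise_pair_pow_four_le {h : ℝ} (hh : 0 ≤ h) (P S : Euc d) :
    ‖P + √(h * d) • S‖ ^ 4 + ‖P - √(h * d) • S‖ ^ 4
      ≤ 2 * (‖P‖ ^ 4 + 6 * ‖P‖ ^ 2 * (h * d * ‖S‖ ^ 2) + (h * d * ‖S‖ ^ 2) ^ 2) := by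
  have e : ‖√(h * d) • S‖ ^ 2 = h * d * ‖S‖ ^ 2 := by
    rw [norm_smul, mul_pow, Real.norm_eq_abs, sq_abs, Real.sq_sqrt (by positivity)]
  rw [← e]
  set R := √(h * d) • S
  have h1 := norm_add_sq_real P R
  have h2 := norm_sub_sq_real P R
  have h3 := real_inner_mul_inner_self_le P R
  rw [real_inner_self_eq_norm_sq, real_inner_self_eq_norm_sq] at h3
  have e4 : ∀ y : Euc d, ‖y‖ ^ 4 = (‖y‖ ^ 2) ^ 2 := fun y => by ring
  rw [e4 (P + R), e4 (P - R), h1, h2]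
  nlinarith

theorem noiseAvg_sq_le (hd : 1 ≤ d) {h K : ℝ} (hh : 0 ≤ h) (hh1 : h ≤ 1) {B : Euc d}
    {S : Fin d → Euc d} (hB : ‖B‖ ≤ K) (hS : ∀ i, ‖S i‖ ≤ K) (x : Euc d) :
    noiseAvg h B S (fun z => ‖x + z‖ ^ 2)
      ≤ (1 + stepConst d K * h) * ‖x‖ ^ 2 + stepConst d K * h := by
  apply noiseAvg_le hd
  intro i
  rw [← add_assoc, ← add_sub_assoc, noise_pair_sq hh]
  have h1 := norm_add_drift_sq_le hh hh1 hB x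
  have h2 : h * d * ‖S i‖ ^ 2 ≤ h * d * K ^ 2 := by gcongr; exact hS i
  have h3 : 1 ≤ stepConst d K := by unfold stepConst; nlinarith [sq_nonneg K, sq_nonneg (K ^ 2),
    (Nat.cast_nonneg d : (0:ℝ) ≤ d), (by positivity : 0 ≤ 12 * d * K ^ 2),
    (by positivity : 0 ≤ (4 + 12 * d + d ^ 2) * K ^ 4)]
  have h4 : 2 * K ^ 2 + d * K ^ 2 ≤ stepConst d K := by
    unfold stepConst; nlinarith [sq_nonneg K, (by positivity : 0 ≤ d * K ^ 2),
      (by positivity : 0 ≤ (4 + 12 * d + d ^ 2) * K ^ 4)]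
  have h5 : h * ‖x‖ ^ 2 ≤ stepConst d K * h * ‖x‖ ^ 2 := by
    gcongr; nlinarith
  nlinarith

theorem noiseAvg_pow_four_le (hd : 1 ≤ d) {h K : ℝ} (hh : 0 ≤ h) (hh1 : h ≤ 1) {B : Euc d}
    {S : Fin d → Euc d} (hB : ‖B‖ ≤ K) (hS : ∀ i, ‖S i‖ ≤ K) (x : Euc d) :
    noiseAvg h B S (fun z => ‖x + z‖ ^ 4)
      ≤ (1 + stepConst d K * h) * ‖x‖ ^ 4 + stepConst d K * h * ‖x‖ ^ 2
        + stepConst d K * h ^ 2 := by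
  apply noiseAvg_le hd
  intro i
  rw [← add_assoc, ← add_sub_assoc]
  refine (noise_pair_pow_four_le hh _ _).trans ?_
  have h1 := norm_add_drift_sq_le hh hh1 hB x
  set P := ‖x + h • B‖ ^ 2 with hP
  have hP0 : 0 ≤ P := by positivity
  have hPP : ‖x + h • B‖ ^ 4 = P ^ 2 := by rw [hP]; ring
  have hx4 : ‖x‖ ^ 4 = (‖x‖ ^ 2) ^ 2 := by ring
  rw [hPP, hx4]
  set X := ‖x‖ ^ 2
  have hX0 : 0 ≤ X := by positivity
  have h2 : h * d * ‖S i‖ ^ 2 ≤ h * d * K ^ 2 := by gcongr; exact hS i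
  set q := h * d * ‖S i‖ ^ 2
  have hq0 : 0 ≤ q := by positivity
  have s1 : P ^ 2 ≤ ((1 + h) * X + 2 * h * K ^ 2) ^ 2 := by gcongr
  have s2 : 6 * P * q ≤ 6 * ((1 + h) * X + 2 * h * K ^ 2) * (h * d * K ^ 2) := by gcongr
  have s3 : q ^ 2 ≤ (h * d * K ^ 2) ^ 2 := by gcongr
  have hs : P ^ 2 + 6 * P * q + q ^ 2
      ≤ ((1 + h) * X + 2 * h * K ^ 2) ^ 2
        + 6 * ((1 + h) * X + 2 * h * K ^ 2) * (h * d * K ^ 2) + (h * d * K ^ 2) ^ 2 := by linarith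
  have hh2 : h * h ≤ h := by nlinarith
  have t1 : ((1 + h) * X + 2 * h * K ^ 2) ^ 2
      ≤ (1 + 3 * h) * X ^ 2 + 8 * h * K ^ 2 * X + 4 * h ^ 2 * K ^ 4 := by
    have a1 : h * h * X ^ 2 ≤ h * X ^ 2 := by gcongr
    have a2 : h * h * (K ^ 2 * X) ≤ h * (K ^ 2 * X) := by gcongr
    nlinarith
  have t2 : 6 * ((1 + h) * X + 2 * h * K ^ 2) * (h * d * K ^ 2)
      ≤ 12 * d * K ^ 2 * h * X + 12 * d * h ^ 2 * K ^ 4 := by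
    have a2 : h * h * (d * K ^ 2 * X) ≤ h * (d * K ^ 2 * X) := by gcongr
    nlinarith
  have u1 : 0 ≤ (8 * K ^ 2 + 12 * d * K ^ 2 + (4 + 12 * d + d ^ 2) * K ^ 4) * (h * X ^ 2) := by
    positivity
  have u2 : 0 ≤ (3 + (4 + 12 * d + d ^ 2) * K ^ 4) * (h * X) := by positivity
  have u3 : 0 ≤ (3 + 8 * K ^ 2 + 12 * d * K ^ 2) * h ^ 2 := by positivity
  unfold stepConst
  nlinarith

end Noise

section Mollify

open scoped Convolution ContDiff

variable {d : ℕ} {F' G' : Type*} [NormedAddCommGroup F'] [NormedSpace ℝ F']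
  [NormedAddCommGroup G'] [NormedSpace ℝ G'] (L : ℝ →L[ℝ] F' →L[ℝ] G')

theorem norm_convolution_le_of_abs_le_one {f : Euc d → ℝ} (hf : ∀ x, |f x| ≤ 1)
    {g : Euc d → F'} (hg : Continuous g) (hgc : HasCompactSupport g) (x : Euc d) :
    ‖(f ⋆[L, volume] g) x‖ ≤ ‖L‖ * ∫ y, ‖g y‖ := by
  rw [convolution_def, ← integral_const_mul]
  rw [← integral_sub_left_eq_self (fun y => ‖L‖ * ‖g y‖) volume x]
  apply norm_integral_le_of_norm_le
  · exact ((hg.integrable_of_hasCompactSupport hgc).norm.const_mul _).comp_sub_left x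
  · filter_upwards with t
    calc ‖L (f t) (g (x - t))‖ ≤ ‖L‖ * ‖f t‖ * ‖g (x - t)‖ := L.le_opNorm₂ _ _
      _ ≤ ‖L‖ * 1 * ‖g (x - t)‖ := by gcongr; exact hf t
      _ = _ := by ring

theorem norm_convolution_sub_le {f : Euc d → ℝ} (hfm : Measurable f) (hf : ∀ x, |f x| ≤ 1)
    {g : Euc d → F'} (hg : Continuous g) (hgc : HasCompactSupport g) (x v : Euc d) :
    ‖(f ⋆[L, volume] g) (x + v) - (f ⋆[L, volume] g) x‖ ≤ ‖L‖ * ∫ y, ‖g (y + v) - g y‖ := by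
  have hgi : Integrable g := hg.integrable_of_hasCompactSupport hgc
  have hfl : LocallyIntegrable f volume := by
    refine (locallyIntegrable_const (1:ℝ)).mono hfm.aestronglyMeasurable ?_
    filter_upwards with t
    simpa using hf t
  have hex := hgc.convolutionExists_right L hfl hg
  rw [convolution_def, convolution_def, ← integral_sub (hex _) (hex _), ← integral_const_mul]
  rw [← integral_sub_left_eq_self (fun y => ‖L‖ * ‖g (y + v) - g y‖) volume x]
  apply norm_integral_le_of_norm_le
  · exact ((((hgi.comp_add_right v).sub hgi).norm).const_mul _).comp_sub_left x
  · filter_upwards with t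
    rw [← map_sub]
    calc ‖L (f t) (g (x + v - t) - g (x - t))‖
        ≤ ‖L‖ * ‖f t‖ * ‖g (x + v - t) - g (x - t)‖ := L.le_opNorm₂ _ _
      _ ≤ ‖L‖ * 1 * ‖g (x + v - t) - g (x - t)‖ := by gcongr; exact hf t
      _ = _ := by rw [mul_one, add_sub_right_comm]

theorem exists_integral_norm_translate_sub_le {g : Euc d → F'} (hg : ContDiff ℝ 1 g)
    (hgc : HasCompactSupport g) :
    ∃ C : ℝ, 0 ≤ C ∧ ∀ v : Euc d, ‖v‖ ≤ 1 → ∫ y, ‖g (y + v) - g y‖ ≤ C * ‖v‖ := by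
  obtain ⟨K, hK⟩ := hg.lipschitzWith_of_hasCompactSupport hgc (by norm_num)
  obtain ⟨R, hR⟩ := hgc.isCompact.isBounded.subset_closedBall (0 : Euc d)
  refine ⟨K * volume.real (Metric.closedBall (0 : Euc d) (R + 1)), by positivity, fun v hv => ?_⟩
  have h0 : ∀ y ∉ Metric.closedBall (0 : Euc d) (R + 1), ‖g (y + v) - g y‖ = 0 := by
    intro y hy
    have hy' : R + 1 < ‖y‖ := by simpa using hy
    have z1 : g y = 0 := by
      by_contra hne
      have := hR (subset_tsupport _ hne)
      rw [mem_closedBall_zero_iff] at this; linarith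
    have z2 : g (y + v) = 0 := by
      by_contra hne
      have := hR (subset_tsupport _ hne)
      rw [mem_closedBall_zero_iff] at this
      have := norm_sub_le (y + v) v
      rw [add_sub_cancel_right] at this; linarith
    simp [z1, z2]
  rw [← setIntegral_eq_integral_of_forall_compl_eq_zero h0]
  have := norm_setIntegral_le_of_norm_le_const (μ := volume) (C := K * ‖v‖)
    (f := fun y => ‖g (y + v) - g y‖)
    (measure_closedBall_lt_top (x := (0 : Euc d)) (r := R + 1)) (fun y _ => by
      rw [norm_norm]
      simpa [dist_eq_norm] using hK.dist_le_mul (y + v) y)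
  refine (le_abs_self _).trans (this.trans (le_of_eq ?_))
  ring

theorem exists_norm_convolution_le {g : Euc d → F'} (hg : Continuous g)
    (hgc : HasCompactSupport g) :
    ∃ C : ℝ, 0 ≤ C ∧ ∀ f : Euc d → ℝ, (∀ x, |f x| ≤ 1) → ∀ x, ‖(f ⋆[L, volume] g) x‖ ≤ C :=
  ⟨‖L‖ * ∫ y, ‖g y‖, mul_nonneg L.opNorm_nonneg (integral_nonneg fun _ => norm_nonneg _),
    fun _ hf => norm_convolution_le_of_abs_le_one L hf hg hgc⟩

theorem exists_norm_convolution_sub_le {g : Euc d → F'} (hg : ContDiff ℝ 1 g)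
    (hgc : HasCompactSupport g) :
    ∃ C : ℝ, 0 ≤ C ∧ ∀ f : Euc d → ℝ, Measurable f → (∀ x, |f x| ≤ 1) → ∀ x v : Euc d, ‖v‖ ≤ 1 →
      ‖(f ⋆[L, volume] g) (x + v) - (f ⋆[L, volume] g) x‖ ≤ C * ‖v‖ := by
  obtain ⟨C, hC0, hC⟩ := exists_integral_norm_translate_sub_le hg hgc
  refine ⟨‖L‖ * C, by positivity, fun f hfm hf x v hv => ?_⟩
  refine (norm_convolution_sub_le L hfm hf hg.continuous hgc x v).trans ?_
  rw [mul_assoc]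
  gcongr
  exact hC v hv

theorem exists_fderiv_convolution {g : Euc d → F'} (hg : ContDiff ℝ 1 g)
    (hgc : HasCompactSupport g) :
    ∃ L' : ℝ →L[ℝ] (Euc d →L[ℝ] F') →L[ℝ] (Euc d →L[ℝ] G'), ∀ f : Euc d → ℝ,
      LocallyIntegrable f volume →
      fderiv ℝ (f ⋆[L, volume] g) = f ⋆[L', volume] fderiv ℝ g :=
  ⟨L.precompR (Euc d), fun _ hf => funext fun x =>
    (hgc.hasFDerivAt_convolution_right L hf hg x).fderiv⟩

theorem exists_norm_fderiv_convolution_le {g : Euc d → F'} (hg : ContDiff ℝ 2 g)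
    (hgc : HasCompactSupport g) :
    ∃ C : ℝ, 0 ≤ C ∧ ∀ f : Euc d → ℝ, Measurable f → (∀ x, |f x| ≤ 1) →
      LocallyIntegrable f volume →
      (∀ x, ‖fderiv ℝ (f ⋆[L, volume] g) x‖ ≤ C) ∧ ∀ x v : Euc d, ‖v‖ ≤ 1 →
      ‖fderiv ℝ (f ⋆[L, volume] g) (x + v) - fderiv ℝ (f ⋆[L, volume] g) x‖ ≤ C * ‖v‖ := by
  have hg1 : ContDiff ℝ 1 (fderiv ℝ g) := hg.fderiv_right (by norm_num)
  obtain ⟨L', hL'⟩ := exists_fderiv_convolution L (hg.of_le (by norm_num)) hgc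
  obtain ⟨I, p, hI⟩ := exists_norm_convolution_le L' hg1.continuous (hgc.fderiv ℝ)
  obtain ⟨J, q, hJ⟩ := exists_norm_convolution_sub_le L' hg1 (hgc.fderiv ℝ)
  refine ⟨I + J, by positivity, fun f hfm hf hfl => ?_⟩
  rw [hL' f hfl]
  refine ⟨fun x => (hI f hf x).trans (by linarith), fun x v hv => (hJ f hfm hf x v hv).trans ?_⟩
  gcongr
  linarith

theorem exists_norm_fderiv_fderiv_convolution_le {g : Euc d → F'} (hg : ContDiff ℝ 3 g)
    (hgc : HasCompactSupport g) :
    ∃ C : ℝ, 0 ≤ C ∧ ∀ f : Euc d → ℝ, Measurable f → (∀ x, |f x| ≤ 1) →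
      LocallyIntegrable f volume →
      (∀ x, ‖fderiv ℝ (fderiv ℝ (f ⋆[L, volume] g)) x‖ ≤ C) ∧ ∀ x v : Euc d, ‖v‖ ≤ 1 →
      ‖fderiv ℝ (fderiv ℝ (f ⋆[L, volume] g)) (x + v)
        - fderiv ℝ (fderiv ℝ (f ⋆[L, volume] g)) x‖ ≤ C * ‖v‖ := by
  obtain ⟨L', hL'⟩ := exists_fderiv_convolution L (hg.of_le (by norm_num)) hgc
  obtain ⟨C, hC0, hC⟩ := exists_norm_fderiv_convolution_le L'
    (hg.fderiv_right (m := 2) (by norm_num)) (hgc.fderiv ℝ)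
  refine ⟨C, hC0, fun f hfm hf hfl => ?_⟩
  rw [hL' f hfl]
  exact hC f hfm hf hfl

theorem convolution_lsmul_apply (f ρ : Euc d → ℝ) (x : Euc d) :
    (f ⋆[ContinuousLinearMap.lsmul ℝ ℝ, volume] ρ) x = ∫ t, f t * ρ (x - t) := by
  simp only [convolution_def, ContinuousLinearMap.lsmul_apply, smul_eq_mul]

theorem hasCompactSupport_convolution_lsmul {f ρ : Euc d → ℝ} (hf : HasCompactSupport f)
    (hρ : HasCompactSupport ρ) :
    HasCompactSupport (f ⋆[ContinuousLinearMap.lsmul ℝ ℝ, volume] ρ) :=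
  HasCompactSupport.convolution (L := ContinuousLinearMap.lsmul ℝ ℝ) (μ := volume) hf hρ

theorem contDiff_convolution_lsmul {f ρ : Euc d → ℝ} (hf : LocallyIntegrable f volume)
    (hρc : HasCompactSupport ρ) (hρ : ContDiff ℝ ∞ ρ) :
    ContDiff ℝ ∞ (f ⋆[ContinuousLinearMap.lsmul ℝ ℝ, volume] ρ) :=
  hρc.contDiff_convolution_right _ hf hρ

theorem exists_bound_convolution {ρ : Euc d → ℝ} (hρ : ContDiff ℝ ∞ ρ)
    (hρc : HasCompactSupport ρ) :
    ∃ C : ℝ, 0 ≤ C ∧ ∀ f : Euc d → ℝ, Measurable f → (∀ x, |f x| ≤ 1) → HasCompactSupport f →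
      ∃ F : Euc d → ℝ, (∀ x, F x = ∫ t, f t * ρ (x - t)) ∧ ContDiff ℝ ∞ F ∧
        HasCompactSupport F ∧ (∀ x, ‖fderiv ℝ F x‖ ≤ C) ∧
        (∀ x, ‖fderiv ℝ (fderiv ℝ F) x‖ ≤ C) ∧
        ∀ x v, ‖v‖ ≤ 1 → ‖fderiv ℝ (fderiv ℝ F) (x + v) - fderiv ℝ (fderiv ℝ F) x‖ ≤ C * ‖v‖ := by
  set L : ℝ →L[ℝ] ℝ →L[ℝ] ℝ := ContinuousLinearMap.lsmul ℝ ℝ with hL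
  have h2 : ContDiff ℝ 2 ρ := hρ.of_le (by norm_cast)
  have h3 : ContDiff ℝ 3 ρ := hρ.of_le (by norm_cast)
  obtain ⟨C₁, h₁, hC₁⟩ := exists_norm_fderiv_convolution_le L h2 hρc
  obtain ⟨C₂, h₂, hC₂⟩ := exists_norm_fderiv_fderiv_convolution_le L h3 hρc
  refine ⟨C₁ + C₂, add_nonneg h₁ h₂, ?_⟩
  intro f hfm hf hfc
  have hfl : LocallyIntegrable f volume := by
    refine (locallyIntegrable_const (1:ℝ)).mono hfm.aestronglyMeasurable ?_
    filter_upwards with t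
    simpa using hf t
  obtain ⟨a₁, -⟩ := hC₁ f hfm hf hfl
  obtain ⟨a₂, a₃⟩ := hC₂ f hfm hf hfl
  have e1 : ∀ x, (f ⋆[L, volume] ρ) x = ∫ t, f t * ρ (x - t) := by
    exact convolution_lsmul_apply f ρ
  have e2 : ContDiff ℝ ∞ (f ⋆[L, volume] ρ) := contDiff_convolution_lsmul hfl hρc hρ
  have e3 : HasCompactSupport (f ⋆[L, volume] ρ) := hasCompactSupport_convolution_lsmul hfc hρc
  generalize hF : f ⋆[L, volume] ρ = F at *
  refine ⟨F, e1, e2, e3, fun x => (a₁ x).trans (by linarith), fun x => (a₂ x).trans (by linarith),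
    fun x v hv => (a₃ x v hv).trans ?_⟩
  gcongr
  linarith

end Mollify

section NoiseKernel

variable {d : ℕ} {U : Type*} [MeasurableSpace U]

/-- The law of a symmetric random walk step with drift `B` and diffusion vectors `S`. -/
def noiseMeasure (h : ℝ) (B : Euc d) (S : Fin d → Euc d) : Measure (Euc d) :=
  ∑ i, ENNReal.ofReal ((2 * d : ℝ)⁻¹) • (Measure.dirac (h • B + √(h * d) • S i)
    + Measure.dirac (h • B - √(h * d) • S i))

theorem lintegral_noiseMeasure (h : ℝ) (B : Euc d) (S : Fin d → Euc d) {f : Euc d → ℝ}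
    (hf : ∀ x, 0 ≤ f x) :
    ∫⁻ z, ENNReal.ofReal (f z) ∂(noiseMeasure h B S) = ENNReal.ofReal (noiseAvg h B S f) := by
  unfold noiseMeasure noiseAvg
  rw [lintegral_finsetSum_measure, ENNReal.ofReal_sum_of_nonneg]
  · refine Finset.sum_congr rfl fun i _ => ?_
    rw [lintegral_smul_measure, lintegral_add_measure, lintegral_dirac, lintegral_dirac,
      ENNReal.ofReal_mul (by positivity), ENNReal.ofReal_add (hf _) (hf _), smul_eq_mul]
  · intro i _
    have := hf (h • B + √(h * d) • S i)
    have := hf (h • B - √(h * d) • S i)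
    positivity

theorem isProbabilityMeasure_noiseMeasure (hd : 1 ≤ d) (h : ℝ) (B : Euc d) (S : Fin d → Euc d) :
    IsProbabilityMeasure (noiseMeasure h B S) := by
  have hd0 : (d : ℝ) ≠ 0 := by positivity
  constructor
  have := lintegral_noiseMeasure h B S (f := fun _ => 1) (by simp)
  rw [ENNReal.ofReal_one, lintegral_one] at this
  rw [this]
  have : noiseAvg h B S (fun _ => (1:ℝ)) = 1 := by
    simp [noiseAvg]
    field_simp
    norm_num
  rw [this, ENNReal.ofReal_one]

theorem integral_noiseMeasure (h : ℝ) (B : Euc d) (S : Fin d → Euc d) (f : Euc d → ℝ) :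
    ∫ z, f z ∂(noiseMeasure h B S) = noiseAvg h B S f := by
  unfold noiseMeasure noiseAvg
  have hi : ∀ x, Integrable f (Measure.dirac x) := fun x => integrable_dirac (by finiteness)
  rw [integral_finsetSum_measure]
  · refine Finset.sum_congr rfl fun i _ => ?_
    rw [integral_smul_measure, integral_add_measure (hi _) (hi _), integral_dirac, integral_dirac,
      ENNReal.toReal_ofReal (by positivity), smul_eq_mul]
  · intro i _
    exact ((hi _).add_measure (hi _)).smul_measure ENNReal.ofReal_ne_top

/-- The kernel associated with `noiseMeasure`. -/
def noiseKernel (h : ℝ) {β : U → Euc d} {σ : U → Fin d → Euc d} (hβ : Measurable β)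
    (hσ : ∀ i, Measurable fun u => σ u i) : Kernel U (Euc d) where
  toFun u := noiseMeasure h (β u) (σ u)
  measurable' := by
    refine Measure.measurable_of_measurable_coe _ fun s hs => ?_
    unfold noiseMeasure
    simp only [Measure.coe_finsetSum, Finset.sum_apply, Measure.smul_apply, Measure.add_apply,
      smul_eq_mul, Measure.dirac_apply' _ hs]
    refine Finset.measurable_sum _ fun i _ => ?_
    have := hσ i
    refine Measurable.const_mul (Measurable.add ?_ ?_) _
    · exact (measurable_one.indicator hs).comp (g := s.indicator (1 : Euc d → ℝ≥0∞))
        (f := fun u => h • β u + √(h * d) • σ u i) (by fun_prop)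
    · exact (measurable_one.indicator hs).comp (g := s.indicator (1 : Euc d → ℝ≥0∞))
        (f := fun u => h • β u - √(h * d) • σ u i) (by fun_prop)

end NoiseKernel

section DiffOpBounds

variable {d : ℕ}

theorem measurable_diffOp {β : ℝ × Euc d → Euc d} {σ : ℝ × Euc d → Fin d → Euc d}
    (hb : Measurable β) (hs : ∀ i, Measurable fun u => σ u i) {φ : Euc d → ℝ}
    (hφ : ContDiff ℝ 2 φ) : Measurable fun u => diffOp (β u) (σ u) φ u.2 := by
  have h1 : ContDiff ℝ 1 (fderiv ℝ φ) := hφ.fderiv_right (by norm_num)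
  have c1 : Measurable fun u : ℝ × Euc d => fderiv ℝ φ u.2 :=
    (h1.continuous.comp continuous_snd).measurable
  have c2 : Measurable fun u : ℝ × Euc d => fderiv ℝ (fderiv ℝ φ) u.2 :=
    ((h1.continuous_fderiv (by norm_num)).comp continuous_snd).measurable
  unfold diffOp
  refine Measurable.add ?_ (Measurable.const_mul (Finset.measurable_sum _ fun i _ => ?_) _)
  · exact (isBoundedBilinearMap_apply.continuous (𝕜 := ℝ)).measurable.comp (c1.prodMk hb)
  · have : Measurable fun u : ℝ × Euc d => fderiv ℝ (fderiv ℝ φ) u.2 (σ u i) :=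
      (isBoundedBilinearMap_apply.continuous (𝕜 := ℝ)).measurable.comp (c2.prodMk (hs i))
    exact (isBoundedBilinearMap_apply.continuous (𝕜 := ℝ)).measurable.comp (this.prodMk (hs i))

theorem abs_diffOp_le {B : Euc d} {S : Fin d → Euc d} {K : ℝ} (hB : ‖B‖ ≤ K)
    (hS : ∀ i, ‖S i‖ ≤ K) {φ : Euc d → ℝ} {C : ℝ} (h1 : ∀ x, ‖fderiv ℝ φ x‖ ≤ C)
    (h2 : ∀ x, ‖fderiv ℝ (fderiv ℝ φ) x‖ ≤ C) (x : Euc d) :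
    |diffOp B S φ x| ≤ C * K + d * (C * K ^ 2) := by
  have hC : 0 ≤ C := le_trans (ContinuousLinearMap.opNorm_nonneg _) (h1 0)
  unfold diffOp
  refine (abs_add_le _ _).trans (add_le_add ?_ ?_)
  · refine ((fderiv ℝ φ x).le_opNorm _).trans ?_
    exact mul_le_mul (h1 _) hB (norm_nonneg _) hC
  · rw [abs_mul]
    have : |∑ i, fderiv ℝ (fderiv ℝ φ) x (S i) (S i)| ≤ ∑ _i : Fin d, C * K ^ 2 := by
      refine (Finset.abs_sum_le_sum_abs _ _).trans (Finset.sum_le_sum fun i _ => ?_)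
      refine ((fderiv ℝ (fderiv ℝ φ) x).le_opNorm₂ _ _).trans ?_
      have := hS i
      rw [mul_assoc, ← sq]
      exact mul_le_mul (h2 _) (by gcongr) (by positivity) hC
    rw [Finset.sum_const, Finset.card_univ, Fintype.card_fin, nsmul_eq_mul] at this
    rw [abs_of_nonneg (by norm_num : (0:ℝ) ≤ 1 / 2)]
    have h0 : 0 ≤ (d : ℝ) * (C * K ^ 2) := by positivity
    linarith

end DiffOpBounds

/-- A weakly continuous flow of probability measures solving a linear Fokker-Planck equation
with bounded measurable coefficients. -/
structure FPFlow (d : ℕ) where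
  ν : Kernel ℝ (Euc d)
  markov : IsMarkovKernel ν
  β : ℝ × Euc d → Euc d
  σ : ℝ × Euc d → Fin d → Euc d
  measurable_β : Measurable β
  measurable_σ : ∀ i, Measurable fun u => σ u i
  K : ℝ
  norm_β_le : ∀ u, ‖β u‖ ≤ K
  norm_σ_le : ∀ u i, ‖σ u i‖ ≤ K
  eqn : ∀ φ : Euc d → ℝ, ContDiff ℝ (⊤ : ℕ∞) φ → HasCompactSupport φ → ∀ s t, 0 ≤ s → s ≤ t →
    ∫ y, φ y ∂(ν t) - ∫ y, φ y ∂(ν s)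
      = ∫ r in s..t, ∫ y, diffOp (β (r, y)) (σ (r, y)) φ y ∂(ν r)

namespace FPFlow

variable {d : ℕ} (D : FPFlow d)

instance : IsMarkovKernel D.ν := D.markov

theorem K_nonneg : 0 ≤ D.K := (norm_nonneg _).trans (D.norm_β_le 0)

/-- The generator of the flow at a time-space point. -/
def gen (φ : Euc d → ℝ) (u : ℝ × Euc d) : ℝ := diffOp (D.β u) (D.σ u) φ u.2

theorem measurable_gen {φ : Euc d → ℝ} (hφ : ContDiff ℝ 2 φ) : Measurable (D.gen φ) :=
  measurable_diffOp D.measurable_β D.measurable_σ hφ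

theorem abs_gen_le {φ : Euc d → ℝ} {C : ℝ} (h1 : ∀ x, ‖fderiv ℝ φ x‖ ≤ C)
    (h2 : ∀ x, ‖fderiv ℝ (fderiv ℝ φ) x‖ ≤ C) (u : ℝ × Euc d) :
    |D.gen φ u| ≤ C * D.K + d * (C * D.K ^ 2) :=
  abs_diffOp_le (D.norm_β_le u) (D.norm_σ_le u) h1 h2 u.2

end FPFlow

namespace FPFlow

variable {d : ℕ} (D : FPFlow d)

theorem integrable_of_abs_le {α : Type*} [MeasurableSpace α] {μ : Measure α} [IsFiniteMeasure μ]
    {f : α → ℝ} (hf : Measurable f) {C : ℝ} (hC : ∀ x, |f x| ≤ C) : Integrable f μ :=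
  Integrable.of_bound hf.aestronglyMeasurable C (ae_of_all _ hC)

theorem abs_integral_le_of_abs_le {α : Type*} [MeasurableSpace α] {μ : Measure α}
    [IsProbabilityMeasure μ] {f : α → ℝ} {C : ℝ} (hC : ∀ x, |f x| ≤ C) : |∫ x, f x ∂μ| ≤ C := by
  simpa using norm_integral_le_of_norm_le_const (μ := μ) (f := f) (C := C) (ae_of_all _ hC)

theorem measurable_integral_ν {f : ℝ × Euc d → ℝ} (hf : Measurable f) :
    Measurable fun s => ∫ y, f (s, y) ∂(D.ν s) := by
  have : StronglyMeasurable fun p : ℝ × Euc d => f p := hf.stronglyMeasurable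
  exact (StronglyMeasurable.integral_kernel_prod_right' (κ := D.ν) this).measurable

theorem intervalIntegrable_of_abs_le {g : ℝ → ℝ} (hg : Measurable g) {C : ℝ}
    (hC : ∀ x, |g x| ≤ C) (a b : ℝ) : IntervalIntegrable g volume a b := by
  constructor <;> exact integrable_of_abs_le hg hC

/-- The time average of the flow over `[τ, τ + δ]`, as a law on space-time. -/
def avg (τ δ : ℝ) : Measure (ℝ × Euc d) :=
  (ENNReal.ofReal δ⁻¹ • volume.restrict (Ioc τ (τ + δ))) ⊗ₘ D.ν

theorem isProbabilityMeasure_time {τ δ : ℝ} (hδ : 0 < δ) :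
    IsProbabilityMeasure (ENNReal.ofReal δ⁻¹ • volume.restrict (Ioc τ (τ + δ))) := by
  constructor
  rw [Measure.smul_apply, Measure.restrict_apply_univ, Real.volume_Ioc, add_sub_cancel_left,
    smul_eq_mul, ← ENNReal.ofReal_mul (by positivity), inv_mul_cancel₀ hδ.ne', ENNReal.ofReal_one]

theorem isProbabilityMeasure_avg {τ δ : ℝ} (hδ : 0 < δ) :
    IsProbabilityMeasure (D.avg τ δ) := by
  have := isProbabilityMeasure_time (τ := τ) hδ
  unfold avg; infer_instance

theorem integral_avg {τ δ : ℝ} (hδ : 0 < δ) {f : ℝ × Euc d → ℝ} (hf : Measurable f) {C : ℝ}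
    (hC : ∀ x, |f x| ≤ C) :
    ∫ u, f u ∂(D.avg τ δ) = δ⁻¹ * ∫ s in τ..τ + δ, ∫ y, f (s, y) ∂(D.ν s) := by
  have := isProbabilityMeasure_time (τ := τ) hδ
  unfold avg
  rw [Measure.integral_compProd (integrable_of_abs_le hf hC), integral_smul_measure,
    ENNReal.toReal_ofReal (by positivity), intervalIntegral.integral_of_le (by linarith),
    smul_eq_mul]

theorem abs_integral_sub_le {φ : Euc d → ℝ} (hφ : ContDiff ℝ (⊤ : ℕ∞) φ)
    (hφc : HasCompactSupport φ) {L : ℝ} (hL : ∀ u, |D.gen φ u| ≤ L) {s t : ℝ} (hs : 0 ≤ s)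
    (hst : s ≤ t) : |∫ y, φ y ∂(D.ν t) - ∫ y, φ y ∂(D.ν s)| ≤ L * (t - s) := by
  rw [D.eqn φ hφ hφc s t hs hst]
  have := intervalIntegral.norm_integral_le_of_norm_le_const (a := s) (b := t) (C := L)
    (f := fun r => ∫ y, diffOp (D.β (r, y)) (D.σ (r, y)) φ y ∂(D.ν r))
    (fun r _ => abs_integral_le_of_abs_le fun y => hL (r, y))
  rwa [abs_of_nonneg (by linarith : 0 ≤ t - s)] at this

theorem abs_avg_step_le {φ : Euc d → ℝ} (hφ : ContDiff ℝ (⊤ : ℕ∞) φ)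
    (hφc : HasCompactSupport φ) {L : ℝ} (hL : ∀ u, |D.gen φ u| ≤ L) {τ δ h : ℝ} (hτ : 0 ≤ τ)
    (hδ : 0 < δ) (hh : 0 ≤ h) :
    |∫ u, φ u.2 ∂(D.avg (τ + h) δ) - ∫ u, φ u.2 ∂(D.avg τ δ) - h * ∫ u, D.gen φ u ∂(D.avg τ δ)|
      ≤ 2 * L * h ^ 2 / δ := by
  obtain ⟨C, hC⟩ := hφ.continuous.bounded_above_of_compact_support hφc
  have hφm : Measurable fun u : ℝ × Euc d => φ u.2 := by
    have := hφ.continuous; fun_prop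
  rw [D.integral_avg hδ hφm fun u => hC u.2, D.integral_avg hδ hφm fun u => hC u.2,
    D.integral_avg hδ (D.measurable_gen (hφ.of_le (by norm_cast))) hL]
  have h1 : ∫ s in τ..τ + δ, ∫ y, D.gen φ (s, y) ∂(D.ν s)
      = ∫ y, φ y ∂(D.ν (τ + δ)) - ∫ y, φ y ∂(D.ν τ) :=
    (D.eqn φ hφ hφc τ (τ + δ) hτ (by linarith)).symm
  rw [h1]
  set G : ℝ → ℝ := fun s => ∫ y, φ y ∂(D.ν s) with hG
  have hGm : Measurable G := D.measurable_integral_ν hφm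
  have hGi : ∀ a b, IntervalIntegrable G volume a b :=
    intervalIntegrable_of_abs_le hGm fun s => abs_integral_le_of_abs_le hC
  have key : ∀ a, 0 ≤ a → |(∫ s in a..a + h, G s) - h * G a| ≤ L * h * h := by
    intro a ha
    have e : (∫ s in a..a + h, G s) - h * G a = ∫ s in a..a + h, (G s - G a) := by
      rw [intervalIntegral.integral_sub (hGi _ _) (by simp)]
      simp
    rw [e]
    have := intervalIntegral.norm_integral_le_of_norm_le_const (a := a) (b := a + h) (C := L * h)
      (f := fun s => G s - G a) (fun r hr => by
        rw [uIoc_of_le (by linarith)] at hr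
        have hL0 : 0 ≤ L := (abs_nonneg _).trans (hL 0)
        refine (D.abs_integral_sub_le hφ hφc hL ha hr.1.le).trans ?_
        have := hr.2
        gcongr; linarith)
    rwa [add_sub_cancel_left, abs_of_nonneg hh] at this
  have e2 : (∫ s in τ + h..τ + h + δ, G s) - ∫ s in τ..τ + δ, G s
      = (∫ s in τ + δ..τ + δ + h, G s) - ∫ s in τ..τ + h, G s := by
    have a1 := intervalIntegral.integral_add_adjacent_intervals (hGi τ (τ + h))
      (hGi (τ + h) (τ + h + δ))
    have a2 := intervalIntegral.integral_add_adjacent_intervals (hGi τ (τ + δ))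
      (hGi (τ + δ) (τ + h + δ))
    rw [show τ + δ + h = τ + h + δ by ring]
    linarith
  have k1 := key (τ + δ) (by linarith)
  have k2 := key τ hτ
  change |δ⁻¹ * (∫ s in τ + h..τ + h + δ, G s) - δ⁻¹ * (∫ s in τ..τ + δ, G s)
    - h * (δ⁻¹ * (G (τ + δ) - G τ))| ≤ _
  have e3 : δ⁻¹ * (∫ s in τ + h..τ + h + δ, G s) - δ⁻¹ * (∫ s in τ..τ + δ, G s)
    - h * (δ⁻¹ * (G (τ + δ) - G τ)) = δ⁻¹ * (((∫ s in τ + δ..τ + δ + h, G s) - h * G (τ + δ))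
      - ((∫ s in τ..τ + h, G s) - h * G τ)) := by
    linear_combination δ⁻¹ * e2
  rw [e3, abs_mul, abs_of_pos (inv_pos.mpr hδ), div_eq_inv_mul]
  gcongr
  refine (abs_sub _ _).trans ?_
  linarith

end FPFlow

section Mollifier

variable {d : ℕ}

/-- The regularity of averages against `κ` of bounded functions, with uniform constant `C`. -/
def IsMollifier (κ : Measure (Euc d)) (C : ℝ) : Prop :=
  ∀ f : Euc d → ℝ, Measurable f → (∀ x, |f x| ≤ 1) → HasCompactSupport f →
    ContDiff ℝ (⊤ : ℕ∞) (fun y => ∫ x, f (y + x) ∂κ) ∧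
    HasCompactSupport (fun y => ∫ x, f (y + x) ∂κ) ∧
    (∀ x, ‖fderiv ℝ (fun y => ∫ x, f (y + x) ∂κ) x‖ ≤ C) ∧
    (∀ x, ‖fderiv ℝ (fderiv ℝ (fun y => ∫ x, f (y + x) ∂κ)) x‖ ≤ C) ∧
    ∀ x v : Euc d, ‖v‖ ≤ 1 → ‖fderiv ℝ (fderiv ℝ (fun y => ∫ x, f (y + x) ∂κ)) (x + v)
      - fderiv ℝ (fderiv ℝ (fun y => ∫ x, f (y + x) ∂κ)) x‖ ≤ C * ‖v‖

theorem exists_isMollifier {ε : ℝ} (hε : 0 < ε) :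
    ∃ κ : Measure (Euc d), IsProbabilityMeasure κ ∧ (∀ᵐ x ∂κ, ‖x‖ ≤ ε) ∧
      ∃ C : ℝ, 0 ≤ C ∧ IsMollifier κ C := by
  let B : ContDiffBump (0 : Euc d) := ⟨ε / 2, ε, by positivity, by linarith⟩
  set ρ : Euc d → ℝ := B.normed volume with hρ
  have hρs : ContDiff ℝ (⊤ : ℕ∞) ρ := B.contDiff_normed
  have hρc : HasCompactSupport ρ := B.hasCompactSupport_normed
  have hρ0 : ∀ x, 0 ≤ ρ x := B.nonneg_normed
  have hρm : Measurable ρ := hρs.continuous.measurable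
  have hρi : Integrable ρ := hρs.continuous.integrable_of_hasCompactSupport hρc
  obtain ⟨C, hC0, hC⟩ := exists_bound_convolution hρs hρc
  refine ⟨volume.withDensity fun x => ENNReal.ofReal (ρ x), ⟨?_⟩, ?_, C, hC0, ?_⟩
  · rw [withDensity_apply _ MeasurableSet.univ, Measure.restrict_univ,
      ← ofReal_integral_eq_lintegral_ofReal hρi (ae_of_all _ hρ0), B.integral_normed,
      ENNReal.ofReal_one]
  · rw [ae_withDensity_iff (by fun_prop)]
    refine ae_of_all _ fun x hx => ?_
    have : x ∈ Function.support ρ := by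
      intro h0; exact hx (by simp [h0])
    rw [hρ, B.support_normed_eq, mem_ball_zero_iff] at this
    exact this.le
  · intro f hf hf1 hfc
    obtain ⟨F, hF, h⟩ := hC f hf hf1 hfc
    have : (fun y => ∫ x, f (y + x) ∂(volume.withDensity fun x => ENNReal.ofReal (ρ x))) = F := by
      funext y
      rw [hF y, integral_withDensity_eq_integral_toReal_smul (by fun_prop) (by simp),
        ← integral_add_left_eq_self (fun t => f t * ρ (y - t)) y]
      refine integral_congr_ae (ae_of_all _ fun x => ?_)
      simp only [ENNReal.toReal_ofReal (hρ0 x), sub_add_cancel_left, smul_eq_mul]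
      rw [hρ, B.normed_neg, mul_comm]
    rw [this]
    exact h

/-- The total variation distance is at most `e`, as tested on functions bounded by one. -/
def TVLe (μ₁ μ₂ : Measure (Euc d)) (e : ℝ) : Prop :=
  ∀ f : Euc d → ℝ, Measurable f → (∀ x, |f x| ≤ 1) → |∫ x, f x ∂μ₁ - ∫ x, f x ∂μ₂| ≤ e

open Filter in
theorem tvLe_of_hasCompactSupport {μ₁ μ₂ : Measure (Euc d)} [IsProbabilityMeasure μ₁]
    [IsProbabilityMeasure μ₂] {e : ℝ}
    (h : ∀ f : Euc d → ℝ, Measurable f → (∀ x, |f x| ≤ 1) → HasCompactSupport f →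
      |∫ x, f x ∂μ₁ - ∫ x, f x ∂μ₂| ≤ e) : TVLe μ₁ μ₂ e := by
  intro f hf hf1
  let g : ℕ → Euc d → ℝ := fun n => (Metric.closedBall (0 : Euc d) n).indicator f
  have hg1 : ∀ n x, |g n x| ≤ 1 := fun n x => by
    simp only [g, indicator]; split_ifs
    · exact hf1 x
    · simp
  have hgm : ∀ n, Measurable (g n) := fun n => hf.indicator measurableSet_closedBall
  have hgl : ∀ x, Tendsto (fun n => g n x) atTop (𝓝 (f x)) := fun x => by
    refine tendsto_const_nhds.congr' ?_
    filter_upwards [eventually_ge_atTop ⌈‖x‖⌉₊] with n hn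
    have : x ∈ Metric.closedBall (0 : Euc d) n := by
      rw [mem_closedBall_zero_iff]
      exact (Nat.le_ceil _).trans (by exact_mod_cast hn)
    simp [g, indicator_of_mem this]
  have lim : ∀ μ : Measure (Euc d), IsProbabilityMeasure μ →
      Tendsto (fun n => ∫ x, g n x ∂μ) atTop (𝓝 (∫ x, f x ∂μ)) := fun μ _ =>
    tendsto_integral_of_dominated_convergence (fun _ => 1)
      (fun n => (hgm n).aestronglyMeasurable) (integrable_const _)
      (fun n => ae_of_all _ (hg1 n)) (ae_of_all _ hgl)
  refine le_of_tendsto ((lim μ₁ inferInstance).sub (lim μ₂ inferInstance)).abs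
    (Eventually.of_forall fun n => h (g n) (hgm n) (hg1 n) ?_)
  exact HasCompactSupport.intro (isCompact_closedBall (0 : Euc d) n)
    fun x hx => indicator_of_notMem hx _

end Mollifier

namespace FPFlow

variable {d : ℕ} (D : FPFlow d) (κ : Measure (Euc d)) [IsProbabilityMeasure κ]

/-- The joint law of a mollified position and the underlying time-space point. -/
def joint (τ δ : ℝ) : Measure (Euc d × (ℝ × Euc d)) :=
  ((D.avg τ δ).prod κ).map fun p => (p.1.2 + p.2, p.1)

theorem isProbabilityMeasure_joint {τ δ : ℝ} (hδ : 0 < δ) :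
    IsProbabilityMeasure (D.joint κ τ δ) := by
  have := D.isProbabilityMeasure_avg (τ := τ) hδ
  exact Measure.isProbabilityMeasure_map (by fun_prop)

theorem integral_joint {τ δ : ℝ} (hδ : 0 < δ) {g : Euc d × (ℝ × Euc d) → ℝ} (hg : Measurable g)
    {C : ℝ} (hC : ∀ p, |g p| ≤ C) :
    ∫ p, g p ∂(D.joint κ τ δ) = ∫ u, ∫ x, g (u.2 + x, u) ∂κ ∂(D.avg τ δ) := by
  have := D.isProbabilityMeasure_avg (τ := τ) hδ
  unfold joint
  rw [integral_map (by fun_prop) hg.aestronglyMeasurable, integral_prod]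
  refine integrable_of_abs_le (hg.comp (by fun_prop)) fun p => hC _

/-- The mollified time-averaged flow. -/
def marg (τ δ : ℝ) : Measure (Euc d) := (D.joint κ τ δ).fst

theorem isProbabilityMeasure_marg {τ δ : ℝ} (hδ : 0 < δ) :
    IsProbabilityMeasure (D.marg κ τ δ) := by
  have := D.isProbabilityMeasure_joint κ (τ := τ) hδ
  unfold marg; infer_instance

theorem integral_marg {τ δ : ℝ} (hδ : 0 < δ) {f : Euc d → ℝ} (hf : Measurable f)
    {C : ℝ} (hC : ∀ p, |f p| ≤ C) :
    ∫ x, f x ∂(D.marg κ τ δ) = ∫ u, ∫ x, f (u.2 + x) ∂κ ∂(D.avg τ δ) := by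
  unfold marg Measure.fst
  rw [integral_map (by fun_prop) hf.aestronglyMeasurable,
    D.integral_joint κ hδ (g := fun p => f p.1) (by fun_prop) fun p => hC _]

/-- The conditional law of the time-space point given the mollified position. -/
def cond (τ δ : ℝ) (hδ : 0 < δ) : Kernel (Euc d) (ℝ × Euc d) :=
  have := D.isProbabilityMeasure_joint κ (τ := τ) hδ
  (D.joint κ τ δ).condKernel

instance (τ δ : ℝ) (hδ : 0 < δ) : IsMarkovKernel (D.cond κ τ δ hδ) := by
  have := D.isProbabilityMeasure_joint κ (τ := τ) hδ
  unfold cond; infer_instance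

theorem integral_cond {τ δ : ℝ} (hδ : 0 < δ) {g : Euc d × (ℝ × Euc d) → ℝ} (hg : Measurable g)
    {C : ℝ} (hC : ∀ p, |g p| ≤ C) :
    ∫ x, ∫ u, g (x, u) ∂(D.cond κ τ δ hδ x) ∂(D.marg κ τ δ)
      = ∫ u, ∫ x, g (u.2 + x, u) ∂κ ∂(D.avg τ δ) := by
  have := D.isProbabilityMeasure_joint κ (τ := τ) hδ
  rw [← D.integral_joint κ hδ hg hC]
  unfold cond marg
  conv_rhs => rw [← (D.joint κ τ δ).disintegrate (D.joint κ τ δ).condKernel]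
  rw [Measure.integral_compProd (integrable_of_abs_le hg hC)]

/-- The increment kernel of the approximating Markov chain. -/
def step (h τ δ : ℝ) (hδ : 0 < δ) : Kernel (Euc d) (Euc d) :=
  noiseKernel h D.measurable_β D.measurable_σ ∘ₖ D.cond κ τ δ hδ

theorem isMarkovKernel_step (hd : 1 ≤ d) (h τ δ : ℝ) (hδ : 0 < δ) :
    IsMarkovKernel (D.step κ h τ δ hδ) := by
  have : IsMarkovKernel (noiseKernel h D.measurable_β D.measurable_σ) :=
    ⟨fun u => isProbabilityMeasure_noiseMeasure hd h _ _⟩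
  unfold step; infer_instance

theorem integral_step (hd : 1 ≤ d) (h τ δ : ℝ) (hδ : 0 < δ) {f : Euc d → ℝ} (hf : Measurable f)
    {C : ℝ} (hC : ∀ p, |f p| ≤ C) (x : Euc d) :
    ∫ z, f z ∂(D.step κ h τ δ hδ x)
      = ∫ u, noiseAvg h (D.β u) (D.σ u) f ∂(D.cond κ τ δ hδ x) := by
  have := D.isMarkovKernel_step κ hd h τ δ hδ
  have hi : Integrable f (D.step κ h τ δ hδ x) := integrable_of_abs_le hf hC
  unfold step at hi ⊢
  rw [Kernel.integral_comp hi]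
  exact integral_congr_ae (ae_of_all _ fun u => integral_noiseMeasure h (D.β u) (D.σ u) f)

theorem lintegral_step_le (h τ δ : ℝ) (hδ : 0 < δ) {f : Euc d → ℝ} (hf : Measurable f)
    (hf0 : ∀ p, 0 ≤ f p) {c : ℝ} (hc : ∀ u, noiseAvg h (D.β u) (D.σ u) f ≤ c) (x : Euc d) :
    ∫⁻ z, ENNReal.ofReal (f z) ∂(D.step κ h τ δ hδ x) ≤ ENNReal.ofReal c := by
  unfold step
  rw [Kernel.lintegral_comp _ _ _ (by fun_prop)]
  calc _ ≤ ∫⁻ _, ENNReal.ofReal c ∂(D.cond κ τ δ hδ x) := by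
        refine lintegral_mono fun u => ?_
        exact (lintegral_noiseMeasure h (D.β u) (D.σ u) hf0).le.trans
          (ENNReal.ofReal_le_ofReal (hc u))
    _ = _ := by simp

/-- The bound for the generator on functions with derivatives bounded by `C`. -/
def genBound (C : ℝ) : ℝ := C * D.K + d * (C * D.K ^ 2)

/-- The error of one step of the chain in total variation. -/
def stepErr (C h δ : ℝ) : ℝ :=
  2 * D.genBound C * h ^ 2 / δ
    + h * (D.K ^ 2 * (1 + d) * (C * √(h * (2 * D.K ^ 2 * (1 + d)))) + h * C * D.K ^ 2)

theorem measurable_noiseAvg {α : Type*} [MeasurableSpace α] (h : ℝ) {u : α → ℝ × Euc d}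
    (hu : Measurable u) {f : α → Euc d → ℝ} (hf : Measurable (Function.uncurry f)) :
    Measurable fun a => noiseAvg h (D.β (u a)) (D.σ (u a)) (f a) := by
  unfold noiseAvg
  have hb := D.measurable_β
  refine Finset.measurable_sum _ fun i _ => ?_
  have hs := D.measurable_σ i
  have h1 : Measurable fun a => f a (h • D.β (u a) + √(h * d) • D.σ (u a) i) :=
    hf.comp (f := fun a => (a, h • D.β (u a) + √(h * d) • D.σ (u a) i)) (by fun_prop)
  have h2 : Measurable fun a => f a (h • D.β (u a) - √(h * d) • D.σ (u a) i) :=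
    hf.comp (f := fun a => (a, h • D.β (u a) - √(h * d) • D.σ (u a) i)) (by fun_prop)
  fun_prop

theorem integral_noiseAvg (h : ℝ) (B : Euc d) (S : Fin d → Euc d) {f : Euc d → Euc d → ℝ}
    (hf : Measurable (Function.uncurry f)) {C : ℝ} (hC : ∀ x z, |f x z| ≤ C) :
    ∫ x, noiseAvg h B S (f x) ∂κ = noiseAvg h B S (fun z => ∫ x, f x z ∂κ) := by
  have hi : ∀ z, Integrable (fun x => f x z) κ := fun z =>
    integrable_of_abs_le (hf.of_uncurry_right) fun x => hC x z
  unfold noiseAvg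
  rw [integral_finsetSum (f := fun i x => (2 * d : ℝ)⁻¹ * (f x (h • B + √(h * d) • S i)
    + f x (h • B - √(h * d) • S i))) _ fun i _ => ((hi _).add (hi _)).const_mul _]
  refine Finset.sum_congr rfl fun i _ => ?_
  rw [integral_const_mul, integral_add (hi _) (hi _)]

theorem tv_step (hd : 1 ≤ d) {C : ℝ} (hκ : IsMollifier κ C) {h τ δ : ℝ} (hδ : 0 < δ) (hτ : 0 ≤ τ)
    (hh : 0 ≤ h) (hh1 : h ≤ 1) (hh2 : h * (2 * D.K ^ 2 * (1 + d)) ≤ 1) {f : Euc d → ℝ}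
    (hf : Measurable f) (hf1 : ∀ x, |f x| ≤ 1) (hfc : HasCompactSupport f) :
    |∫ x, ∫ z, f (x + z) ∂(D.step κ h τ δ hδ x) ∂(D.marg κ τ δ)
      - ∫ x, f x ∂(D.marg κ (τ + h) δ)| ≤ D.stepErr C h δ := by
  have := D.isProbabilityMeasure_avg (τ := τ) hδ
  obtain ⟨hF, hFc, hF1, hF2, hF3⟩ := hκ f hf hf1 hfc
  set F : Euc d → ℝ := fun y => ∫ x, f (y + x) ∂κ with hFdef
  have hF2' : ContDiff ℝ 2 F := hF.of_le (by norm_cast)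
  have hFb : ∀ x, |F x| ≤ 1 := fun x => abs_integral_le_of_abs_le fun y => hf1 _
  have hFm : Measurable F := hF.continuous.measurable
  have hC0 : 0 ≤ C := le_trans (ContinuousLinearMap.opNorm_nonneg _) (hF1 0)
  have hL : ∀ u, |D.gen F u| ≤ D.genBound C := D.abs_gen_le hF1 hF2
  have e1 : ∫ x, ∫ z, f (x + z) ∂(D.step κ h τ δ hδ x) ∂(D.marg κ τ δ)
      = ∫ u, noiseAvg h (D.β u) (D.σ u) (fun z => F (u.2 + z)) ∂(D.avg τ δ) := by
    have : ∀ x, ∫ z, f (x + z) ∂(D.step κ h τ δ hδ x)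
        = ∫ u, noiseAvg h (D.β u) (D.σ u) (fun z => f (x + z)) ∂(D.cond κ τ δ hδ x) := fun x =>
      D.integral_step κ hd h τ δ hδ (by fun_prop) (fun z => hf1 _) x
    simp_rw [this]
    rw [D.integral_cond κ hδ (g := fun p => noiseAvg h (D.β p.2) (D.σ p.2) (fun z => f (p.1 + z)))
      (D.measurable_noiseAvg h measurable_snd
        (f := fun (p : Euc d × (ℝ × Euc d)) z => f (p.1 + z))
          (by unfold Function.uncurry; fun_prop))
      (C := 1) (fun p => abs_noiseAvg_le hd fun i => ⟨hf1 _, hf1 _⟩)]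
    refine integral_congr_ae (ae_of_all _ fun u => ?_)
    dsimp only
    rw [integral_noiseAvg κ h (D.β u) (D.σ u) (f := fun x z => f (u.2 + x + z))
      (by unfold Function.uncurry; fun_prop) (C := 1) fun x z => hf1 _]
    congr 1
    funext z
    rw [hFdef]
    refine integral_congr_ae (ae_of_all _ fun x => ?_)
    dsimp only
    congr 1; abel
  rw [e1, D.integral_marg κ hδ hf hf1]
  change |_ - ∫ u, F u.2 ∂(D.avg (τ + h) δ)| ≤ _
  have s1 := D.abs_avg_step_le hF hFc hL hτ hδ hh
  set w := C * √(h * (2 * D.K ^ 2 * (1 + d))) with hw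
  have tay : ∀ u : ℝ × Euc d, |noiseAvg h (D.β u) (D.σ u) (fun z => F (u.2 + z)) - F u.2
      - h * D.gen F u| ≤ h * (D.K ^ 2 * (1 + d) * w + h * C * D.K ^ 2) := fun u =>
    abs_noiseAvg_sub_le hd hF2' hh hh1 (D.norm_β_le u) (D.norm_σ_le u) (hF2 _) (fun v hv => by
      have hv1 : ‖v‖ ≤ 1 := by
        rw [← sq_le_one_iff₀ (norm_nonneg _)]; exact hv.trans hh2
      refine (hF3 _ v hv1).trans ?_
      exact mul_le_mul_of_nonneg_left (Real.le_sqrt_of_sq_le hv) hC0)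
  have i1 : Integrable (fun u => noiseAvg h (D.β u) (D.σ u) (fun z => F (u.2 + z)))
      (D.avg τ δ) := integrable_of_abs_le
    (D.measurable_noiseAvg h measurable_id (f := fun (u : ℝ × Euc d) z => F (u.2 + z))
      (by unfold Function.uncurry; fun_prop)) (C := 1)
      fun u => abs_noiseAvg_le hd fun i => ⟨hFb _, hFb _⟩
  have i2 : Integrable (fun u : ℝ × Euc d => F u.2) (D.avg τ δ) :=
    integrable_of_abs_le (by fun_prop) fun u => hFb _
  have i3 : Integrable (D.gen F) (D.avg τ δ) := integrable_of_abs_le (D.measurable_gen hF2') hL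
  have s2 := abs_integral_le_of_abs_le (μ := D.avg τ δ) tay
  have s3 := integral_sub (i1.sub i2) (i3.const_mul h)
  have s4 := integral_sub i1 i2
  simp only [Pi.sub_apply] at s3
  rw [s3, s4, integral_const_mul] at s2
  unfold stepErr
  rw [abs_le] at s1 s2 ⊢
  constructor <;> linarith

end FPFlow

theorem TVLe.abs_sub_le {d : ℕ} {μ₁ μ₂ : Measure (Euc d)} {e M : ℝ} (h : TVLe μ₁ μ₂ e) (hM : 0 < M)
    {f : Euc d → ℝ} (hf : Measurable f) (hfM : ∀ x, |f x| ≤ M) :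
    |∫ x, f x ∂μ₁ - ∫ x, f x ∂μ₂| ≤ M * e := by
  have := h (fun x => M⁻¹ * f x) (by fun_prop) fun x => by
    rw [abs_mul, abs_of_pos (inv_pos.mpr hM), inv_mul_le_one₀ hM]; exact hfM x
  rw [integral_const_mul, integral_const_mul, ← mul_sub, abs_mul, abs_of_pos (inv_pos.mpr hM),
    inv_mul_le_iff₀ hM] at this
  exact this

namespace FPFlow

variable {d : ℕ} (D : FPFlow d) (κ : Measure (Euc d)) [IsProbabilityMeasure κ]

variable {T : ℝ} (hT : 0 ≤ T) (hd : 1 ≤ d)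

/-- The law of the interpolated approximating Markov chain. -/
def approx (h δ : ℝ) (hδ : 0 < δ) (J : ℕ) : Measure (PathSpace d T) :=
  chainLaw hT (D.marg κ 0 δ) (fun j => D.step κ h (j * h) δ hδ) h J

include hd in
theorem isProbabilityMeasure_approx (h δ : ℝ) (hδ : 0 < δ) (J : ℕ) :
    IsProbabilityMeasure (D.approx κ hT h δ hδ J) := by
  have := D.isProbabilityMeasure_marg κ (τ := 0) hδ
  have : ∀ j : ℕ, IsMarkovKernel (D.step κ h (j * h) δ hδ) :=
    fun j => D.isMarkovKernel_step κ hd h _ δ hδ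
  unfold approx; infer_instance

theorem stepErr_nonneg {C h δ : ℝ} (hC : 0 ≤ C) (hh : 0 ≤ h) (hδ : 0 < δ) :
    0 ≤ D.stepErr C h δ := by
  have := D.K_nonneg
  unfold stepErr genBound; positivity

include hd in
theorem tv_approx {C : ℝ} (hκ : IsMollifier κ C) {h δ : ℝ} (hδ : 0 < δ)
    (hh : 0 < h) (hh1 : h ≤ 1) (hh2 : h * (2 * D.K ^ 2 * (1 + d)) ≤ 1) {J : ℕ}
    (hJ : (J : ℝ) * h ≤ T) (j : ℕ) (hj : j ≤ J) :
    TVLe ((D.approx κ hT h δ hδ J).map (evalAt hT (j * h))) (D.marg κ (j * h) δ)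
      (j * D.stepErr C h δ) := by
  have i0 := D.isProbabilityMeasure_marg κ (τ := 0) hδ
  have i1 : ∀ j : ℕ, IsMarkovKernel (D.step κ h (j * h) δ hδ) :=
    fun j => D.isMarkovKernel_step κ hd h _ δ hδ
  have i2 := D.isProbabilityMeasure_approx κ hT hd h δ hδ J
  induction j with
  | zero =>
    intro f _ _
    simp only [Nat.cast_zero, zero_mul, approx]
    rw [map_evalAt_zero_chainLaw hT _ _ hh]
    simp
  | succ j ih =>
    have i3 := D.isProbabilityMeasure_marg κ (τ := (j + 1 : ℕ) * h) hδ
    have i4 := Measure.isProbabilityMeasure_map (μ := D.approx κ hT h δ hδ J)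
      (measurable_evalAt hT ((j + 1 : ℕ) * h)).aemeasurable
    refine tvLe_of_hasCompactSupport fun f hf hf1 hfc => ?_
    have hm : ∀ s, Measurable (evalAt (d := d) hT s) := measurable_evalAt hT
    have e1 := integral_chainLaw_markov hT (D.marg κ 0 δ) (fun j => D.step κ h (j * h) δ hδ) hh hj
      hJ
      (G := fun _ => 1) measurable_const (fun _ _ _ => rfl) (CG := 1) (by simp)
      (ψ := fun _ y => f y) (by unfold Function.uncurry; fun_prop) (Cψ := 1) fun _ y => hf1 y
    simp only [one_mul] at e1
    have e2 : ∫ x, f x ∂((D.approx κ hT h δ hδ J).map (evalAt hT ((j + 1 : ℕ) * h)))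
        = ∫ x, (∫ z, f (x + z) ∂(D.step κ h (j * h) δ hδ x))
          ∂((D.approx κ hT h δ hδ J).map (evalAt hT (j * h))) := by
      rw [integral_map (hm _).aemeasurable hf.aestronglyMeasurable, integral_map
        (hm _).aemeasurable]
      · exact e1
      · have : StronglyMeasurable fun p : Euc d × Euc d => f (p.1 + p.2) :=
          (hf.comp (by fun_prop)).stronglyMeasurable
        exact (this.integral_kernel_prod_right' (κ := D.step κ h (j * h) δ hδ)).aestronglyMeasurable
    have hTm : Measurable fun x => ∫ z, f (x + z) ∂(D.step κ h (j * h) δ hδ x) := by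
      have : StronglyMeasurable fun p : Euc d × Euc d => f (p.1 + p.2) :=
        (hf.comp (by fun_prop)).stronglyMeasurable
      exact (this.integral_kernel_prod_right' (κ := D.step κ h (j * h) δ hδ)).measurable
    have s1 := ih (by omega) _ hTm fun x => abs_integral_le_of_abs_le fun z => hf1 _
    have s2 := D.tv_step κ hd hκ hδ (τ := j * h) (by positivity) hh.le hh1 hh2 hf hf1 hfc
    rw [e2]
    rw [show (j : ℝ) * h + h = (j + 1 : ℕ) * h by push_cast; ring] at s2
    push_cast at s1 s2 ⊢
    rw [abs_le] at s1 s2 ⊢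
    constructor <;> linarith

include hd in
theorem lintegral_approx_increment_le {h δ : ℝ} (hδ : 0 < δ) (hh : 0 < h) (hh1 : h ≤ 1) {J : ℕ}
    (hJ : (J : ℝ) * h = T) {s t : ℝ} (hs : 0 ≤ s) (hst : s ≤ t) (ht : t ≤ T) :
    ∫⁻ ω, ENNReal.ofReal (‖evalAt hT t ω - evalAt hT s ω‖ ^ 4) ∂(D.approx κ hT h δ hδ J)
      ≤ ENNReal.ofReal (momentConst (stepConst d D.K) T * (t - s) ^ 2) := by
  have i0 := D.isProbabilityMeasure_marg κ (τ := 0) hδ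
  have i1 : ∀ j : ℕ, IsMarkovKernel (D.step κ h (j * h) δ hδ) :=
    fun j => D.isMarkovKernel_step κ hd h _ δ hδ
  have hc : 0 ≤ stepConst d D.K := by
    have := D.K_nonneg
    unfold stepConst; positivity
  refine lintegral_increment_pow_four_le hT (D.marg κ 0 δ) (fun j => D.step κ h (j * h) δ hδ)
    hc ?_ ?_ hh hJ hs hst ht
  · exact fun j x S => D.lintegral_step_le κ h _ δ hδ (by fun_prop) (fun z => by positivity)
      (fun u => noiseAvg_sq_le hd hh.le hh1 (D.norm_β_le u) (D.norm_σ_le u) S) x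
  · exact fun j x S => D.lintegral_step_le κ h _ δ hδ (by fun_prop) (fun z => by positivity)
      (fun u => noiseAvg_pow_four_le hd hh.le hh1 (D.norm_β_le u) (D.norm_σ_le u) S) x

end FPFlow

theorem noiseAvg_sub_const {d : ℕ} (hd : 1 ≤ d) (h : ℝ) (B : Euc d) (S : Fin d → Euc d)
    (f : Euc d → ℝ) (c : ℝ) : noiseAvg h B S (fun z => f z - c) = noiseAvg h B S f - c := by
  have hd0 : (d : ℝ) ≠ 0 := by positivity
  have : c = ∑ _i : Fin d, (2 * d : ℝ)⁻¹ * (2 * c) := by simp; field_simp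
  conv_rhs => rw [this]
  unfold noiseAvg
  rw [← Finset.sum_sub_distrib]
  exact Finset.sum_congr rfl fun i _ => by ring

theorem abs_sum_mul_sub_le {ι : Type*} [Fintype ι] (a b D : ι → ℝ) {C : ℝ} (hD : ∀ i, |D i| ≤ C) :
    |∑ i, a i * D i - ∑ i, b i * D i| ≤ C * ∑ i, |a i - b i| := by
  rw [← Finset.sum_sub_distrib, Finset.mul_sum]
  refine (Finset.abs_sum_le_sum_abs _ _).trans (Finset.sum_le_sum fun i _ => ?_)
  rw [← sub_mul, abs_mul, mul_comm]
  exact mul_le_mul_of_nonneg_right (hD i) (abs_nonneg _)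

namespace FPFlow

variable {d : ℕ} (D : FPFlow d) (κ : Measure (Euc d)) [IsProbabilityMeasure κ]

/-- A family of bounded coefficients together with continuous substitutes. -/
structure Coeffs (ι : Type*) [Fintype ι] (U : Type*) [MeasurableSpace U] where
  c : ι → U → ℝ
  c' : ι → U → ℝ
  measurable_c : ∀ i, Measurable (c i)
  measurable_c' : ∀ i, Measurable (c' i)
  M : ℝ
  abs_c_le : ∀ i u, |c i u| ≤ M
  abs_c'_le : ∀ i u, |c' i u| ≤ M

namespace Coeffs

variable {ι : Type*} [Fintype ι] {U : Type*} [MeasurableSpace U] (A : Coeffs ι U)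

/-- Total deviation of the coefficients at `u` from their substitutes at `v`. -/
def dev (u v : U) : ℝ :=
  ∑ i, |A.c i u - A.c' i v|

def bound : ℝ := Fintype.card ι * (2 * A.M) + 1

theorem dev_nonneg (u v : U) : 0 ≤ A.dev u v := Finset.sum_nonneg fun _ _ => abs_nonneg _

theorem dev_le (u v : U) : A.dev u v ≤ A.bound := by
  have : A.dev u v ≤ ∑ _i : ι, 2 * A.M := Finset.sum_le_sum fun i _ => by
    refine (abs_sub _ _).trans ?_
    have := A.abs_c_le i u
    have := A.abs_c'_le i v
    linarith
  simp only [Finset.sum_const, Finset.card_univ, nsmul_eq_mul] at this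
  unfold bound; linarith

theorem abs_dev_le (u v : U) : |A.dev u v| ≤ A.bound := by
  rw [abs_of_nonneg (A.dev_nonneg u v)]; exact A.dev_le u v

theorem bound_pos [Nonempty U] : 0 < A.bound := by
  have u : U := Classical.arbitrary U
  have h : (0 : ℝ) ≤ Fintype.card ι * (2 * A.M) := by
    rcases isEmpty_or_nonempty ι with hι | ⟨⟨i⟩⟩
    · simp
    · have := (abs_nonneg _).trans (A.abs_c_le i u)
      positivity
  unfold bound; linarith

theorem measurable_dev {α : Type*} [MeasurableSpace α] {f g : α → U} (hf : Measurable f)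
    (hg : Measurable g) : Measurable fun x => A.dev (f x) (g x) := by
  unfold dev
  refine Finset.measurable_sum _ fun i _ => ?_
  have h1 := (A.measurable_c i).comp hf
  have h2 := (A.measurable_c' i).comp hg
  exact (h1.sub h2).abs

theorem dev_le_add {w : ℝ} {u v : U} (h : ∀ i, |A.c' i u - A.c' i v| ≤ w) :
    A.dev u v ≤ A.dev u u + Fintype.card ι * w := by
  have : (Fintype.card ι : ℝ) * w = ∑ _i : ι, w := by simp
  rw [this]
  unfold dev
  rw [← Finset.sum_add_distrib]
  refine Finset.sum_le_sum fun i _ => (abs_sub_le _ (A.c' i u) _).trans ?_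
  have := h i
  linarith

end Coeffs

theorem integral_dev_le {ι : Type*} [Fintype ι] (A : Coeffs ι (ℝ × Euc d)) {τ δ ε w : ℝ}
    (hδ : 0 < δ) (hκ : ∀ᵐ x ∂κ, ‖x‖ ≤ ε)
    (hw : ∀ i s t x y, |s - t| ≤ δ → ‖x - y‖ ≤ ε → |A.c' i (s, x) - A.c' i (t, y)| ≤ w) :
    ∫ x, ∫ u, A.dev u (τ, x) ∂(D.cond κ τ δ hδ x) ∂(D.marg κ τ δ)
      ≤ ∫ u, A.dev u u ∂(D.avg τ δ) + Fintype.card ι * w := by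
  have := D.isProbabilityMeasure_avg (τ := τ) hδ
  rw [D.integral_cond κ hδ (g := fun p => A.dev p.2 (τ, p.1))
    (A.measurable_dev measurable_snd (by fun_prop)) fun p => A.abs_dev_le _ _]
  have hmeas : Measurable fun u : ℝ × Euc d => ∫ x, A.dev u (τ, u.2 + x) ∂κ :=
    (StronglyMeasurable.integral_prod_right (f := fun (p : (ℝ × Euc d)) x => A.dev p (τ, p.2 + x))
      (A.measurable_dev (f := fun p : (ℝ × Euc d) × Euc d => p.1)
        (g := fun p => (τ, p.1.2 + p.2)) (by fun_prop) (by fun_prop)).stronglyMeasurable).measurable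
  have hm2 : Measurable fun u : ℝ × Euc d => A.dev u u :=
    A.measurable_dev measurable_id measurable_id
  have hb1 : ∀ u : ℝ × Euc d, |∫ x, A.dev u (τ, u.2 + x) ∂κ| ≤ A.bound := fun u =>
    abs_integral_le_of_abs_le fun x => A.abs_dev_le _ _
  have e : ∫ u, A.dev u u ∂(D.avg τ δ) + Fintype.card ι * w
      = ∫ u, (A.dev u u + Fintype.card ι * w) ∂(D.avg τ δ) := by
    rw [integral_add (integrable_of_abs_le hm2 fun u => A.abs_dev_le _ _) (integrable_const _)]
    simp
  have hb2 : ∀ u : ℝ × Euc d, |A.dev u u + Fintype.card ι * w|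
      ≤ A.bound + |Fintype.card ι * w| := fun u =>
    (abs_add_le _ _).trans (by gcongr; exact A.abs_dev_le _ _)
  rw [e, D.integral_avg hδ hmeas hb1, D.integral_avg hδ (hm2.add_const _) hb2]
  refine mul_le_mul_of_nonneg_left ?_ (by positivity)
  refine intervalIntegral.integral_mono_on (by linarith)
    (intervalIntegrable_of_abs_le (D.measurable_integral_ν hmeas)
      (fun s => abs_integral_le_of_abs_le fun y => hb1 _) _ _)
    (intervalIntegrable_of_abs_le (D.measurable_integral_ν (hm2.add_const _))
      (fun s => abs_integral_le_of_abs_le fun y => hb2 _) _ _) fun s hs => ?_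
  refine integral_mono
    (integrable_of_abs_le (hmeas.comp measurable_prodMk_left) fun y => hb1 _)
    (integrable_of_abs_le ((hm2.add_const _).comp measurable_prodMk_left) fun y => hb2 _)
    fun y => ?_
  have : ∫ x, A.dev (s, y) (τ, y + x) ∂κ
      ≤ ∫ _x, (A.dev (s, y) (s, y) + Fintype.card ι * w) ∂κ := by
    refine integral_mono_ae (integrable_of_abs_le
      (A.measurable_dev measurable_const (by fun_prop)) fun x => A.abs_dev_le _ _)
      (integrable_const _) ?_
    filter_upwards [hκ] with x hx
    refine A.dev_le_add fun i => hw i _ _ _ _ ?_ (by simpa using hx)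
    rw [abs_le]; constructor <;> linarith [hs.1, hs.2]
  simpa using this

variable {T : ℝ} (hT : 0 ≤ T) (hd : 1 ≤ d)

include hd in
theorem abs_martingale_step_le {ι : Type*} [Fintype ι] (A : Coeffs ι (ℝ × Euc d)) {δ ε w : ℝ}
    (hδ : 0 < δ) (hκ : ∀ᵐ x ∂κ, ‖x‖ ≤ ε)
    (hw : ∀ i s t x y, |s - t| ≤ δ → ‖x - y‖ ≤ ε → |A.c' i (s, x) - A.c' i (t, y)| ≤ w)
    {C : ℝ} (hκC : IsMollifier κ C) {h : ℝ}
    (hh : 0 < h) (hh1 : h ≤ 1) (hh2 : h * (2 * D.K ^ 2 * (1 + d)) ≤ 1) {J : ℕ}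
    (hJ : (J : ℝ) * h ≤ T) {φ : Euc d → ℝ} (hφ : ContDiff ℝ 2 φ) {Cφ w' : ℝ}
    (hφ0 : ∀ x, |φ x| ≤ Cφ) (hφ2 : ∀ x, ‖fderiv ℝ (fderiv ℝ φ) x‖ ≤ Cφ)
    (hw' : ∀ x v, ‖v‖ ^ 2 ≤ h * (2 * D.K ^ 2 * (1 + d)) →
      ‖fderiv ℝ (fderiv ℝ φ) (x + v) - fderiv ℝ (fderiv ℝ φ) x‖ ≤ w')
    {Dφ : ι → Euc d → ℝ} (hDm : ∀ i, Measurable (Dφ i)) (hDφ : ∀ i x, |Dφ i x| ≤ Cφ)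
    (hgen : ∀ u x, diffOp (D.β u) (D.σ u) φ x = ∑ i, A.c i u * Dφ i x)
    {G : PathSpace d T → ℝ} (hGm : Measurable G) (hG1 : ∀ ω, |G ω| ≤ 1)
    {j : ℕ} (hj : j + 1 ≤ J) (hG : DependsUpTo hT (j * h) G) :
    |∫ ω, G ω * (φ (evalAt hT ((j + 1 : ℕ) * h) ω) - φ (evalAt hT (j * h) ω)
      - h * ∑ i, A.c' i (j * h, evalAt hT (j * h) ω) * Dφ i (evalAt hT (j * h) ω))
      ∂(D.approx κ hT h δ hδ J)| ≤ h * (D.K ^ 2 * (1 + d) * w' + h * Cφ * D.K ^ 2)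
        + h * Cφ * (∫ u, A.dev u u ∂(D.avg (j * h) δ) + Fintype.card ι * w
          + A.bound * (j * D.stepErr C h δ)) := by
  have i0 := D.isProbabilityMeasure_marg κ (τ := 0) hδ
  have i1 : ∀ j : ℕ, IsMarkovKernel (D.step κ h (j * h) δ hδ) :=
    fun j => D.isMarkovKernel_step κ hd h _ δ hδ
  have i2 := D.isProbabilityMeasure_approx κ hT hd h δ hδ J
  have hm : ∀ s, Measurable (evalAt (d := d) hT s) := measurable_evalAt hT
  have hCφ : 0 ≤ Cφ := (abs_nonneg _).trans (hφ0 0)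
  have hφm : Measurable φ := hφ.continuous.measurable
  set τ : ℝ := j * h with hτ
  set q : Euc d → ℝ := fun x => φ x + h * ∑ i, A.c' i (τ, x) * Dφ i x with hq
  have hqm : Measurable q := by
    have := A.measurable_c'
    refine hφm.add (Measurable.const_mul (Finset.measurable_sum _ fun i _ => ?_) _)
    exact ((A.measurable_c' i).comp measurable_prodMk_left).mul (hDm i)
  have hqb : ∀ x, |q x| ≤ Cφ + h * ∑ _i : ι, A.M * Cφ := fun x => by
    refine (abs_add_le _ _).trans (add_le_add (hφ0 x) ?_)
    rw [abs_mul, abs_of_pos hh]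
    gcongr
    refine (Finset.abs_sum_le_sum_abs _ _).trans (Finset.sum_le_sum fun i _ => ?_)
    rw [abs_mul]
    exact mul_le_mul (A.abs_c'_le i _) (hDφ i x) (abs_nonneg _)
      ((abs_nonneg _).trans (A.abs_c_le i 0))
  have hψb : ∀ x y, |φ y - q x| ≤ Cφ + (Cφ + h * ∑ _i : ι, A.M * Cφ) := fun x y =>
    (abs_sub _ _).trans (add_le_add (hφ0 _) (hqb _))
  have e1 := integral_chainLaw_markov hT (D.marg κ 0 δ) (fun j => D.step κ h (j * h) δ hδ) hh hj hJ
    hGm hG hG1 (ψ := fun x y => φ y - q x) (by unfold Function.uncurry; fun_prop) hψb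
  set S : Euc d → ℝ := fun x => ∫ u, A.dev u (τ, x) ∂(D.cond κ τ δ hδ x) with hS
  have hSm : Measurable S := by
    have : StronglyMeasurable fun p : Euc d × (ℝ × Euc d) => A.dev p.2 (τ, p.1) :=
      (A.measurable_dev measurable_snd (by fun_prop)).stronglyMeasurable
    exact (this.integral_kernel_prod_right' (κ := D.cond κ τ δ hδ)).measurable
  have hSb : ∀ x, |S x| ≤ A.bound := fun x => abs_integral_le_of_abs_le fun u => A.abs_dev_le _ _
  set tay := h * (D.K ^ 2 * (1 + d) * w' + h * Cφ * D.K ^ 2) with htay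
  have e2 : ∀ x, |∫ z, (φ (x + z) - q x) ∂(D.step κ h τ δ hδ x)| ≤ tay + h * Cφ * S x := by
    intro x
    rw [D.integral_step κ hd h τ δ hδ (by fun_prop) (fun z => hψb x (x + z))]
    have hi : Integrable (fun u => A.dev u (τ, x)) (D.cond κ τ δ hδ x) :=
      integrable_of_abs_le (A.measurable_dev measurable_id (by fun_prop)) fun u => A.abs_dev_le _ _
    have : tay + h * Cφ * S x = ∫ u, (tay + h * Cφ * A.dev u (τ, x)) ∂(D.cond κ τ δ hδ x) := by
      rw [integral_add (integrable_const _) (hi.const_mul _), integral_const,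
        probReal_univ, one_smul, integral_const_mul]
    rw [this]
    have hi' : Integrable (fun u => tay + h * Cφ * A.dev u (τ, x)) (D.cond κ τ δ hδ x) :=
      (integrable_const _).add (hi.const_mul _)
    rw [← Real.norm_eq_abs]
    refine norm_integral_le_of_norm_le hi' (ae_of_all _ fun u => ?_)
    rw [noiseAvg_sub_const hd, Real.norm_eq_abs]
    have t1 := abs_noiseAvg_sub_le hd hφ hh.le hh1 (D.norm_β_le u) (D.norm_σ_le u) (hφ2 x) (hw' x)
    have t2 := abs_sum_mul_sub_le (fun i => A.c i u) (fun i => A.c' i (τ, x)) (fun i => Dφ i x)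
      fun i => hDφ i x
    rw [← hgen] at t2
    have t3 := mul_le_mul_of_nonneg_left t2 hh.le
    rw [← abs_of_pos hh, ← abs_mul, abs_of_pos hh] at t3
    have : noiseAvg h (D.β u) (D.σ u) (fun z => φ (x + z)) - q x
      = (noiseAvg h (D.β u) (D.σ u) (fun z => φ (x + z)) - φ x - h * diffOp (D.β u) (D.σ u) φ x)
        + h * (diffOp (D.β u) (D.σ u) φ x - ∑ i, A.c' i (τ, x) * Dφ i x) := by
      rw [hq]; ring
    rw [this]
    refine (abs_add_le _ _).trans (add_le_add t1 (t3.trans (le_of_eq ?_)))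
    unfold Coeffs.dev; ring
  have e3 : ∫ ω, G ω * (φ (evalAt hT ((j + 1 : ℕ) * h) ω) - φ (evalAt hT τ ω)
      - h * ∑ i, A.c' i (τ, evalAt hT τ ω) * Dφ i (evalAt hT τ ω)) ∂(D.approx κ hT h δ hδ J)
      = ∫ ω, G ω * ∫ z, (φ (evalAt hT τ ω + z) - q (evalAt hT τ ω))
        ∂(D.step κ h τ δ hδ (evalAt hT τ ω)) ∂(D.approx κ hT h δ hδ J) := by
    refine Eq.trans (integral_congr_ae (ae_of_all _ fun ω => ?_)) e1
    simp only [hq]; ring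
  rw [e3]
  have hSi : Integrable (fun ω => S (evalAt hT τ ω)) (D.approx κ hT h δ hδ J) :=
    integrable_of_abs_le (hSm.comp (hm τ)) fun ω => hSb _
  have hi' : Integrable (fun ω => tay + h * Cφ * S (evalAt hT τ ω)) (D.approx κ hT h δ hδ J) :=
    (integrable_const _).add (hSi.const_mul _)
  have e4 := norm_integral_le_of_norm_le (μ := D.approx κ hT h δ hδ J)
    (f := fun ω => G ω * ∫ z, (φ (evalAt hT τ ω + z) - q (evalAt hT τ ω))
        ∂(D.step κ h τ δ hδ (evalAt hT τ ω))) hi' (ae_of_all _ fun ω => by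
      rw [norm_mul]
      have := mul_le_mul (hG1 ω) (e2 (evalAt hT τ ω)) (abs_nonneg _) zero_le_one
      rwa [one_mul] at this)
  refine e4.trans ?_
  have e5 : ∫ ω, (tay + h * Cφ * S (evalAt hT τ ω)) ∂(D.approx κ hT h δ hδ J)
      = tay + h * Cφ * ∫ x, S x ∂((D.approx κ hT h δ hδ J).map (evalAt hT τ)) := by
    rw [integral_map (hm τ).aemeasurable hSm.aestronglyMeasurable, ← integral_const_mul,
      integral_add (integrable_const _) (hSi.const_mul _), integral_const, probReal_univ, one_smul]
  rw [e5]
  have t := (D.tv_approx κ hT hd hκC hδ hh hh1 hh2 hJ j (by omega)).abs_sub_le A.bound_pos hSm hSb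
  have t' := D.integral_dev_le κ A (τ := τ) hδ hκ hw
  refine add_le_add le_rfl (mul_le_mul_of_nonneg_left ?_ (by positivity))
  have := (abs_le.mp t).2
  linarith

end FPFlow

namespace FPFlow

variable {d : ℕ} (D : FPFlow d) (κ : Measure (Euc d)) [IsProbabilityMeasure κ]

theorem sum_integral_avg_le {q : ℝ × Euc d → ℝ} (hq : Measurable q) (hq0 : ∀ u, 0 ≤ q u) {C : ℝ}
    (hC : ∀ u, |q u| ≤ C) {h : ℝ} (hh : 0 < h) {R J : ℕ} (hR : 0 < R) (hR1 : R * h ≤ 1) :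
    ∑ j ∈ Finset.range J, h * ∫ u, q u ∂(D.avg (j * h) (R * h))
      ≤ ∫ s in (0:ℝ)..J * h + 1, ∫ y, q (s, y) ∂(D.ν s) := by
  have hRr : (0:ℝ) < R := by exact_mod_cast hR
  set Q : ℝ → ℝ := fun s => ∫ y, q (s, y) ∂(D.ν s) with hQ
  have hQ0 : ∀ s, 0 ≤ Q s := fun s => integral_nonneg fun y => hq0 _
  have hQi : ∀ a b, IntervalIntegrable Q volume a b :=
    intervalIntegrable_of_abs_le (D.measurable_integral_ν hq)
      fun s => abs_integral_le_of_abs_le fun y => hC _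
  have e1 : ∀ j : ℕ, h * ∫ u, q u ∂(D.avg (j * h) (R * h))
      = ∑ i ∈ Finset.range R, (R:ℝ)⁻¹ * ∫ s in ((i + j : ℕ) * h)..((i + j + 1 : ℕ) * h), Q s := by
    intro j
    rw [D.integral_avg (by positivity) hq hC, ← Finset.mul_sum]
    have := intervalIntegral.sum_integral_adjacent_intervals (f := Q) (μ := volume)
      (a := fun i => ((i + j : ℕ) : ℝ) * h) (n := R) (fun k _ => hQi _ _)
    have e : ∀ i : ℕ, i + 1 + j = i + j + 1 := fun i => by omega
    simp only [e] at this
    rw [this]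
    have e' : ((R + j : ℕ) : ℝ) * h = j * h + R * h := by push_cast; ring
    rw [e', zero_add]
    field_simp
    rfl
  simp_rw [e1]
  rw [Finset.sum_comm]
  have e2 : ∀ i ∈ Finset.range R, ∑ j ∈ Finset.range J,
      (R:ℝ)⁻¹ * ∫ s in ((i + j : ℕ) * h)..((i + j + 1 : ℕ) * h), Q s
      ≤ (R:ℝ)⁻¹ * ∫ s in (0:ℝ)..J * h + 1, Q s := by
    intro i hi
    rw [← Finset.mul_sum]
    refine mul_le_mul_of_nonneg_left ?_ (by positivity)
    have := intervalIntegral.sum_integral_adjacent_intervals (f := Q) (μ := volume)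
      (a := fun j => ((i + j : ℕ) : ℝ) * h) (n := J) (fun k _ => hQi _ _)
    simp only [← add_assoc] at this
    rw [this, add_zero]
    have hiR : (i:ℝ) ≤ R := by exact_mod_cast (Finset.mem_range.mp hi).le
    refine intervalIntegral.integral_mono_interval (by positivity) ?_ ?_
      (ae_of_all _ hQ0) (hQi _ _)
    · push_cast; gcongr; simp
    · push_cast
      have : (i:ℝ) * h ≤ R * h := by gcongr
      linarith
  refine (Finset.sum_le_sum e2).trans (le_of_eq ?_)
  rw [Finset.sum_const, Finset.card_range, nsmul_eq_mul]
  field_simp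

variable {T : ℝ} (hT : 0 ≤ T) (hd : 1 ≤ d)

include hd in
theorem abs_martingale_sum_le {ι : Type*} [Fintype ι] (A : Coeffs ι (ℝ × Euc d)) {ε w : ℝ}
    {h : ℝ} {R J : ℕ} (hR : 0 < R) (hR1 : R * h ≤ 1) (hδ : 0 < R * h)
    (hκ : ∀ᵐ x ∂κ, ‖x‖ ≤ ε) (hw0 : 0 ≤ w)
    (hw : ∀ i s t x y, |s - t| ≤ R * h → ‖x - y‖ ≤ ε → |A.c' i (s, x) - A.c' i (t, y)| ≤ w)
    {C : ℝ} (hC : 0 ≤ C) (hκC : IsMollifier κ C)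
    (hh : 0 < h) (hh2 : h * (2 * D.K ^ 2 * (1 + d)) ≤ 1)
    (hJ : (J : ℝ) * h = T) {φ : Euc d → ℝ} (hφ : ContDiff ℝ 2 φ) {Cφ w' : ℝ} (hw0' : 0 ≤ w')
    (hφ0 : ∀ x, |φ x| ≤ Cφ) (hφ2 : ∀ x, ‖fderiv ℝ (fderiv ℝ φ) x‖ ≤ Cφ)
    (hw' : ∀ x v, ‖v‖ ^ 2 ≤ h * (2 * D.K ^ 2 * (1 + d)) →
      ‖fderiv ℝ (fderiv ℝ φ) (x + v) - fderiv ℝ (fderiv ℝ φ) x‖ ≤ w')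
    {Dφ : ι → Euc d → ℝ} (hDm : ∀ i, Measurable (Dφ i)) (hDφ : ∀ i x, |Dφ i x| ≤ Cφ)
    (hgen : ∀ u x, diffOp (D.β u) (D.σ u) φ x = ∑ i, A.c i u * Dφ i x)
    {G : PathSpace d T → ℝ} (hGm : Measurable G) (hG1 : ∀ ω, |G ω| ≤ 1)
    {k l : ℕ} (hkl : k ≤ l) (hl : l ≤ J) (hG : DependsUpTo hT (k * h) G) :
    |∫ ω, G ω * (φ (evalAt hT (l * h) ω) - φ (evalAt hT (k * h) ω)
      - ∑ j ∈ Finset.Ico k l, h * ∑ i, A.c' i (j * h, evalAt hT (j * h) ω)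
        * Dφ i (evalAt hT (j * h) ω)) ∂(D.approx κ hT h (R * h) hδ J)|
      ≤ Cφ * (∫ s in (0:ℝ)..T + 1, ∫ y, A.dev (s, y) (s, y) ∂(D.ν s))
        + (T * (D.K ^ 2 * (1 + d) * w' + h * Cφ * D.K ^ 2)
        + T * Cφ * (Fintype.card ι * w + A.bound * (J * D.stepErr C h (R * h)))) := by
  have i2 := D.isProbabilityMeasure_approx κ hT hd h (R * h) hδ J
  have hm : ∀ s, Measurable (evalAt (d := d) hT s) := measurable_evalAt hT
  have hCφ : 0 ≤ Cφ := (abs_nonneg _).trans (hφ0 0)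
  have hφm : Measurable φ := hφ.continuous.measurable
  have hRr : (1:ℝ) ≤ R := by exact_mod_cast hR
  have hh1 : h ≤ 1 := le_trans (by nlinarith) hR1
  have hse := D.stepErr_nonneg hC hh.le hδ
  have hbd := A.bound_pos
  have hm2 : Measurable fun u : ℝ × Euc d => A.dev u u :=
    A.measurable_dev measurable_id measurable_id
  set f : ℕ → PathSpace d T → ℝ := fun j ω => G ω * (φ (evalAt hT ((j + 1 : ℕ) * h) ω)
    - φ (evalAt hT (j * h) ω) - h * ∑ i, A.c' i (j * h, evalAt hT (j * h) ω)
      * Dφ i (evalAt hT (j * h) ω)) with hf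
  have hfi : ∀ j, Integrable (f j) (D.approx κ hT h (R * h) hδ J) := by
    intro j
    refine integrable_of_abs_le (C := 1 * (Cφ + Cφ + h * ∑ _i : ι, A.M * Cφ)) ?_ fun ω => ?_
    · refine hGm.mul (((hφm.comp (hm _)).sub (hφm.comp (hm _))).sub
        (Measurable.const_mul (Finset.measurable_sum _ fun i _ => ?_) _))
      exact ((A.measurable_c' i).comp (measurable_const.prodMk (hm _))).mul ((hDm i).comp (hm _))
    · rw [hf, abs_mul]
      refine mul_le_mul (hG1 ω) ?_ (abs_nonneg _) zero_le_one
      refine (abs_sub _ _).trans (add_le_add ((abs_sub _ _).trans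
        (add_le_add (hφ0 _) (hφ0 _))) ?_)
      rw [abs_mul, abs_of_pos hh]
      gcongr
      refine (Finset.abs_sum_le_sum_abs _ _).trans (Finset.sum_le_sum fun i _ => ?_)
      rw [abs_mul]
      exact mul_le_mul (A.abs_c'_le i _) (hDφ i _) (abs_nonneg _)
        ((abs_nonneg _).trans (A.abs_c_le i 0))
  have e1 : ∀ ω, G ω * (φ (evalAt hT (l * h) ω) - φ (evalAt hT (k * h) ω)
      - ∑ j ∈ Finset.Ico k l, h * ∑ i, A.c' i (j * h, evalAt hT (j * h) ω)
        * Dφ i (evalAt hT (j * h) ω)) = ∑ j ∈ Finset.Ico k l, f j ω := by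
    intro ω
    have := Finset.sum_Ico_sub (fun j : ℕ => φ (evalAt hT (j * h) ω)) hkl
    rw [← this, ← Finset.sum_sub_distrib, Finset.mul_sum]
  simp_rw [e1]
  rw [integral_finsetSum _ fun j _ => hfi j]
  set b : ℕ → ℝ := fun j => h * (D.K ^ 2 * (1 + d) * w' + h * Cφ * D.K ^ 2)
    + h * Cφ * (∫ u, A.dev u u ∂(D.avg (j * h) (R * h)) + Fintype.card ι * w
      + A.bound * (J * D.stepErr C h (R * h))) with hb
  have hb0 : ∀ j, 0 ≤ b j := fun j => by
    have : 0 ≤ ∫ u, A.dev u u ∂(D.avg (j * h) (R * h)) := integral_nonneg fun u => A.dev_nonneg u u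
    positivity
  have hfb : ∀ j ∈ Finset.Ico k l, |∫ ω, f j ω ∂(D.approx κ hT h (R * h) hδ J)| ≤ b j := by
    intro j hj
    rw [Finset.mem_Ico] at hj
    have hkj : (k:ℝ) ≤ j := by exact_mod_cast hj.1
    refine (D.abs_martingale_step_le κ hT hd A hδ hκ hw hκC hh hh1 hh2 hJ.le hφ hφ0 hφ2 hw' hDm
      hDφ hgen hGm hG1 (by omega) (hG.mono hT (by gcongr))).trans ?_
    have hjJ : (j:ℝ) ≤ J := by exact_mod_cast (by omega : j ≤ J)
    simp only [hb]
    gcongr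
  calc |∑ j ∈ Finset.Ico k l, ∫ ω, f j ω ∂(D.approx κ hT h (R * h) hδ J)|
      ≤ ∑ j ∈ Finset.Ico k l, b j :=
        (Finset.abs_sum_le_sum_abs _ _).trans (Finset.sum_le_sum hfb)
    _ ≤ ∑ j ∈ Finset.range J, b j := by
        refine Finset.sum_le_sum_of_subset_of_nonneg (fun j hj => ?_) fun j _ _ => hb0 j
        rw [Finset.mem_Ico] at hj
        rw [Finset.mem_range]; omega
    _ = Cφ * ∑ j ∈ Finset.range J, h * ∫ u, A.dev u u ∂(D.avg (j * h) (R * h))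
        + (J * h * (D.K ^ 2 * (1 + d) * w' + h * Cφ * D.K ^ 2)
        + J * h * Cφ * (Fintype.card ι * w + A.bound * (J * D.stepErr C h (R * h)))) := by
        rw [hb, Finset.mul_sum]
        have : ∀ c : ℝ, (J:ℝ) * c = ∑ _j ∈ Finset.range J, c := fun c => by simp
        rw [mul_assoc (J:ℝ), mul_assoc (J:ℝ), mul_assoc (J:ℝ), ← mul_add, this (_ + _),
          ← Finset.sum_add_distrib]
        exact Finset.sum_congr rfl fun j _ => by ring
    _ ≤ _ := by
        rw [hJ]
        have := D.sum_integral_avg_le hm2 (fun u => A.dev_nonneg u u) (fun u => A.abs_dev_le u u)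
          hh hR hR1 (J := J)
        rw [hJ] at this
        gcongr

end FPFlow

/-- A bound for a compactly supported smooth function and its first two derivatives. -/
theorem exists_bound_derivatives {E : Type*} [NormedAddCommGroup E] [NormedSpace ℝ E] {φ : E → ℝ}
    (hφ : ContDiff ℝ 2 φ) (hφc : HasCompactSupport φ) :
    ∃ C : ℝ, 0 ≤ C ∧ (∀ x, |φ x| ≤ C) ∧ (∀ x, ‖fderiv ℝ φ x‖ ≤ C) ∧
      ∀ x, ‖fderiv ℝ (fderiv ℝ φ) x‖ ≤ C := by
  have h1 : ContDiff ℝ 1 (fderiv ℝ φ) := hφ.fderiv_right (by norm_num)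
  obtain ⟨C0, h0⟩ := hφ.continuous.bounded_above_of_compact_support hφc
  obtain ⟨C1, h1'⟩ := h1.continuous.bounded_above_of_compact_support (hφc.fderiv ℝ)
  obtain ⟨C2, h2⟩ := (h1.continuous_fderiv (by norm_num)).bounded_above_of_compact_support
    ((hφc.fderiv ℝ).fderiv ℝ)
  refine ⟨max 0 (max C0 (max C1 C2)), le_max_left _ _, fun x => (h0 x).trans ?_,
    fun x => (h1' x).trans ?_, fun x => (h2 x).trans ?_⟩ <;> simp

namespace FPFlow

variable {d : ℕ} (D : FPFlow d) (κ : Measure (Euc d)) [IsProbabilityMeasure κ]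

theorem abs_marg_sub_le {φ : Euc d → ℝ} (hφ : ContDiff ℝ (⊤ : ℕ∞) φ)
    (hφc : HasCompactSupport φ) {C ε : ℝ} (hC : ∀ x, |φ x| ≤ C) (h1 : ∀ x, ‖fderiv ℝ φ x‖ ≤ C)
    (hκ : ∀ᵐ x ∂κ, ‖x‖ ≤ ε) {L : ℝ}
    (hL : ∀ u, |D.gen φ u| ≤ L) {τ δ : ℝ} (hτ : 0 ≤ τ) (hδ : 0 < δ) :
    |∫ x, φ x ∂(D.marg κ τ δ) - ∫ x, φ x ∂(D.ν τ)| ≤ C * ε + L * δ := by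
  have := D.isProbabilityMeasure_avg (τ := τ) hδ
  have hC0 : 0 ≤ C := (abs_nonneg _).trans (hC 0)
  have hL0 : 0 ≤ L := (abs_nonneg _).trans (hL 0)
  have hφm : Measurable φ := hφ.continuous.measurable
  have hlip : ∀ x y : Euc d, |φ (y + x) - φ y| ≤ C * ‖x‖ := fun x y => by
    have := Convex.norm_image_sub_le_of_norm_fderiv_le (𝕜 := ℝ) (f := φ) (s := univ) (C := C)
      (x := y) (y := y + x) (fun x _ => (hφ.differentiable (by simp)) x) (fun x _ => h1 x)
      convex_univ (mem_univ _) (mem_univ _)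
    simpa using this
  rw [D.integral_marg κ hδ hφm hC]
  have m1 : Measurable fun u : ℝ × Euc d => ∫ x, φ (u.2 + x) ∂κ := by
    have : StronglyMeasurable fun p : (ℝ × Euc d) × Euc d => φ (p.1.2 + p.2) :=
      (hφm.comp (by fun_prop)).stronglyMeasurable
    exact this.integral_prod_right.measurable
  have s1 : |∫ u, ∫ x, φ (u.2 + x) ∂κ ∂(D.avg τ δ) - ∫ u, φ u.2 ∂(D.avg τ δ)| ≤ C * ε := by
    rw [← integral_sub (integrable_of_abs_le m1 fun u => abs_integral_le_of_abs_le fun x => hC _)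
      (integrable_of_abs_le (by fun_prop) fun u => hC _)]
    refine abs_integral_le_of_abs_le fun u => ?_
    have : ∫ x, φ (u.2 + x) ∂κ - φ u.2 = ∫ x, (φ (u.2 + x) - φ u.2) ∂κ := by
      rw [integral_sub (integrable_of_abs_le (by fun_prop) fun u => hC _) (integrable_const _)]
      simp
    rw [this, ← Real.norm_eq_abs]
    refine (norm_integral_le_of_norm_le_const (C := C * ε) ?_).trans (by simp)
    filter_upwards [hκ] with x hx
    exact (hlip x _).trans (by gcongr)
  have s2 : |∫ u, φ u.2 ∂(D.avg τ δ) - ∫ x, φ x ∂(D.ν τ)| ≤ L * δ := by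
    have e : ∫ u, φ u.2 ∂(D.avg τ δ) - ∫ x, φ x ∂(D.ν τ)
        = ∫ u, (∫ x, φ x ∂(D.ν u.1) - ∫ x, φ x ∂(D.ν τ)) ∂(D.avg τ δ) := by
      have m2 : Measurable fun u : ℝ × Euc d => ∫ x, φ x ∂(D.ν u.1) :=
        (D.measurable_integral_ν (f := fun p => φ p.2) (by fun_prop)).comp measurable_fst
      rw [integral_sub (integrable_of_abs_le m2 fun u => abs_integral_le_of_abs_le fun x => hC _)
        (integrable_const _), integral_const, probReal_univ, one_smul,
        D.integral_avg hδ (f := fun u => φ u.2) (by fun_prop) fun u => hC _,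
        D.integral_avg hδ m2 fun u => abs_integral_le_of_abs_le fun x => hC _]
      simp
    rw [e]
    have hae : ∀ᵐ u ∂(D.avg τ δ), u.1 ∈ Ioc τ (τ + δ) := by
      have := isProbabilityMeasure_time (τ := τ) hδ
      unfold avg
      refine Measure.ae_compProd_of_ae_ae (measurable_fst measurableSet_Ioc) ?_
      refine Measure.ae_smul_measure ?_ _
      filter_upwards [ae_restrict_mem measurableSet_Ioc] with s hs
      exact ae_of_all _ fun _ => hs
    rw [← Real.norm_eq_abs]
    refine (norm_integral_le_of_norm_le_const (C := L * δ) ?_).trans (by simp)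
    filter_upwards [hae] with u hu
    refine (D.abs_integral_sub_le hφ hφc hL hτ hu.1.le).trans ?_
    have := hu.2
    gcongr; linarith
  have := abs_sub_le (∫ u, ∫ x, φ (u.2 + x) ∂κ ∂(D.avg τ δ)) (∫ u, φ u.2 ∂(D.avg τ δ))
    (∫ x, φ x ∂(D.ν τ))
  linarith

theorem exists_parameters {T : ℝ} (hT : 0 < T) {C e : ℝ} (he : 0 < e) (n : ℕ) :
    ∃ N R : ℕ, n ≤ N ∧ 0 < R ∧ R * (T / 2 ^ N) ≤ e ∧ (T / 2 ^ N) ≤ e ∧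
      (T / 2 ^ N) * (2 * D.K ^ 2 * (1 + d)) ≤ 1 ∧
      ((2 ^ N : ℕ) : ℝ) * D.stepErr C (T / 2 ^ N) (R * (T / 2 ^ N)) ≤ e := by
  have hlim : Filter.Tendsto (fun N : ℕ => T / 2 ^ N) Filter.atTop (𝓝 0) := by
    have := (tendsto_pow_atTop_nhds_zero_of_lt_one (r := (1 / 2 : ℝ)) (by norm_num)
      (by norm_num)).const_mul T
    simpa [div_eq_mul_inv] using this
  obtain ⟨q, hq⟩ := (hlim.eventually (gt_mem_nhds he)).exists
  set δ := T / 2 ^ q with hδ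
  have hδ0 : 0 < δ := by positivity
  have c1 : Filter.Tendsto (fun N : ℕ => (T / 2 ^ N) * (2 * D.K ^ 2 * (1 + d))) Filter.atTop
      (𝓝 0) := by simpa using hlim.mul_const (2 * D.K ^ 2 * (1 + d))
  set F : ℝ → ℝ := fun h => T * (2 * D.genBound C * h / δ
    + (D.K ^ 2 * (1 + d) * (C * √(h * (2 * D.K ^ 2 * (1 + d)))) + h * C * D.K ^ 2)) with hF
  have c2 : Filter.Tendsto (fun N : ℕ => F (T / 2 ^ N)) Filter.atTop (𝓝 0) := by
    have : Continuous F := by fun_prop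
    have h := (this.tendsto 0).comp hlim
    rw [show F 0 = 0 by simp [hF]] at h
    exact h
  obtain ⟨N, h1, h2, h3, h4⟩ := ((hlim.eventually (gt_mem_nhds he)).and
    ((c1.eventually (gt_mem_nhds one_pos)).and ((c2.eventually (gt_mem_nhds he)).and
      (Filter.eventually_ge_atTop (max n q))))).exists
  have hN : q ≤ N := (le_max_right _ _).trans h4
  have hR : ((2 ^ (N - q) : ℕ) : ℝ) * (T / 2 ^ N) = δ := by
    rw [hδ]; push_cast
    rw [pow_sub₀ _ (by norm_num) hN]; field_simp
  refine ⟨N, 2 ^ (N - q), (le_max_left _ _).trans h4, by positivity, ?_, h1.le, h2.le, ?_⟩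
  · rw [hR]; exact hq.le
  · rw [hR]
    refine le_of_eq_of_le ?_ h3.le
    unfold stepErr
    simp only [hF]; push_cast
    field_simp

/-- A sequence of laws on path space that asymptotically solves the martingale problem along
dyadic grids and has the right marginals. -/
structure IsApproxSeq {T : ℝ} (hT : 0 ≤ T) (P : ℕ → Measure (PathSpace d T)) (N : ℕ → ℕ) :
    Prop where
  le : ∀ n, n ≤ N n
  prob : ∀ n, IsProbabilityMeasure (P n)
  moment : ∃ M : ℝ, 0 ≤ M ∧ ∀ n s t, 0 ≤ s → s ≤ t → t ≤ T →
    ∫⁻ ω, ENNReal.ofReal (‖evalAt hT t ω - evalAt hT s ω‖ ^ 4) ∂(P n)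
      ≤ ENNReal.ofReal (M * (t - s) ^ 2)
  marginal : ∀ f : Euc d → ℝ, ContDiff ℝ (⊤ : ℕ∞) f → HasCompactSupport f → ∀ η > (0 : ℝ),
    ∀ᶠ n in Filter.atTop, ∀ j : ℕ, j ≤ 2 ^ N n →
      |∫ ω, f (evalAt hT (j * (T / 2 ^ N n)) ω) ∂(P n) - ∫ x, f x ∂(D.ν (j * (T / 2 ^ N n)))| ≤ η
  martingale : ∀ (ι : Type) [Fintype ι] (A : Coeffs ι (ℝ × Euc d)),
    (∀ i, UniformContinuous (A.c' i)) → ∀ (φ : Euc d → ℝ), ContDiff ℝ 2 φ → HasCompactSupport φ →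
    ∀ (Dφ : ι → Euc d → ℝ), (∀ i, Measurable (Dφ i)) →
    (∀ u x, diffOp (D.β u) (D.σ u) φ x = ∑ i, A.c i u * Dφ i x) →
    ∀ Cφ : ℝ, (∀ i x, |Dφ i x| ≤ Cφ) → (∀ x, |φ x| ≤ Cφ) →
    (∀ x, ‖fderiv ℝ (fderiv ℝ φ) x‖ ≤ Cφ) → ∀ η > (0 : ℝ), ∀ᶠ n in Filter.atTop,
    ∀ G : PathSpace d T → ℝ, Measurable G → (∀ ω, |G ω| ≤ 1) → ∀ k l : ℕ, k ≤ l → l ≤ 2 ^ N n →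
    DependsUpTo hT (k * (T / 2 ^ N n)) G →
    |∫ ω, G ω * (φ (evalAt hT (l * (T / 2 ^ N n)) ω) - φ (evalAt hT (k * (T / 2 ^ N n)) ω)
      - ∑ j ∈ Finset.Ico k l, (T / 2 ^ N n) * ∑ i, A.c' i (j * (T / 2 ^ N n),
        evalAt hT (j * (T / 2 ^ N n)) ω) * Dφ i (evalAt hT (j * (T / 2 ^ N n)) ω)) ∂(P n)|
      ≤ Cφ * (∫ s in (0:ℝ)..T + 1, ∫ y, A.dev (s, y) (s, y) ∂(D.ν s)) + η

theorem exists_isApproxSeq (hd : 1 ≤ d) {T : ℝ} (hT : 0 < T) :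
    ∃ (P : ℕ → Measure (PathSpace d T)) (N : ℕ → ℕ), D.IsApproxSeq hT.le P N := by
  have he : ∀ n : ℕ, 0 < (1 : ℝ) / (n + 1) := fun n => by positivity
  choose κ hκp hκε C hC0 hC using fun n : ℕ => exists_isMollifier (d := d) (he n)
  choose N R hN hR hRe hhe hh2 hse using fun n : ℕ => D.exists_parameters hT (C := C n) (he n) n
  have hh : ∀ n, 0 < T / 2 ^ N n := fun n => by positivity
  have hδ : ∀ n, 0 < R n * (T / 2 ^ N n) := fun n => by
    have := hR n; have := hh n; positivity
  have hle1 : ∀ n : ℕ, (1 : ℝ) / (n + 1) ≤ 1 := fun n => by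
    rw [div_le_one (by positivity)]; simp
  have hJ : ∀ n, ((2 ^ N n : ℕ) : ℝ) * (T / 2 ^ N n) = T := fun n => by push_cast; field_simp
  have hlim : Filter.Tendsto (fun n : ℕ => (1 : ℝ) / (n + 1)) Filter.atTop (𝓝 0) :=
    tendsto_one_div_add_atTop_nhds_zero_nat
  have hlimh : Filter.Tendsto (fun n : ℕ => T / 2 ^ N n) Filter.atTop (𝓝 0) :=
    squeeze_zero (fun n => (hh n).le) hhe hlim
  refine ⟨fun n => D.approx (κ n) hT.le (T / 2 ^ N n) (R n * (T / 2 ^ N n)) (hδ n) (2 ^ N n), N,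
    hN, fun n => D.isProbabilityMeasure_approx _ _ hd _ _ _ _,
    ⟨max 0 (momentConst (stepConst d D.K) T), le_max_left _ _, fun n s t hs hst ht => ?_⟩, ?_, ?_⟩
  · refine (D.lintegral_approx_increment_le (κ n) hT.le hd (hδ n) (hh n)
      ((hhe n).trans (hle1 n)) (hJ n) hs hst ht).trans (ENNReal.ofReal_le_ofReal ?_)
    gcongr; exact le_max_right _ _
  · intro f hf hfc η hη
    obtain ⟨Cf, hCf0, h0, h1, h2⟩ := exists_bound_derivatives (hf.of_le (by norm_cast)) hfc
    have hfm : Measurable f := hf.continuous.measurable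
    have hgen := D.abs_gen_le h1 h2
    set L := Cf * D.K + d * (Cf * D.K ^ 2)
    have hL0 : 0 ≤ L := (abs_nonneg _).trans (hgen 0)
    have hlim2 : Filter.Tendsto (fun n : ℕ => ((Cf + 1) + (Cf + L)) * ((1 : ℝ) / (n + 1)))
        Filter.atTop (𝓝 0) := by simpa using hlim.const_mul ((Cf + 1) + (Cf + L))
    filter_upwards [hlim2.eventually (gt_mem_nhds hη)] with n hn j hj
    have t1 := (D.tv_approx (κ n) hT.le hd (hC n) (hδ n) (hh n) ((hhe n).trans (hle1 n)) (hh2 n)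
      (hJ n).le j hj).abs_sub_le (M := Cf + 1) (by positivity) hfm
      fun x => (h0 x).trans (by linarith)
    rw [integral_map (measurable_evalAt _ _).aemeasurable hfm.aestronglyMeasurable] at t1
    have t2 := D.abs_marg_sub_le (κ n) hf hfc h0 h1 (hκε n) hgen (τ := j * (T / 2 ^ N n))
      (by have := hh n; positivity) (hδ n)
    have t3 : (j : ℝ) * D.stepErr (C n) (T / 2 ^ N n) (R n * (T / 2 ^ N n)) ≤ 1 / (n + 1) := by
      refine le_trans ?_ (hse n)
      have := D.stepErr_nonneg (hC0 n) (hh n).le (hδ n)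
      gcongr
    have t4 : (Cf + 1) * (j * D.stepErr (C n) (T / 2 ^ N n) (R n * (T / 2 ^ N n)))
      ≤ (Cf + 1) * (1 / (n + 1)) := by gcongr
    have t5 : L * (R n * (T / 2 ^ N n)) ≤ L * (1 / (n + 1)) := by gcongr; exact hRe n
    refine (abs_sub_le _ _ _).trans ((add_le_add t1 t2).trans ?_)
    linarith
  · intro ι _ A hA φ hφ hφc Dφ hDm hgen Cφ hDφ hφ0 hφ2 η hη
    have hCφ : 0 ≤ Cφ := (abs_nonneg _).trans (hφ0 0)
    have hK := D.K_nonneg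
    have hbd := A.bound_pos
    have h1 : ContDiff ℝ 1 (fderiv ℝ φ) := hφ.fderiv_right (by norm_num)
    have huc : @UniformContinuous _ _ PseudoMetricSpace.toUniformSpace
        PseudoMetricSpace.toUniformSpace (fderiv ℝ (fderiv ℝ φ)) :=
      (h1.continuous_fderiv (by norm_num)).uniformContinuous_of_tendsto_cocompact
        (x := 0) ((hφc.fderiv ℝ).fderiv ℝ).is_zero_at_infty
    set a := T * (D.K ^ 2 * (1 + d)) + T * Cφ * Fintype.card ι with ha
    have ha0 : 0 ≤ a := by positivity
    set w := η / (2 * (a + 1)) with hw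
    have hw0 : 0 < w := by positivity
    obtain ⟨r, hr, hr'⟩ := Metric.uniformContinuous_iff.mp huc w hw0
    have hA' : ∀ i, ∃ r > 0, ∀ u v : ℝ × Euc d, dist u v < r → |A.c' i u - A.c' i v| < w :=
      fun i => by
        obtain ⟨r, hr, h⟩ := Metric.uniformContinuous_iff.mp (hA i) w hw0
        exact ⟨r, hr, fun u v huv => h huv⟩
    choose ρ hρ hρ' using hA'
    have c1 : ∀ᶠ n : ℕ in Filter.atTop, ∀ i, (1 : ℝ) / (n + 1) < ρ i :=
      Filter.eventually_all.mpr fun i => hlim.eventually (gt_mem_nhds (hρ i))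
    have c2 : ∀ᶠ n : ℕ in Filter.atTop, (T / 2 ^ N n) * (2 * D.K ^ 2 * (1 + d)) < r ^ 2 := by
      have : Filter.Tendsto (fun n : ℕ => (T / 2 ^ N n) * (2 * D.K ^ 2 * (1 + d))) Filter.atTop
        (𝓝 0) := by simpa using hlimh.mul_const (2 * D.K ^ 2 * (1 + d))
      exact this.eventually (gt_mem_nhds (by positivity))
    have c3 : ∀ᶠ n : ℕ in Filter.atTop, T * ((T / 2 ^ N n) * Cφ * D.K ^ 2)
        + T * Cφ * (A.bound * (1 / (n + 1))) < η / 2 := by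
      have : Filter.Tendsto (fun n : ℕ => T * ((T / 2 ^ N n) * Cφ * D.K ^ 2)
        + T * Cφ * (A.bound * ((1 : ℝ) / (n + 1)))) Filter.atTop (𝓝 0) := by
        have := (((hlimh.mul_const Cφ).mul_const (D.K ^ 2)).const_mul T).add
          ((hlim.const_mul A.bound).const_mul (T * Cφ))
        simpa using this
      exact this.eventually (gt_mem_nhds (by positivity))
    filter_upwards [c1, c2, c3] with n h1 h2 h3 G hGm hG1 k l hkl hl hG
    have := hκp n
    refine (D.abs_martingale_sum_le (κ n) hT.le hd A (hR n) ((hRe n).trans (hle1 n)) (hδ n) (hκε n)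
      hw0.le ?_ (hC0 n) (hC n) (hh n) (hh2 n) (hJ n) hφ hw0.le hφ0 hφ2 ?_ hDm hDφ hgen hGm hG1
      hkl hl hG).trans ?_
    · intro i s t x y hst hxy
      refine (hρ' i _ _ ?_).le
      rw [Prod.dist_eq, max_lt_iff, Real.dist_eq, dist_eq_norm]
      exact ⟨(hst.trans (hRe n)).trans_lt (h1 i), hxy.trans_lt (h1 i)⟩
    · intro x v hv
      have : dist (x + v) x < r := by
        rw [dist_eq_norm, add_sub_cancel_left]
        exact lt_of_pow_lt_pow_left₀ 2 hr.le (hv.trans_lt h2)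
      exact ((dist_eq_norm (fderiv ℝ (fderiv ℝ φ) (x + v)) (fderiv ℝ (fderiv ℝ φ) x)).symm.trans_lt
        (hr' this)).le
    · have e1 : T * Cφ * (A.bound * (((2 ^ N n : ℕ) : ℝ)
          * D.stepErr (C n) (T / 2 ^ N n) (R n * (T / 2 ^ N n))))
          ≤ T * Cφ * (A.bound * (1 / (n + 1))) := by
        have := hse n
        gcongr
      have e2 : a * w ≤ η / 2 := by
        rw [hw, mul_div_assoc', div_le_div_iff₀ (by positivity) (by positivity)]
        nlinarith
      have e3 : a * w = T * (D.K ^ 2 * (1 + d)) * w + T * Cφ * Fintype.card ι * w := by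
        rw [ha]; ring
      linarith

end FPFlow

namespace FPFlow

variable {d : ℕ} {T : ℝ}

/-- Paths with geometrically small increments along the dyadic grids of level at least `m`. -/
def dyadicSet (d : ℕ) (hT : 0 ≤ T) (m : ℕ) : Set (PathSpace d T) :=
  {ω | ∀ n, m ≤ n → ∀ k : ℕ, k < 2 ^ n →
    ‖evalAt hT ((k + 1 : ℕ) * (T / 2 ^ n)) ω - evalAt hT (k * (T / 2 ^ n)) ω‖ ≤ (9 / 10 : ℝ) ^ n}

theorem isClosed_dyadicSet (hT : 0 ≤ T) (m : ℕ) : IsClosed (dyadicSet d hT m) := by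
  unfold dyadicSet
  simp only [ofPred_forall]
  refine isClosed_iInter fun n => isClosed_iInter fun _ => isClosed_iInter fun k =>
    isClosed_iInter fun _ => isClosed_le ?_ continuous_const
  have h1 := continuous_evalAt (d := d) hT ((k + 1 : ℕ) * (T / 2 ^ n))
  have h2 := continuous_evalAt (d := d) hT (k * (T / 2 ^ n))
  fun_prop

theorem norm_sub_floor_le (hT : 0 < T) {m : ℕ} {ω : PathSpace d T} (hω : ω ∈ dyadicSet d hT.le m)
    {n : ℕ} (hn : m ≤ n) {t : ℝ} (ht0 : 0 ≤ t) (htT : t ≤ T) :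
    ‖evalAt hT.le t ω - evalAt hT.le (⌊2 ^ n * (t / T)⌋₊ * (T / 2 ^ n)) ω‖
      ≤ 9 * (9 / 10 : ℝ) ^ n := by
  have hx0 : 0 ≤ t / T := by positivity
  have hx1 : t / T ≤ 1 := (div_le_one hT).mpr htT
  set x := t / T with hx
  have htx : t = x * T := by rw [hx]; field_simp
  set f : ℕ → Euc d := fun p => evalAt hT.le (⌊2 ^ (n + p) * x⌋₊ * (T / 2 ^ (n + p))) ω with hf
  have hstep : ∀ p, dist (f p) (f (p + 1)) ≤ (9 / 10 : ℝ) ^ (n + 1) * (9 / 10) ^ p := by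
    intro p
    have e0 : (0:ℝ) ≤ 2 ^ (n + p) * x := by positivity
    set k := ⌊2 ^ (n + p) * x⌋₊ with hk
    have k1 : (k:ℝ) ≤ 2 ^ (n + p) * x := Nat.floor_le e0
    have k2 : 2 ^ (n + p) * x < k + 1 := Nat.lt_floor_add_one _
    set k' := ⌊2 ^ (n + (p + 1)) * x⌋₊ with hk'
    have k1' : (k':ℝ) ≤ 2 ^ (n + (p + 1)) * x := Nat.floor_le (by positivity)
    have k2' : 2 ^ (n + (p + 1)) * x < k' + 1 := Nat.lt_floor_add_one _
    have e1 : (2:ℝ) ^ (n + (p + 1)) * x = 2 * (2 ^ (n + p) * x) := by ring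
    rw [e1] at k1' k2'
    have a1 : k' < 2 * k + 2 := by
      have : (k':ℝ) < (2 * k + 2 : ℕ) := by push_cast; linarith
      exact_mod_cast this
    have a2 : 2 * k < k' + 1 := by
      have : ((2 * k : ℕ) : ℝ) < (k' + 1 : ℕ) := by push_cast; linarith
      exact_mod_cast this
    have e2 : (k:ℝ) * (T / 2 ^ (n + p)) = (2 * k : ℕ) * (T / 2 ^ (n + (p + 1))) := by
      push_cast; field_simp; ring
    simp only [hf, ← hk, ← hk', e2]
    rcases (by omega : k' = 2 * k ∨ k' = 2 * k + 1) with h | h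
    · rw [h, dist_self]; positivity
    · rw [h, dist_comm, dist_eq_norm]
      have hlt : 2 * k < 2 ^ (n + (p + 1)) := by
        have hp : (0:ℝ) ≤ 2 ^ (n + p) := by positivity
        have : ((2 * k + 1 : ℕ) : ℝ) ≤ (2 ^ (n + (p + 1)) : ℕ) := by
          rw [← h]; push_cast
          refine k1'.trans ?_
          have : (2:ℝ) ^ (n + (p + 1)) = 2 * 2 ^ (n + p) := by ring
          rw [this]
          nlinarith
        have : 2 * k + 1 ≤ 2 ^ (n + (p + 1)) := by exact_mod_cast this
        omega
      refine (hω (n + (p + 1)) (by omega) (2 * k) hlt).trans (le_of_eq ?_)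
      ring
  have hlim : Filter.Tendsto f Filter.atTop (𝓝 (evalAt hT.le t ω)) := by
    refine ((continuous_evalAt_left hT.le ω).tendsto t).comp ?_
    have e : ∀ p : ℕ, (⌊2 ^ (n + p) * x⌋₊ : ℝ) * (T / 2 ^ (n + p))
        = T * ((⌊x * 2 ^ (n + p)⌋₊ : ℝ) / 2 ^ (n + p)) := fun p => by
      rw [mul_comm x]; field_simp
    simp_rw [e]
    have h1 : Filter.Tendsto (fun y : ℝ => (⌊x * y⌋₊ : ℝ) / y) Filter.atTop (𝓝 x) :=
      tendsto_nat_floor_mul_div_atTop hx0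
    have h2 : Filter.Tendsto (fun p : ℕ => (2:ℝ) ^ (n + p)) Filter.atTop Filter.atTop :=
      (tendsto_pow_atTop_atTop_of_one_lt (by norm_num)).comp
        (Filter.tendsto_atTop_mono (fun p => Nat.le_add_left p n) Filter.tendsto_id)
    have := (h1.comp h2).const_mul T
    rw [htx, mul_comm x]
    exact this
  have := dist_le_of_le_geometric_of_tendsto₀ (9 / 10 : ℝ) _ (by norm_num) hstep hlim
  rw [dist_comm, dist_eq_norm] at this
  refine this.trans (le_of_eq ?_)
  rw [pow_succ]; ring

theorem norm_sub_le_of_mem_dyadicSet (hT : 0 < T) {m : ℕ} {ω : PathSpace d T}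
    (hω : ω ∈ dyadicSet d hT.le m) {n : ℕ} (hn : m ≤ n) {s t : ℝ} (hs : 0 ≤ s) (hst : s ≤ t)
    (ht : t ≤ T) (h : t - s ≤ T / 2 ^ n) :
    ‖evalAt hT.le t ω - evalAt hT.le s ω‖ ≤ 19 * (9 / 10 : ℝ) ^ n := by
  have b1 := norm_sub_floor_le hT hω hn (hs.trans hst) ht
  have b2 := norm_sub_floor_le hT hω hn hs (hst.trans ht)
  set k := ⌊2 ^ n * (s / T)⌋₊ with hk
  set l := ⌊2 ^ n * (t / T)⌋₊ with hl
  have hkl : k ≤ l := Nat.floor_le_floor (by gcongr)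
  have hlk : l ≤ k + 1 := by
    rw [hk, ← Nat.floor_add_one (by positivity)]
    refine Nat.floor_le_floor ?_
    rw [le_div_iff₀ (by positivity)] at h
    have : 2 ^ n * (t / T) - 2 ^ n * (s / T) = (t - s) * 2 ^ n / T := by ring
    have : (t - s) * 2 ^ n / T ≤ 1 := (div_le_one hT).mpr h
    linarith
  have b3 : ‖evalAt hT.le (l * (T / 2 ^ n)) ω - evalAt hT.le (k * (T / 2 ^ n)) ω‖
      ≤ (9 / 10 : ℝ) ^ n := by
    rcases (by omega : l = k ∨ l = k + 1) with h | h
    · rw [h, sub_self, norm_zero]; positivity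
    · rw [h]
      refine hω n hn k ?_
      have : (l:ℝ) ≤ (2 ^ n : ℕ) := by
        refine (Nat.floor_le (by have := hs.trans hst; positivity)).trans ?_
        push_cast
        have : t / T ≤ 1 := (div_le_one hT).mpr ht
        have h0 : (0:ℝ) ≤ 2 ^ n := by positivity
        nlinarith
      have : l ≤ 2 ^ n := by exact_mod_cast this
      omega
  have e : evalAt hT.le t ω - evalAt hT.le s ω
      = (evalAt hT.le t ω - evalAt hT.le (l * (T / 2 ^ n)) ω)
        + (evalAt hT.le (l * (T / 2 ^ n)) ω - evalAt hT.le (k * (T / 2 ^ n)) ω)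
        - (evalAt hT.le s ω - evalAt hT.le (k * (T / 2 ^ n)) ω) := by abel
  rw [e]
  refine (norm_sub_le _ _).trans ?_
  have := norm_add_le (evalAt hT.le t ω - evalAt hT.le (l * (T / 2 ^ n)) ω)
    (evalAt hT.le (l * (T / 2 ^ n)) ω - evalAt hT.le (k * (T / 2 ^ n)) ω)
  linarith

/-- The modulus of continuity of the paths in `dyadicSet` is uniform. -/
theorem exists_modulus_dyadicSet (hT : 0 < T) (m : ℕ) {ε : ℝ} (hε : 0 < ε) :
    ∃ ρ > 0, ∀ ω ∈ dyadicSet d hT.le m, ∀ s t : ℝ, 0 ≤ s → s ≤ t → t ≤ T → t - s ≤ ρ →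
      ‖evalAt hT.le t ω - evalAt hT.le s ω‖ ≤ ε := by
  have : Filter.Tendsto (fun n : ℕ => 19 * (9 / 10 : ℝ) ^ n) Filter.atTop (𝓝 0) := by
    simpa using (tendsto_pow_atTop_nhds_zero_of_lt_one (r := (9 / 10 : ℝ)) (by norm_num)
      (by norm_num)).const_mul 19
  obtain ⟨n, h1, h2⟩ := ((this.eventually (gt_mem_nhds hε)).and
    (Filter.eventually_ge_atTop m)).exists
  exact ⟨T / 2 ^ n, by positivity, fun ω hω s t hs hst ht h =>
    (norm_sub_le_of_mem_dyadicSet hT hω h2 hs hst ht h).trans h1.le⟩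

theorem isCompact_dyadicSet_inter (hT : 0 < T) (m : ℕ) (R : ℝ) :
    IsCompact (dyadicSet d hT.le m ∩ {ω | ‖evalAt hT.le 0 ω‖ ≤ R}) := by
  set A := dyadicSet d hT.le m ∩ {ω | ‖evalAt hT.le 0 ω‖ ≤ R} with hA
  have hev : ∀ (ω : PathSpace d T) (x : Icc (0:ℝ) T), ω x = evalAt hT.le x ω := fun ω x => by
    unfold evalAt; rw [projIcc_val]
  have hAc : IsClosed A := (isClosed_dyadicSet hT.le m).inter
    (isClosed_le (continuous_evalAt hT.le 0).norm continuous_const)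
  have hbd : ∀ ω ∈ A, ∀ x : Icc (0:ℝ) T, ‖ω x‖ ≤ R + (2 ^ m : ℕ) * 19 := by
    intro ω hω x
    have : ∀ k : ℕ, k ≤ 2 ^ m → ‖evalAt hT.le (k * (x / 2 ^ m)) ω‖ ≤ R + k * 19 := by
      intro k
      induction k with
      | zero => intro _; simpa using hω.2
      | succ k ih =>
        intro hk
        have h1 := ih (by omega)
        have hx := x.2
        have hk' : ((k + 1 : ℕ) : ℝ) * (x / 2 ^ m) ≤ T := by
          have : ((k + 1 : ℕ) : ℝ) ≤ 2 ^ m := by exact_mod_cast hk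
          calc ((k + 1 : ℕ) : ℝ) * (x / 2 ^ m) ≤ 2 ^ m * (x / 2 ^ m) :=
                mul_le_mul_of_nonneg_right this (by have := hx.1; positivity)
            _ = x := by field_simp
            _ ≤ T := hx.2
        have h0 : (0:ℝ) ≤ x / 2 ^ m := by have := hx.1; positivity
        have h2 := norm_sub_le_of_mem_dyadicSet hT hω.1 le_rfl (s := k * (x / 2 ^ m))
          (t := (k + 1 : ℕ) * (x / 2 ^ m)) (by positivity)
          (by push_cast; linarith) hk' (by
            push_cast
            have : (x : ℝ) / 2 ^ m ≤ T / 2 ^ m := by gcongr; exact hx.2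
            linarith)
        have h3 : (9 / 10 : ℝ) ^ m ≤ 1 := pow_le_one₀ (by norm_num) (by norm_num)
        have h4 := norm_le_norm_add_norm_sub' (evalAt hT.le ((k + 1 : ℕ) * (x / 2 ^ m)) ω)
          (evalAt hT.le (k * (x / 2 ^ m)) ω)
        push_cast at h4 h2 ⊢
        linarith
    have h := this (2 ^ m) le_rfl
    have e : ((2 ^ m : ℕ) : ℝ) * (x / 2 ^ m) = x := by push_cast; field_simp
    rw [e, ← hev] at h
    exact h
  set Φ := ContinuousMap.isometryEquivBoundedOfCompact (Icc (0:ℝ) T) (Euc d)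
  have hc : IsCompact (Φ.symm ⁻¹' A) := by
    refine BoundedContinuousFunction.arzela_ascoli₂
      (Metric.closedBall (0 : Euc d) (R + (2 ^ m : ℕ) * 19))
      (isCompact_closedBall _ _) _ (hAc.preimage Φ.symm.continuous) ?_ ?_
    · intro f x hf
      rw [mem_closedBall_zero_iff]
      exact hbd _ hf x
    · refine (Metric.uniformEquicontinuous_iff.mpr fun ε hε => ?_).equicontinuous
      obtain ⟨ρ, hρ, h⟩ := exists_modulus_dyadicSet (d := d) hT m (half_pos hε)
      have key : ∀ f : Φ.symm ⁻¹' A, ∀ x y : Icc (0:ℝ) T, x ≤ y → dist x y < ρ →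
          dist ((f : BoundedContinuousFunction (Icc (0:ℝ) T) (Euc d)) x) (f.1 y) < ε := by
        intro f x y hxy hd
        have := h _ f.2.1 x y x.2.1 hxy y.2.2 (by
          rw [dist_comm, Subtype.dist_eq, Real.dist_eq] at hd
          exact (le_abs_self _).trans hd.le)
        rw [← hev, ← hev, ← dist_eq_norm, dist_comm] at this
        exact this.trans_lt (by linarith)
      refine ⟨ρ, hρ, fun x y hxy f => ?_⟩
      rcases le_total x y with hle | hle
      · exact key f x y hle hxy
      · rw [dist_comm]; exact key f y x hle (by rwa [dist_comm])
  have := hc.image Φ.symm.continuous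
  rwa [image_preimage_eq _ Φ.symm.surjective] at this

theorem measure_compl_dyadicSet_le (hT : 0 < T) {P : Measure (PathSpace d T)} {M : ℝ} (hM : 0 ≤ M)
    (hP : ∀ s t, 0 ≤ s → s ≤ t → t ≤ T →
      ∫⁻ ω, ENNReal.ofReal (‖evalAt hT.le t ω - evalAt hT.le s ω‖ ^ 4) ∂P
        ≤ ENNReal.ofReal (M * (t - s) ^ 2)) (m : ℕ) :
    P (dyadicSet d hT.le m)ᶜ ≤ ENNReal.ofReal (M * T ^ 2 * (5 * (4 / 5) ^ m)) := by
  set B : ℕ → ℕ → Set (PathSpace d T) := fun n k =>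
    {ω | (9 / 10 : ℝ) ^ n < ‖evalAt hT.le ((k + 1 : ℕ) * (T / 2 ^ n)) ω
      - evalAt hT.le (k * (T / 2 ^ n)) ω‖} with hB
  have hsub : (dyadicSet d hT.le m)ᶜ ⊆ ⋃ n, ⋃ k ∈ Finset.range (2 ^ (n + m)), B (n + m) k := by
    intro ω hω
    simp only [dyadicSet, mem_compl_iff, mem_ofPred_eq] at hω
    push Not at hω
    obtain ⟨n, hn, k, hk, h⟩ := hω
    simp only [mem_iUnion, Finset.mem_range]
    refine ⟨n - m, k, ?_, ?_⟩ <;> rw [Nat.sub_add_cancel hn]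
    · exact hk
    · exact h
  have hBk : ∀ n k : ℕ, k < 2 ^ n → P (B n k) ≤ ENNReal.ofReal (M * (T / 2 ^ n) ^ 2
      / ((9 / 10) ^ n) ^ 4) := by
    intro n k hk
    have hk' : ((k + 1 : ℕ) : ℝ) ≤ 2 ^ n := by exact_mod_cast hk
    have h1 := hP (k * (T / 2 ^ n)) ((k + 1 : ℕ) * (T / 2 ^ n)) (by positivity)
      (by gcongr; simp) (by
        calc ((k + 1 : ℕ) : ℝ) * (T / 2 ^ n) ≤ 2 ^ n * (T / 2 ^ n) := by gcongr
          _ = T := by field_simp)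
    have e : ((k + 1 : ℕ) : ℝ) * (T / 2 ^ n) - k * (T / 2 ^ n) = T / 2 ^ n := by push_cast; ring
    rw [e] at h1
    have hm : Measurable fun ω : PathSpace d T => ENNReal.ofReal
        (‖evalAt hT.le ((k + 1 : ℕ) * (T / 2 ^ n)) ω - evalAt hT.le (k * (T / 2 ^ n)) ω‖ ^ 4) := by
      have h1 := measurable_evalAt (d := d) hT.le ((k + 1 : ℕ) * (T / 2 ^ n))
      have h2 := measurable_evalAt (d := d) hT.le (k * (T / 2 ^ n))
      fun_prop
    have hpos : (0:ℝ) < ((9 / 10) ^ n) ^ 4 := by positivity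
    have h2 := mul_meas_ge_le_lintegral (μ := P) hm (ENNReal.ofReal (((9 / 10) ^ n) ^ 4))
    rw [ENNReal.ofReal_div_of_pos hpos, ENNReal.le_div_iff_mul_le
      (Or.inl (by simpa using hpos)) (Or.inl ENNReal.ofReal_ne_top), mul_comm]
    refine le_trans ?_ (h2.trans h1)
    gcongr
    intro ω hω
    simp only [hB, mem_ofPred_eq] at hω ⊢
    gcongr
  have hn : ∀ n : ℕ, P (⋃ k ∈ Finset.range (2 ^ (n + m)), B (n + m) k)
      ≤ ENNReal.ofReal (M * T ^ 2 * (4 / 5) ^ m * (4 / 5) ^ n) := by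
    intro n
    refine (measure_biUnion_finset_le _ _).trans ?_
    refine (Finset.sum_le_sum fun k hk => hBk _ k (Finset.mem_range.mp hk)).trans ?_
    rw [Finset.sum_const, Finset.card_range, nsmul_eq_mul,
      ← ENNReal.ofReal_natCast (2 ^ (n + m)), ← ENNReal.ofReal_mul (by positivity)]
    refine ENNReal.ofReal_le_ofReal ?_
    rw [mul_assoc, ← pow_add, add_comm m n]
    have e : ((2 ^ (n + m) : ℕ) : ℝ) * (M * (T / 2 ^ (n + m)) ^ 2 / ((9 / 10) ^ (n + m)) ^ 4)
        = M * T ^ 2 * (5000 / 6561 : ℝ) ^ (n + m) := by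
      have : (5000 / 6561 : ℝ) = (2 * (9 / 10) ^ 4)⁻¹ := by norm_num
      rw [this, inv_pow, mul_pow, ← pow_mul, ← pow_mul, mul_comm 4]
      push_cast; field_simp
    rw [e]
    exact mul_le_mul_of_nonneg_left (pow_le_pow_left₀ (by norm_num) (by norm_num) _)
      (by positivity)
  refine (measure_mono hsub).trans ((measure_iUnion_le _).trans
    ((ENNReal.tsum_le_tsum hn).trans ?_))
  have hs : HasSum (fun n : ℕ => M * T ^ 2 * (4 / 5 : ℝ) ^ m * (4 / 5) ^ n)
      (M * T ^ 2 * (5 * (4 / 5) ^ m)) := by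
    have := (hasSum_geometric_of_lt_one (r := (4 / 5 : ℝ)) (by norm_num) (by norm_num)).mul_left
      (M * T ^ 2 * (4 / 5 : ℝ) ^ m)
    have e : M * T ^ 2 * (4 / 5 : ℝ) ^ m * (1 - 4 / 5)⁻¹ = M * T ^ 2 * (5 * (4 / 5) ^ m) := by
      norm_num; ring
    rwa [e] at this
  rw [← ENNReal.ofReal_tsum_of_nonneg (fun n => by positivity) hs.summable, hs.tsum_eq]

end FPFlow

namespace FPFlow

theorem exists_forall_measureReal_norm_gt_le {d : ℕ} (μ : Measure (Euc d)) [IsFiniteMeasure μ]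
    {ε : ℝ} (hε : 0 < ε) : ∃ R₀, 0 ≤ R₀ ∧ ∀ R, R₀ ≤ R → μ.real {x | R < ‖x‖} ≤ ε := by
  have h := tendsto_measure_norm_gt_of_isTightMeasureSet (isTightMeasureSet_singleton (μ := μ))
  simp only [mem_singleton_iff, iSup_iSup_eq_left] at h
  obtain ⟨R₀, h'⟩ := Filter.eventually_atTop.mp
    (h.eventually (gt_mem_nhds (ENNReal.ofReal_pos.mpr hε)))
  refine ⟨max 0 R₀, le_max_left _ _, fun R hR => ?_⟩
  exact ENNReal.toReal_le_of_le_ofReal hε.le (h' R ((le_max_right _ _).trans hR)).le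

variable {d : ℕ} {D : FPFlow d} {T : ℝ} {hT : 0 < T} {P : ℕ → Measure (PathSpace d T)} {N : ℕ → ℕ}

namespace IsApproxSeq

theorem exists_forall_initial_le (S : D.IsApproxSeq hT.le P N) {ε : ℝ} (hε : 0 < ε) :
    ∃ R, ∀ n, (P n).real {ω | R < ‖evalAt hT.le 0 ω‖} ≤ ε := by
  have hp := S.prob
  have hm0 := measurable_evalAt (d := d) hT.le 0
  have hmap : ∀ n R, ((P n).map (evalAt hT.le 0)).real {x | R < ‖x‖}
      = (P n).real {ω | R < ‖evalAt hT.le 0 ω‖} := fun n R =>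
    map_measureReal_apply hm0 (measurableSet_lt measurable_const measurable_norm)
  obtain ⟨R₁, hR₁, h1⟩ := exists_forall_measureReal_norm_gt_le (D.ν 0) (half_pos hε)
  let B : ContDiffBump (0 : Euc d) := ⟨R₁ + 1, R₁ + 2, by linarith, by linarith⟩
  have hBm : Measurable B := B.continuous.measurable
  have hB1 : ∀ x, |B x| ≤ 1 := fun x => by rw [abs_of_nonneg B.nonneg]; exact B.le_one
  obtain ⟨n₀, hn₀⟩ := Filter.eventually_atTop.mp (S.marginal B B.contDiff B.hasCompactSupport
    (ε / 2) (half_pos hε))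
  have hlarge : ∀ n, n₀ ≤ n → (P n).real {ω | R₁ + 2 < ‖evalAt hT.le 0 ω‖} ≤ ε := by
    intro n hn
    have h2 := hn₀ n hn 0 (by positivity)
    simp only [Nat.cast_zero, zero_mul] at h2
    have m1 : MeasurableSet {ω : PathSpace d T | R₁ + 2 < ‖evalAt hT.le 0 ω‖} :=
      measurableSet_lt measurable_const hm0.norm
    have m2 : MeasurableSet {x : Euc d | R₁ < ‖x‖} := measurableSet_lt measurable_const
      measurable_norm
    have a1 : (P n).real {ω | R₁ + 2 < ‖evalAt hT.le 0 ω‖} + ∫ ω, B (evalAt hT.le 0 ω) ∂(P n) ≤ 1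
      := by
      have hi : Integrable (fun ω => B (evalAt hT.le 0 ω)) (P n) :=
        integrable_of_abs_le (hBm.comp hm0) fun _ => hB1 _
      have hi' : Integrable (indicator {ω : PathSpace d T | R₁ + 2 < ‖evalAt hT.le 0 ω‖}
        (fun _ => (1:ℝ))) (P n) := (integrable_const _).indicator m1
      rw [← integral_indicator_one m1]
      change ∫ ω, indicator _ (fun _ => (1:ℝ)) ω ∂(P n) + _ ≤ _
      rw [← integral_add hi' hi]
      refine le_trans (integral_mono (g := fun _ => (1:ℝ)) (hi'.add hi) (integrable_const _)
        fun ω => ?_) (by simp)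
      by_cases h : ω ∈ {ω : PathSpace d T | R₁ + 2 < ‖evalAt hT.le 0 ω‖}
      · have : B (evalAt hT.le 0 ω) = 0 := B.zero_of_le_dist (by
          rw [dist_zero_right]; exact (mem_ofPred_eq ▸ h).le)
        simp [indicator_of_mem h, this]
      · simp only [indicator_of_notMem h, zero_add]; exact B.le_one
    have a2 : 1 ≤ (D.ν 0).real {x | R₁ < ‖x‖} + ∫ x, B x ∂(D.ν 0) := by
      have hi : Integrable (fun x => B x) (D.ν 0) := integrable_of_abs_le hBm fun _ => hB1 _
      have hi' : Integrable (indicator {x : Euc d | R₁ < ‖x‖} (fun _ => (1:ℝ))) (D.ν 0) :=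
        (integrable_const _).indicator m2
      rw [← integral_indicator_one m2]
      change _ ≤ ∫ ω, indicator _ (fun _ => (1:ℝ)) ω ∂(D.ν 0) + _
      rw [← integral_add hi' hi]
      refine le_trans (by simp) (integral_mono (f := fun _ => (1:ℝ)) (integrable_const _)
        (hi'.add hi) fun x => ?_)
      by_cases h : x ∈ {x : Euc d | R₁ < ‖x‖}
      · simp only [indicator_of_mem h]
        have := B.nonneg (x := x)
        linarith
      · have : B x = 1 := B.one_of_mem_closedBall (by
          rw [mem_closedBall_zero_iff]
          simp only [mem_ofPred_eq, not_lt] at h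
          change ‖x‖ ≤ R₁ + 1
          linarith)
        simp [indicator_of_notMem h, this]
    have a3 := h1 R₁ le_rfl
    have a4 := (abs_le.mp h2).1
    linarith
  choose R hR0 hR using fun n => exists_forall_measureReal_norm_gt_le ((P n).map (evalAt hT.le 0))
    hε
  refine ⟨(R₁ + 2) + ∑ n ∈ Finset.range n₀, R n, fun n => ?_⟩
  rcases lt_or_ge n n₀ with h | h
  · rw [← hmap]
    refine hR n _ ?_
    have := Finset.single_le_sum (f := R) (fun n _ => hR0 n) (Finset.mem_range.mpr h)
    linarith
  · refine le_trans (measureReal_mono fun ω hω => ?_) (hlarge n h)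
    have := Finset.sum_nonneg fun n (_ : n ∈ Finset.range n₀) => hR0 n
    simp only [mem_ofPred_eq] at hω ⊢
    linarith

theorem exists_forall_compl_dyadicSet_le (S : D.IsApproxSeq hT.le P N) {ε : ℝ} (hε : 0 < ε) :
    ∃ m, ∀ n, (P n).real (dyadicSet d hT.le m)ᶜ ≤ ε := by
  obtain ⟨M, hM, h⟩ := S.moment
  have : Filter.Tendsto (fun m : ℕ => M * T ^ 2 * (5 * (4 / 5 : ℝ) ^ m)) Filter.atTop (𝓝 0) := by
    simpa using ((tendsto_pow_atTop_nhds_zero_of_lt_one (r := (4 / 5 : ℝ)) (by norm_num)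
      (by norm_num)).const_mul 5).const_mul (M * T ^ 2)
  obtain ⟨m, hm⟩ := (this.eventually (gt_mem_nhds hε)).exists
  refine ⟨m, fun n => ENNReal.toReal_le_of_le_ofReal hε.le ?_⟩
  exact (measure_compl_dyadicSet_le hT hM (h n) m).trans (ENNReal.ofReal_le_ofReal hm.le)

theorem exists_limit (S : D.IsApproxSeq hT.le P N) :
    ∃ (Pr : Measure (PathSpace d T)) (l : Filter ℕ), IsProbabilityMeasure Pr ∧ l.NeBot ∧
      l ≤ Filter.atTop ∧ ∀ F : PathSpace d T → ℝ, Continuous F → (∃ C, ∀ ω, |F ω| ≤ C) →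
        Filter.Tendsto (fun n => ∫ ω, F ω ∂(P n)) l (𝓝 (∫ ω, F ω ∂Pr)) := by
  have hp := S.prob
  set Q : ℕ → ProbabilityMeasure (PathSpace d T) := fun n => ⟨P n, hp n⟩ with hQ
  have htight : IsTightMeasureSet {((μ : ProbabilityMeasure (PathSpace d T)) :
      Measure (PathSpace d T)) | μ ∈ range Q} := by
    rw [isTightMeasureSet_iff_exists_isCompact_measure_compl_le]
    intro ε hε
    obtain ⟨e, he, hee⟩ : ∃ e : ℝ, 0 < e ∧ ENNReal.ofReal e ≤ ε := by
      rcases eq_or_ne ε ∞ with h | h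
      · exact ⟨1, one_pos, by simp [h]⟩
      · exact ⟨ε.toReal, ENNReal.toReal_pos hε.ne' h, by rw [ENNReal.ofReal_toReal h]⟩
    obtain ⟨m, hm⟩ := S.exists_forall_compl_dyadicSet_le (hT := hT) (half_pos he)
    obtain ⟨R, hR⟩ := S.exists_forall_initial_le (hT := hT) (half_pos he)
    refine ⟨_, isCompact_dyadicSet_inter hT m R, ?_⟩
    rintro _ ⟨_, ⟨n, rfl⟩, rfl⟩
    change P n _ ≤ _
    refine le_trans ?_ hee
    rw [compl_inter]
    refine (measure_union_le _ _).trans ?_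
    rw [← ENNReal.ofReal_toReal (measure_ne_top (P n) (dyadicSet d hT.le m)ᶜ),
      ← ENNReal.ofReal_toReal (measure_ne_top (P n) {ω | ‖evalAt hT.le 0 ω‖ ≤ R}ᶜ),
      ← ENNReal.ofReal_add ENNReal.toReal_nonneg ENNReal.toReal_nonneg]
    refine ENNReal.ofReal_le_ofReal ?_
    have h1 := hm n
    have h2 := hR n
    have e1 : {ω : PathSpace d T | ‖evalAt hT.le 0 ω‖ ≤ R}ᶜ = {ω | R < ‖evalAt hT.le 0 ω‖} := by
      ext ω; simp
    rw [e1]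
    exact (add_le_add h1 h2).trans_eq (add_halves e)
  have hc := isCompact_closure_of_isTightMeasureSet htight
  obtain ⟨Pr, -, hPr⟩ := hc.ultrafilter_le_nhds ((Filter.hyperfilter ℕ).map Q) (by
    refine Filter.le_principal_iff.mpr (Filter.mem_map.mpr (Filter.univ_mem' fun n => ?_))
    exact subset_closure (mem_range_self n))
  refine ⟨Pr, Filter.hyperfilter ℕ, inferInstance, inferInstance, Nat.hyperfilter_le_atTop, ?_⟩
  rintro F hF ⟨C, hC⟩
  have ht : Filter.Tendsto Q (Filter.hyperfilter ℕ) (𝓝 Pr) := hPr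
  exact (ProbabilityMeasure.tendsto_iff_forall_integral_tendsto.mp ht)
    (BoundedContinuousFunction.ofNormedAddCommGroup F hF C hC)

end IsApproxSeq

end FPFlow

theorem abs_integral_le_add_measureReal_compl {α : Type*} [MeasurableSpace α] {μ : Measure α}
    [IsProbabilityMeasure μ] {H : α → ℝ} (hH : Measurable H) {A : Set α} (hA : MeasurableSet A)
    {C e : ℝ} (he : 0 ≤ e) (hC : ∀ x, |H x| ≤ C) (hAe : ∀ x ∈ A, |H x| ≤ e) :
    |∫ x, H x ∂μ| ≤ e + C * μ.real Aᶜ := by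
  have hi : Integrable H μ := FPFlow.integrable_of_abs_le hH hC
  have h1 := norm_setIntegral_le_of_norm_le_const (μ := μ) (s := A) (f := H) (C := e)
    (measure_lt_top _ _) hAe
  have h2 := norm_setIntegral_le_of_norm_le_const (μ := μ) (s := Aᶜ) (f := H) (C := C)
    (measure_lt_top _ _) fun x _ => hC x
  rw [← integral_add_compl hA hi]
  refine (abs_add_le _ _).trans (add_le_add (h1.trans ?_) h2)
  exact mul_le_of_le_one_right he measureReal_le_one

theorem ext_of_integral_contDiff {E : Type*} [NormedAddCommGroup E] [NormedSpace ℝ E]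
    [FiniteDimensional ℝ E] [MeasurableSpace E] [BorelSpace E] {μ ν : Measure E}
    [IsProbabilityMeasure μ] [IsProbabilityMeasure ν]
    (h : ∀ f : E → ℝ, ContDiff ℝ (⊤ : ℕ∞) f → HasCompactSupport f → ∫ x, f x ∂μ = ∫ x, f x ∂ν) :
    μ = ν := by
  have : ProperSpace E := FiniteDimensional.proper_real E
  refine Measure.ext_of_integral_eq_on_compactlySupported fun f => ?_
  have hfi : ∀ m : Measure E, IsProbabilityMeasure m → Integrable (fun x => f x) m := fun m _ =>
    f.continuous.integrable_of_hasCompactSupport f.hasCompactSupport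
  refine eq_of_forall_dist_le fun ε hε => ?_
  obtain ⟨g, hg, hgf, hgs⟩ := f.continuous.exists_contDiff_approx (⊤ : ℕ∞)
    (ε := fun _ => ε / 2) continuous_const fun _ => half_pos hε
  have hgc : HasCompactSupport g := f.hasCompactSupport.mono hgs
  have key : ∀ m : Measure E, IsProbabilityMeasure m → |∫ x, f x ∂m - ∫ x, g x ∂m| ≤ ε / 2 := by
    intro m _
    rw [← integral_sub (hfi m inferInstance)
      (hg.continuous.integrable_of_hasCompactSupport hgc)]
    refine FPFlow.abs_integral_le_of_abs_le fun x => ?_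
    have := (hgf x).le
    rwa [dist_comm, Real.dist_eq] at this
  have h1 := key μ inferInstance
  have h2 := key ν inferInstance
  rw [h g hg hgc] at h1
  rw [Real.dist_eq]
  rw [abs_sub_comm] at h2
  exact (abs_sub_le _ _ _).trans ((add_le_add h1 h2).trans_eq (add_halves ε))

namespace FPFlow

variable {d : ℕ} {D : FPFlow d} {T : ℝ} {hT : 0 < T} {P : ℕ → Measure (PathSpace d T)} {N : ℕ → ℕ}

namespace IsApproxSeq

theorem tendsto_mesh (S : D.IsApproxSeq hT.le P N) :
    Filter.Tendsto (fun n => T / 2 ^ N n) Filter.atTop (𝓝 0) := by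
  have h1 : Filter.Tendsto N Filter.atTop Filter.atTop :=
    Filter.tendsto_atTop_mono S.le Filter.tendsto_id
  have h2 : Filter.Tendsto (fun n => T * (2⁻¹ : ℝ) ^ N n) Filter.atTop (𝓝 (T * 0)) :=
    ((tendsto_pow_atTop_nhds_zero_of_lt_one (r := (2⁻¹ : ℝ)) (by norm_num)
      (by norm_num)).comp h1).const_mul T
  simpa [div_eq_mul_inv] using h2

theorem eventually_abs_integral_le (S : D.IsApproxSeq hT.le P N) {H : ℕ → PathSpace d T → ℝ}
    (hH : ∀ n, Measurable (H n)) {C : ℝ} (hC : ∀ n ω, |H n ω| ≤ C)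
    (hm : ∀ m, ∀ e > 0, ∀ᶠ n in Filter.atTop, ∀ ω ∈ dyadicSet d hT.le m, |H n ω| ≤ e)
    {η : ℝ} (hη : 0 < η) : ∀ᶠ n in Filter.atTop, |∫ ω, H n ω ∂(P n)| ≤ η := by
  have hp := S.prob
  have hC0 : 0 ≤ C := (abs_nonneg _).trans (hC 0 0)
  obtain ⟨m, h⟩ := S.exists_forall_compl_dyadicSet_le (hT := hT)
    (ε := η / (2 * (C + 1))) (by positivity)
  filter_upwards [hm m (η / 2) (by positivity)] with n hn
  refine (abs_integral_le_add_measureReal_compl (hH n) (isClosed_dyadicSet hT.le m).measurableSet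
    (half_pos hη).le (hC n) hn).trans ?_
  have : C * (P n).real (dyadicSet d hT.le m)ᶜ ≤ (C + 1) * (η / (2 * (C + 1))) :=
    mul_le_mul (by linarith) (h n) measureReal_nonneg (by positivity)
  have e : (C + 1) * (η / (2 * (C + 1))) = η / 2 := by field_simp
  linarith

theorem map_evalAt_limit (S : D.IsApproxSeq hT.le P N) {Pr : Measure (PathSpace d T)}
    [IsProbabilityMeasure Pr] {l : Filter ℕ} [l.NeBot] (hl : l ≤ Filter.atTop)
    (hlim : ∀ F : PathSpace d T → ℝ, Continuous F → (∃ C, ∀ ω, |F ω| ≤ C) →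
      Filter.Tendsto (fun n => ∫ ω, F ω ∂(P n)) l (𝓝 (∫ ω, F ω ∂Pr)))
    {t : ℝ} (ht0 : 0 ≤ t) (htT : t ≤ T) : Pr.map (evalAt hT.le t) = D.ν t := by
  have hp := S.prob
  have hmt := measurable_evalAt (d := d) hT.le t
  have := Measure.isProbabilityMeasure_map (μ := Pr) hmt.aemeasurable
  refine ext_of_integral_contDiff fun f hf hfc => ?_
  obtain ⟨C, hC0, h0, h1, h2⟩ := exists_bound_derivatives (hf.of_le (by norm_cast)) hfc
  have hfm := hf.continuous.measurable
  rw [integral_map hmt.aemeasurable hfm.aestronglyMeasurable]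
  refine tendsto_nhds_unique (hlim (fun ω => f (evalAt hT.le t ω))
    (hf.continuous.comp (continuous_evalAt hT.le t)) ⟨C, fun ω => h0 _⟩) ?_
  refine Filter.Tendsto.mono_left ?_ hl
  set h : ℕ → ℝ := fun n => T / 2 ^ N n with hh
  have hpos : ∀ n, 0 < h n := fun n => by positivity
  set j : ℕ → ℕ := fun n => ⌊t / h n⌋₊ with hj
  have j1 : ∀ n, j n * h n ≤ t := fun n =>
    (le_div_iff₀ (hpos n)).mp (Nat.floor_le (div_nonneg ht0 (hpos n).le))
  have j2 : ∀ n, t - j n * h n ≤ h n := fun n => by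
    have := (div_lt_iff₀ (hpos n)).mp (Nat.lt_floor_add_one (t / h n))
    linarith
  have j3 : ∀ n, j n ≤ 2 ^ N n := fun n => by
    refine Nat.floor_le_of_le ?_
    rw [div_le_iff₀ (hpos n)]
    simp only [hh]
    push_cast
    field_simp
    exact htT
  have hfu := hf.continuous.uniformContinuous_of_tendsto_cocompact (x := 0) hfc.is_zero_at_infty
  set L := C * D.K + d * (C * D.K ^ 2) with hL
  have hL0 : 0 ≤ L := by have := D.K_nonneg; positivity
  refine Metric.tendsto_atTop'.mpr fun ε hε => ?_
  have hmesh := S.tendsto_mesh (hT := hT)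
  have a1 := S.eventually_abs_integral_le (hT := hT) (C := 2 * C)
    (H := fun n ω => f (evalAt hT.le t ω) - f (evalAt hT.le (j n * h n) ω))
    (fun n => (hfm.comp hmt).sub (hfm.comp (measurable_evalAt hT.le _)))
    (fun n ω => (abs_sub _ _).trans ((add_le_add (h0 _) (h0 _)).trans_eq (two_mul C).symm))
      (fun m e he => by
      obtain ⟨r, hr, hfr⟩ := Metric.uniformContinuous_iff.mp hfu e he
      obtain ⟨ρ, hρ, hω⟩ := exists_modulus_dyadicSet (d := d) hT m (half_pos hr)
      filter_upwards [hmesh.eventually (gt_mem_nhds hρ)] with n hn ω hωm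
      refine (hfr ?_).le
      rw [dist_eq_norm]
      refine (hω ω hωm _ _ (by have := hpos n; positivity) (j1 n) htT
        ((j2 n).trans hn.le)).trans_lt (by linarith)) (η := ε / 4) (by positivity)
  have a2 := S.marginal f hf hfc (ε / 4) (by positivity)
  have hmesh2 : Filter.Tendsto (fun n => L * h n) Filter.atTop (𝓝 0) := by
    simpa using hmesh.const_mul L
  obtain ⟨n₀, hn₀⟩ := Filter.eventually_atTop.mp
    ((a1.and a2).and (hmesh2.eventually (gt_mem_nhds (by positivity : (0:ℝ) < ε / 4))))
  refine ⟨n₀, fun n hn => ?_⟩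
  obtain ⟨⟨b1, b2⟩, b3⟩ := hn₀ n hn.le
  have b2 := b2 (j n) (j3 n)
  have b4 := D.abs_integral_sub_le hf hfc (D.abs_gen_le h1 h2)
    (by have := hpos n; positivity : (0:ℝ) ≤ j n * h n) (j1 n)
  have b5 : L * (t - j n * h n) ≤ L * h n := mul_le_mul_of_nonneg_left (j2 n) hL0
  have hi : ∀ r, Integrable (fun ω => f (evalAt hT.le r ω)) (P n) := fun r =>
    integrable_of_abs_le (hfm.comp (measurable_evalAt hT.le r)) fun _ => h0 _
  rw [integral_sub (hi _) (hi _)] at b1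
  rw [Real.dist_eq]
  rw [abs_le] at b1 b2 b4
  rw [abs_lt]
  constructor <;> linarith [b1.1, b1.2, b2.1, b2.2, b4.1, b4.2]

end IsApproxSeq

end FPFlow

theorem abs_intervalIntegral_sub_sum_le {ψ : ℝ → ℝ} (hψ : Continuous ψ) {h w : ℝ} (hh : 0 ≤ h)
    {k l : ℕ} (hkl : k ≤ l)
    (hw : ∀ j ∈ Finset.Ico k l, ∀ r, j * h ≤ r → r ≤ (j + 1 : ℕ) * h → |ψ r - ψ (j * h)| ≤ w) :
    |(∫ r in (k * h)..(l * h), ψ r) - ∑ j ∈ Finset.Ico k l, h * ψ (j * h)| ≤ (l * h - k * h) * w :=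
      by
  have e1 := intervalIntegral.sum_integral_adjacent_intervals_Ico (f := ψ) (μ := volume)
    (a := fun j : ℕ => (j : ℝ) * h) hkl fun j _ => hψ.intervalIntegrable _ _
  rw [← e1, ← Finset.sum_sub_distrib]
  have hj : ∀ j ∈ Finset.Ico k l,
      |(∫ r in ((j : ℝ) * h)..((j + 1 : ℕ) * h), ψ r) - h * ψ (j * h)| ≤ h * w := by
    intro j hj
    have hle : (j : ℝ) * h ≤ (j + 1 : ℕ) * h := by push_cast; nlinarith
    have e2 : h * ψ (j * h) = ∫ _r in ((j : ℝ) * h)..((j + 1 : ℕ) * h), ψ (j * h) := by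
      rw [intervalIntegral.integral_const, smul_eq_mul]; push_cast; ring
    rw [e2, ← intervalIntegral.integral_sub (hψ.intervalIntegrable _ _) (by simp)]
    have := intervalIntegral.norm_integral_le_of_norm_le_const (a := (j : ℝ) * h)
      (b := (j + 1 : ℕ) * h) (C := w) (f := fun r => ψ r - ψ (j * h)) (fun r hr => by
        rw [uIoc_of_le hle] at hr
        exact hw j hj r hr.1.le hr.2)
    rw [Real.norm_eq_abs] at this
    refine this.trans_eq ?_
    rw [abs_of_nonneg (by linarith)]; push_cast; ring
  refine (Finset.abs_sum_le_sum_abs _ _).trans ((Finset.sum_le_sum hj).trans_eq ?_)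
  rw [Finset.sum_const, Nat.card_Ico, nsmul_eq_mul, Nat.cast_sub hkl]
  ring

namespace FPFlow

variable {d : ℕ} {D : FPFlow d} {T : ℝ} {hT : 0 < T} {P : ℕ → Measure (PathSpace d T)} {N : ℕ → ℕ}

theorem continuous_comp_path (hT : 0 ≤ T) {g : ℝ × Euc d → ℝ} (hg : Continuous g) :
    Continuous fun p : PathSpace d T × ℝ => g (p.2, evalAt hT p.2 p.1) :=
  hg.comp (continuous_snd.prodMk ((continuous_evalAt_uncurry hT).comp
    (continuous_snd.prodMk continuous_fst)))

theorem continuous_integral_path (hT : 0 ≤ T) {g : ℝ × Euc d → ℝ} (hg : Continuous g) (s t : ℝ) :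
    Continuous fun ω : PathSpace d T => ∫ r in s..t, g (r, evalAt hT r ω) :=
  intervalIntegral.continuous_parametric_intervalIntegral_of_continuous'
    (f := fun (ω : PathSpace d T) r => g (r, evalAt hT r ω)) (continuous_comp_path hT hg) s t

namespace IsApproxSeq

theorem abs_integral_limit_le (S : D.IsApproxSeq hT.le P N) {Pr : Measure (PathSpace d T)}
    [IsProbabilityMeasure Pr] {l : Filter ℕ} [l.NeBot] (hl : l ≤ Filter.atTop)
    (hlim : ∀ F : PathSpace d T → ℝ, Continuous F → (∃ C, ∀ ω, |F ω| ≤ C) →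
      Filter.Tendsto (fun n => ∫ ω, F ω ∂(P n)) l (𝓝 (∫ ω, F ω ∂Pr)))
    {φ : Euc d → ℝ} (hφ : Continuous φ) (hφc : HasCompactSupport φ)
    {g : ℝ × Euc d → ℝ} (hg : Continuous g) (hgc : HasCompactSupport g)
    {G : PathSpace d T → ℝ} (hG : Continuous G) (hG1 : ∀ ω, |G ω| ≤ 1)
    {s t B : ℝ} (hs : 0 ≤ s) (hst : s ≤ t) (ht : t ≤ T)
    (hM : ∀ η > 0, ∀ᶠ n in Filter.atTop, ∀ k l : ℕ, k ≤ l → l ≤ 2 ^ N n → s ≤ k * (T / 2 ^ N n) →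
      |∫ ω, G ω * (φ (evalAt hT.le (l * (T / 2 ^ N n)) ω) - φ (evalAt hT.le (k * (T / 2 ^ N n)) ω)
        - ∑ j ∈ Finset.Ico k l, (T / 2 ^ N n) * g (j * (T / 2 ^ N n),
          evalAt hT.le (j * (T / 2 ^ N n)) ω)) ∂(P n)| ≤ B + η) :
    |∫ ω, G ω * (φ (evalAt hT.le t ω) - φ (evalAt hT.le s ω)
      - ∫ r in s..t, g (r, evalAt hT.le r ω)) ∂Pr| ≤ B := by
  have hp := S.prob
  obtain ⟨C, hC⟩ := hφ.bounded_above_of_compact_support hφc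
  obtain ⟨C', hC'⟩ := hg.bounded_above_of_compact_support hgc
  have hC0 : 0 ≤ C := (norm_nonneg _).trans (hC 0)
  have hC'0 : 0 ≤ C' := (norm_nonneg _).trans (hC' 0)
  have hφu := hφ.uniformContinuous_of_tendsto_cocompact (x := 0) hφc.is_zero_at_infty
  have hgu := hg.uniformContinuous_of_tendsto_cocompact (x := 0) hgc.is_zero_at_infty
  set h : ℕ → ℝ := fun n => T / 2 ^ N n with hh
  have hmesh : Filter.Tendsto h Filter.atTop (𝓝 0) := S.tendsto_mesh (hT := hT)
  have hpos : ∀ n, 0 < h n := fun n => by positivity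
  set k : ℕ → ℕ := fun n => ⌈s / h n⌉₊ with hk
  set m : ℕ → ℕ := fun n => ⌈t / h n⌉₊ with hm
  have hkm : ∀ n, k n ≤ m n := fun n => Nat.ceil_mono (by have := hpos n; gcongr)
  have hmN : ∀ n, m n ≤ 2 ^ N n := fun n => by
    refine Nat.ceil_le.mpr ?_
    rw [div_le_iff₀ (hpos n)]
    simp only [hh]
    push_cast
    field_simp
    exact ht
  have hceil : ∀ n r, 0 ≤ r → r ≤ ⌈r / h n⌉₊ * h n ∧ ⌈r / h n⌉₊ * h n - r ≤ h n := by
    intro n r hr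
    have h1 := (div_le_iff₀ (hpos n)).mp (Nat.le_ceil (r / h n))
    have h2 := (Nat.ceil_lt_add_one (div_nonneg hr (hpos n).le)).le
    have h3 := mul_le_mul_of_nonneg_right h2 (hpos n).le
    rw [add_mul, div_mul_cancel₀ _ (hpos n).ne'] at h3
    exact ⟨h1, by linarith⟩
  have hmT : ∀ n (j : ℕ), j ≤ 2 ^ N n → j * h n ≤ T := fun n j hj => by
    have : (j : ℝ) ≤ 2 ^ N n := by exact_mod_cast hj
    have h1 := mul_le_mul_of_nonneg_right this (hpos n).le
    have h2 : (2:ℝ) ^ N n * h n = T := by simp only [hh]; field_simp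
    linarith
  set Φ : PathSpace d T → ℝ := fun ω => φ (evalAt hT.le t ω) - φ (evalAt hT.le s ω)
      - ∫ r in s..t, g (r, evalAt hT.le r ω) with hΦ
  set Ψ : ℕ → PathSpace d T → ℝ := fun n ω => φ (evalAt hT.le (m n * h n) ω)
    - φ (evalAt hT.le (k n * h n) ω)
    - ∑ j ∈ Finset.Ico (k n) (m n), h n * g (j * h n, evalAt hT.le (j * h n) ω) with hΨ
  have hev := continuous_evalAt (d := d) hT.le
  have hΦc : Continuous Φ :=
    ((hφ.comp (hev t)).sub (hφ.comp (hev s))).sub (continuous_integral_path hT.le hg s t)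
  have hΨc : ∀ n, Continuous (Ψ n) := fun n =>
    ((hφ.comp (hev _)).sub (hφ.comp (hev _))).sub (continuous_finsetSum _ fun j _ =>
      continuous_const.mul (hg.comp (continuous_const.prodMk (hev _))))
  have hφ2 : ∀ x y, |φ x - φ y| ≤ 2 * C := fun x y =>
    (abs_sub _ _).trans ((add_le_add (hC _) (hC _)).trans_eq (two_mul C).symm)
  have hΦb : ∀ ω, |Φ ω| ≤ 2 * C + T * C' := by
    intro ω
    refine (abs_sub _ _).trans (add_le_add (hφ2 _ _) ?_)
    have := intervalIntegral.norm_integral_le_of_norm_le_const (a := s) (b := t) (C := C')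
      (f := fun r => g (r, evalAt hT.le r ω)) fun r _ => hC' _
    rw [Real.norm_eq_abs, abs_of_nonneg (by linarith : 0 ≤ t - s)] at this
    nlinarith
  have hΨb : ∀ n ω, |Ψ n ω| ≤ 2 * C + T * C' := by
    intro n ω
    refine (abs_sub _ _).trans (add_le_add (hφ2 _ _) ?_)
    refine (Finset.abs_sum_le_sum_abs _ _).trans ((Finset.sum_le_sum (g := fun _ => h n * C')
      fun j _ => ?_).trans ?_)
    · rw [abs_mul, abs_of_pos (hpos n)]
      exact mul_le_mul_of_nonneg_left (hC' _) (hpos n).le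
    · rw [Finset.sum_const, Nat.card_Ico, nsmul_eq_mul, ← mul_assoc]
      refine mul_le_mul_of_nonneg_right ?_ hC'0
      exact hmT n _ ((Nat.sub_le _ _).trans (hmN n))
  have hGm : ∀ a b ω, |a| ≤ b → |G ω * a| ≤ b := fun a b ω hab => by
    rw [abs_mul]
    exact (mul_le_mul (hG1 ω) hab (abs_nonneg _) zero_le_one).trans_eq (one_mul b)
  have hsmall : ∀ p, ∀ e > 0, ∀ᶠ n in Filter.atTop, ∀ ω ∈ dyadicSet d hT.le p,
      |G ω * (Φ ω - Ψ n ω)| ≤ e := by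
    intro p e he
    set w := e / (8 * (T + 1)) with hw
    have hw0 : 0 < w := by positivity
    have hwT : (T + 1) * w = e / 8 := by rw [hw]; field_simp
    obtain ⟨r₁, hr₁, hφr⟩ := Metric.uniformContinuous_iff.mp hφu w hw0
    obtain ⟨r₂, hr₂, hgr⟩ := Metric.uniformContinuous_iff.mp hgu w hw0
    obtain ⟨ρ, hρ, hω⟩ := exists_modulus_dyadicSet (d := d) hT p
      (half_pos (lt_min hr₁ hr₂))
    have hmesh2 : Filter.Tendsto (fun n => h n * C') Filter.atTop (𝓝 0) := by
      simpa using hmesh.mul_const C'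
    filter_upwards [hmesh.eventually (gt_mem_nhds (lt_min hρ hr₂)),
      hmesh2.eventually (gt_mem_nhds (by positivity : (0:ℝ) < e / 8))] with n hn hn2 ω hωp
    have hnρ : h n < ρ := hn.trans_le (min_le_left _ _)
    have hnr : h n < r₂ := hn.trans_le (min_le_right _ _)
    have hmod : ∀ r r', 0 ≤ r → r ≤ r' → r' ≤ T → r' - r ≤ h n →
        dist (evalAt hT.le r' ω) (evalAt hT.le r ω) < min r₁ r₂ := fun r r' h0 h1 h2 h3 => by
      rw [dist_eq_norm]
      have := lt_min hr₁ hr₂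
      exact (hω ω hωp r r' h0 h1 h2 (h3.trans hnρ.le)).trans_lt (by linarith)
    refine hGm _ _ _ ?_
    obtain ⟨k1, k2⟩ := hceil n s hs
    obtain ⟨m1, m2⟩ := hceil n t (hs.trans hst)
    have kT := hmT n (k n) ((hkm n).trans (hmN n))
    have mT := hmT n (m n) (hmN n)
    have b1 : |φ (evalAt hT.le (m n * h n) ω) - φ (evalAt hT.le t ω)| ≤ w :=
      (hφr ((hmod t _ (hs.trans hst) m1 mT m2).trans_le (min_le_left _ _))).le
    have b2 : |φ (evalAt hT.le (k n * h n) ω) - φ (evalAt hT.le s ω)| ≤ w :=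
      (hφr ((hmod s _ hs k1 kT k2).trans_le (min_le_left _ _))).le
    have hψ : Continuous fun r => g (r, evalAt hT.le r ω) :=
      hg.comp (continuous_id.prodMk (continuous_evalAt_left hT.le ω))
    have b3 := abs_intervalIntegral_sub_sum_le hψ (hpos n).le (hkm n) (w := w)
      (fun j hj r hr1 hr2 => by
        have hj2 : j + 1 ≤ 2 ^ N n := le_trans (Finset.mem_Ico.mp hj).2 (hmN n)
        have hd : r - j * h n ≤ h n := by push_cast at hr2; linarith
        refine (hgr ?_).le
        rw [Prod.dist_eq]
        refine max_lt ?_ ?_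
        · change dist r (j * h n) < _
          rw [Real.dist_eq, abs_of_nonneg (by linarith)]
          linarith
        · exact (hmod _ _ (by have := hpos n; positivity) hr1
            (hr2.trans (hmT n _ hj2)) hd).trans_le (min_le_right _ _))
    have hsm : ∀ r r', r ≤ r' → r' - r ≤ h n →
        |∫ u in r..r', g (u, evalAt hT.le u ω)| ≤ e / 8 := fun r r' h1 h2 => by
      have := intervalIntegral.norm_integral_le_of_norm_le_const (a := r) (b := r') (C := C')
        (f := fun r => g (r, evalAt hT.le r ω)) fun r _ => hC' _
      rw [Real.norm_eq_abs, abs_of_nonneg (by linarith : 0 ≤ r' - r)] at this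
      nlinarith
    have b4 := hsm s _ k1 k2
    have b5 := hsm t _ m1 m2
    have hii : ∀ a b, IntervalIntegrable (fun r => g (r, evalAt hT.le r ω)) volume a b :=
      fun a b => hψ.intervalIntegrable a b
    have e1 := intervalIntegral.integral_add_adjacent_intervals (hii s (k n * h n))
      (hii (k n * h n) (m n * h n))
    have e2 := intervalIntegral.integral_add_adjacent_intervals (hii s t) (hii t (m n * h n))
    have b6 : (m n * h n - k n * h n) * w ≤ T * w := by
      have : 0 ≤ k n * h n := by have := hpos n; positivity
      gcongr; linarith
    simp only [hΦ, hΨ]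
    rw [abs_le] at b1 b2 b3 b4 b5 ⊢
    have hwe : w ≤ e / 8 := by nlinarith
    have hTw : T * w ≤ e / 8 := by nlinarith
    constructor <;> linarith [b1.1, b1.2, b2.1, b2.2, b3.1, b3.2, b4.1, b4.2, b5.1, b5.2]
  refine le_of_forall_pos_le_add fun η hη => ?_
  refine le_of_tendsto ((hlim (fun ω => G ω * Φ ω) (hG.mul hΦc)
    ⟨2 * C + T * C', fun ω => hGm _ _ _ (hΦb ω)⟩).abs) (Filter.Eventually.filter_mono hl ?_)
  have a1 := S.eventually_abs_integral_le (hT := hT) (H := fun n ω => G ω * (Φ ω - Ψ n ω))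
    (fun n => (hG.mul (hΦc.sub (hΨc n))).measurable)
    (fun n ω => hGm _ _ _ ((abs_sub _ _).trans (add_le_add (hΦb ω) (hΨb n ω)))) hsmall (half_pos hη)
  filter_upwards [a1, hM (η / 2) (half_pos hη)] with n h1 h2
  have h3 := h2 (k n) (m n) (hkm n) (hmN n) (hceil n s hs).1
  change |∫ ω, G ω * Ψ n ω ∂(P n)| ≤ _ at h3
  simp only [mul_sub] at h1
  have i1 : Integrable (fun ω => G ω * Φ ω) (P n) :=
    integrable_of_abs_le (hG.mul hΦc).measurable fun ω => hGm _ _ _ (hΦb ω)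
  have i2 : Integrable (fun ω => G ω * Ψ n ω) (P n) :=
    integrable_of_abs_le (hG.mul (hΨc n)).measurable fun ω => hGm _ _ _ (hΨb n ω)
  rw [integral_sub i1 i2] at h1
  rw [abs_le] at h1 h3 ⊢
  constructor <;> linarith [h1.1, h1.2, h3.1, h3.2]

end IsApproxSeq

end FPFlow

section Coordinates

variable {d : ℕ}

theorem pd2_eq {φ : Euc d → ℝ} (hφ : ContDiff ℝ 2 φ) (i j : Fin d) (x : Euc d) :
    pd2 i j φ x = fderiv ℝ (fderiv ℝ φ) x (EuclideanSpace.single i 1)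
      (EuclideanSpace.single j 1) := by
  have h1 : ContDiff ℝ 1 (fderiv ℝ φ) := hφ.fderiv_right (by norm_num)
  unfold pd2
  rw [fderiv_clm_apply (h1.differentiable (by norm_num) x) (differentiableAt_const _)]
  simp

theorem euc_eq_sum (v : Euc d) : v = ∑ i, v i • EuclideanSpace.single i (1:ℝ) := by
  have := (EuclideanSpace.basisFun (Fin d) ℝ).sum_repr v
  simpa using this.symm

theorem diffOp_eq_sum (B : Euc d) (S : Fin d → Euc d) {φ : Euc d → ℝ} (hφ : ContDiff ℝ 2 φ)
    (x : Euc d) : diffOp B S φ x = ∑ i, B i * pd i φ x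
      + (1 / 2 : ℝ) * ∑ i, ∑ j, (∑ k, S k i * S k j) * pd2 i j φ x := by
  unfold diffOp
  congr 1
  · conv_lhs => rw [euc_eq_sum B]
    simp [pd, map_sum]
  · congr 1
    have h : ∀ k, fderiv ℝ (fderiv ℝ φ) x (S k) (S k)
        = ∑ i, ∑ j, (S k i * S k j) * pd2 i j φ x := by
      intro k
      conv_lhs => rw [euc_eq_sum (S k)]
      simp only [map_sum, map_smul, sum_apply, smul_apply,
        smul_eq_mul, pd2_eq hφ]
      rw [Finset.sum_comm]
      refine Finset.sum_congr rfl fun i _ => ?_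
      rw [Finset.mul_sum]
      exact Finset.sum_congr rfl fun j _ => by ring
    simp only [h, Finset.sum_mul]
    rw [Finset.sum_comm]
    refine Finset.sum_congr rfl fun i _ => ?_
    rw [Finset.sum_comm]

theorem continuous_pd {φ : Euc d → ℝ} (hφ : ContDiff ℝ 2 φ) (i : Fin d) : Continuous (pd i φ) :=
  (hφ.continuous_fderiv (by norm_num)).clm_apply continuous_const

theorem continuous_pd2 {φ : Euc d → ℝ} (hφ : ContDiff ℝ 2 φ) (i j : Fin d) :
    Continuous (pd2 i j φ) := by
  have h1 : ContDiff ℝ 1 (fderiv ℝ φ) := hφ.fderiv_right (by norm_num)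
  have : pd2 i j φ = fun x => fderiv ℝ (fderiv ℝ φ) x (EuclideanSpace.single i 1)
      (EuclideanSpace.single j 1) := funext fun x => pd2_eq hφ i j x
  rw [this]
  exact ((h1.continuous_fderiv (by norm_num)).clm_apply continuous_const).clm_apply continuous_const

theorem abs_pd_le {φ : Euc d → ℝ} {C : ℝ} (h : ∀ x, ‖fderiv ℝ φ x‖ ≤ C) (i : Fin d) (x : Euc d) :
    |pd i φ x| ≤ C := by
  refine ((fderiv ℝ φ x).le_opNorm _).trans ?_
  simpa using h x

theorem abs_pd2_le {φ : Euc d → ℝ} (hφ : ContDiff ℝ 2 φ) {C : ℝ}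
    (h : ∀ x, ‖fderiv ℝ (fderiv ℝ φ) x‖ ≤ C) (i j : Fin d) (x : Euc d) : |pd2 i j φ x| ≤ C := by
  rw [pd2_eq hφ]
  refine ((fderiv ℝ (fderiv ℝ φ) x).le_opNorm₂ _ _).trans ?_
  simpa using h x

end Coordinates

theorem abs_clamp_sub_clamp_le {M : ℝ} (a b : ℝ) :
    |max (-M) (min a M) - max (-M) (min b M)| ≤ |a - b| := by
  refine (abs_max_sub_max_le_max _ _ _ _).trans ?_
  rw [sub_self, abs_zero, max_eq_right (abs_nonneg _)]
  refine (abs_min_sub_min_le_max _ _ _ _).trans ?_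
  rw [sub_self, abs_zero, max_eq_left (abs_nonneg _)]

namespace FPFlow

variable {d : ℕ} (D : FPFlow d) {T : ℝ}

theorem exists_continuous_approx (hT : 0 ≤ T) {c : ℝ × Euc d → ℝ} (hc : Measurable c) {M : ℝ}
    (hM : ∀ u, |c u| ≤ M) {ε : ℝ} (hε : 0 < ε) : ∃ c' : ℝ × Euc d → ℝ, Continuous c' ∧
      HasCompactSupport c' ∧ (∀ u, |c' u| ≤ M) ∧
      ∫ s in (0:ℝ)..T + 1, ∫ y, |c (s, y) - c' (s, y)| ∂(D.ν s) ≤ ε := by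
  have hM0 : 0 ≤ M := (abs_nonneg _).trans (hM 0)
  set m : Measure (ℝ × Euc d) := (volume.restrict (Ioc 0 (T + 1))) ⊗ₘ D.ν with hm
  obtain ⟨g, hgc, hg, hgcont, hgi⟩ := (integrable_of_abs_le (μ := m) hc
    hM).exists_hasCompactSupport_integral_sub_le hε
  set c' : ℝ × Euc d → ℝ := fun u => max (-M) (min (g u) M) with hc'
  have hc'c : Continuous c' := continuous_const.max (hgcont.min continuous_const)
  have hc'M : ∀ u, |c' u| ≤ M := fun u =>
    abs_le.mpr ⟨le_max_left _ _, max_le (by linarith) (min_le_right _ _)⟩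
  refine ⟨c', hc'c, ?_, hc'M, ?_⟩
  · exact hgc.comp_left (g := fun r => max (-M) (min r M)) (by simp [hM0])
  · have hd : ∀ u, |c u - c' u| ≤ ‖c u - g u‖ := fun u => by
      have e : c u = max (-M) (min (c u) M) := by
        rw [min_eq_left (abs_le.mp (hM u)).2, max_eq_right (abs_le.mp (hM u)).1]
      conv_lhs => rw [e]
      exact abs_clamp_sub_clamp_le _ _
    have hmeas : Measurable fun u => |c u - c' u| := (hc.sub hc'c.measurable).abs
    have hb : ∀ u, |(|c u - c' u|)| ≤ M + M := fun u => by
      rw [abs_abs]; exact (abs_sub _ _).trans (add_le_add (hM u) (hc'M u))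
    rw [intervalIntegral.integral_of_le (by linarith), ← Measure.integral_compProd
      (f := fun u => |c u - c' u|) (integrable_of_abs_le hmeas hb)]
    refine le_trans (integral_mono (integrable_of_abs_le hmeas hb) ?_ hd) hg
    exact ((integrable_of_abs_le hc hM).sub hgi).norm

theorem measurable_comp_path (hT : 0 ≤ T) {F : ℝ × Euc d → ℝ} (hF : Measurable F) :
    Measurable fun p : PathSpace d T × ℝ => F (p.2, evalAt hT p.2 p.1) :=
  hF.comp (measurable_snd.prodMk ((continuous_evalAt_uncurry hT).comp
    (continuous_snd.prodMk continuous_fst)).measurable)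

theorem measurable_integral_path (hT : 0 ≤ T) {F : ℝ × Euc d → ℝ} (hF : Measurable F) {s t : ℝ}
    (hst : s ≤ t) : Measurable fun ω : PathSpace d T => ∫ r in s..t, F (r, evalAt hT r ω) := by
  simp only [intervalIntegral.integral_of_le hst]
  exact (StronglyMeasurable.integral_prod_right (f := fun (ω : PathSpace d T) r =>
    F (r, evalAt hT r ω)) (measurable_comp_path hT hF).stronglyMeasurable).measurable

theorem measurable_slice (hT : 0 ≤ T) {F : ℝ × Euc d → ℝ} (hF : Measurable F)
    (ω : PathSpace d T) : Measurable fun r => F (r, evalAt hT r ω) :=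
  hF.comp (measurable_id.prodMk (continuous_evalAt_left hT ω).measurable)

theorem integral_integral_path (hT : 0 ≤ T) {Pr : Measure (PathSpace d T)}
    [IsProbabilityMeasure Pr] (hPr : ∀ r ∈ Icc 0 T, Pr.map (evalAt hT r) = D.ν r)
    {F : ℝ × Euc d → ℝ} (hF : Measurable F) {C : ℝ} (hC : ∀ u, |F u| ≤ C) {s t : ℝ} (hs : 0 ≤ s)
    (hst : s ≤ t) (ht : t ≤ T) :
    ∫ ω, (∫ r in s..t, F (r, evalAt hT r ω)) ∂Pr = ∫ r in s..t, ∫ y, F (r, y) ∂(D.ν r) := by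
  simp only [intervalIntegral.integral_of_le hst]
  rw [integral_integral_swap (f := fun ω r => F (r, evalAt hT r ω))
    (integrable_of_abs_le (measurable_comp_path hT hF) fun p => hC _)]
  refine setIntegral_congr_fun measurableSet_Ioc fun r hr => ?_
  have hFr : Measurable fun y => F (r, y) := hF.comp measurable_prodMk_left
  rw [← hPr r ⟨hs.trans hr.1.le, hr.2.trans ht⟩, integral_map
    (measurable_evalAt hT r).aemeasurable hFr.aestronglyMeasurable]

end FPFlow

namespace FPFlow

variable {d : ℕ} (D : FPFlow d) {T : ℝ}

/-- The drift and diffusion coefficients of a flow, as one finite family. -/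
def coef : Fin d ⊕ Fin d × Fin d → ℝ × Euc d → ℝ :=
  Sum.elim (fun i u => D.β u i) fun p u => ∑ k, D.σ u k p.1 * D.σ u k p.2

/-- The derivatives paired with the coefficients `FPFlow.coef` in the generator. -/
def derivs (φ : Euc d → ℝ) : Fin d ⊕ Fin d × Fin d → Euc d → ℝ :=
  Sum.elim (fun i => pd i φ) fun p x => 1 / 2 * pd2 p.1 p.2 φ x

theorem diffOp_eq_sum_coef {φ : Euc d → ℝ} (hφ : ContDiff ℝ 2 φ) (u : ℝ × Euc d) (x : Euc d) :
    diffOp (D.β u) (D.σ u) φ x = ∑ i, D.coef i u * derivs φ i x := by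
  rw [diffOp_eq_sum _ _ hφ, Fintype.sum_sum_type, Fintype.sum_prod_type]
  simp only [coef, derivs, Sum.elim_inl, Sum.elim_inr, Finset.mul_sum]
  congr 1
  refine Finset.sum_congr rfl fun i _ => Finset.sum_congr rfl fun j _ => ?_
  ring

theorem measurable_coord {U : Type*} [MeasurableSpace U] {f : U → Euc d} (hf : Measurable f)
    (i : Fin d) : Measurable fun u => f u i :=
  (EuclideanSpace.proj (𝕜 := ℝ) i).continuous.measurable.comp hf

theorem abs_coord_le (v : Euc d) (i : Fin d) : |v i| ≤ ‖v‖ := by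
  simpa using PiLp.norm_apply_le v i

theorem measurable_coef (i : Fin d ⊕ Fin d × Fin d) : Measurable (D.coef i) := by
  rcases i with i | p
  · exact measurable_coord D.measurable_β i
  · have : Measurable fun u => ∑ k, D.σ u k p.1 * D.σ u k p.2 := Finset.measurable_sum _ fun k _ =>
      (measurable_coord (D.measurable_σ k) p.1).mul (measurable_coord (D.measurable_σ k) p.2)
    exact this

theorem abs_coef_le (i : Fin d ⊕ Fin d × Fin d) (u : ℝ × Euc d) :
    |D.coef i u| ≤ D.K + d * (D.K * D.K) := by
  have hK := D.K_nonneg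
  rcases i with i | p
  · have := (abs_coord_le (D.β u) i).trans (D.norm_β_le u)
    have h2 : 0 ≤ d * (D.K * D.K) := by positivity
    simp only [coef, Sum.elim_inl]
    linarith
  · have : |∑ k, D.σ u k p.1 * D.σ u k p.2| ≤ ∑ _k : Fin d, D.K * D.K := by
      refine (Finset.abs_sum_le_sum_abs _ _).trans (Finset.sum_le_sum fun k _ => ?_)
      rw [abs_mul]
      exact mul_le_mul ((abs_coord_le _ _).trans (D.norm_σ_le u k))
        ((abs_coord_le _ _).trans (D.norm_σ_le u k)) (abs_nonneg _) hK
    rw [Finset.sum_const, Finset.card_univ, Fintype.card_fin, nsmul_eq_mul] at this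
    simp only [coef, Sum.elim_inr]
    linarith

theorem continuous_derivs {φ : Euc d → ℝ} (hφ : ContDiff ℝ 2 φ) (i : Fin d ⊕ Fin d × Fin d) :
    Continuous (derivs φ i) := by
  rcases i with i | p
  · exact continuous_pd hφ i
  · exact continuous_const.mul (continuous_pd2 hφ _ _)

theorem abs_derivs_le {φ : Euc d → ℝ} (hφ : ContDiff ℝ 2 φ) {C : ℝ}
    (h1 : ∀ x, ‖fderiv ℝ φ x‖ ≤ C) (h2 : ∀ x, ‖fderiv ℝ (fderiv ℝ φ) x‖ ≤ C)
    (i : Fin d ⊕ Fin d × Fin d) (x : Euc d) : |derivs φ i x| ≤ C := by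
  rcases i with i | p
  · exact abs_pd_le h1 i x
  · have := abs_pd2_le hφ h2 p.1 p.2 x
    have h0 := abs_nonneg (pd2 p.1 p.2 φ x)
    simp only [derivs, Sum.elim_inr]
    rw [abs_mul, abs_of_pos (by norm_num : (0:ℝ) < 1 / 2)]
    linarith

theorem exists_coeffs (hT : 0 ≤ T) {ε : ℝ} (hε : 0 < ε) :
    ∃ A : Coeffs (Fin d ⊕ Fin d × Fin d) (ℝ × Euc d), A.c = D.coef ∧
      (∀ i, Continuous (A.c' i)) ∧ (∀ i, HasCompactSupport (A.c' i)) ∧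
      ∫ s in (0:ℝ)..T + 1, ∫ y, A.dev (s, y) (s, y) ∂(D.ν s) ≤ ε := by
  set m : ℝ := (Fintype.card (Fin d ⊕ Fin d × Fin d) : ℝ) with hm
  have hm0 : 0 ≤ m := by positivity
  choose c' hc hcs hb hi using fun i => D.exists_continuous_approx hT (D.measurable_coef i)
    (D.abs_coef_le i) (show 0 < ε / (m + 1) by positivity)
  set A : Coeffs (Fin d ⊕ Fin d × Fin d) (ℝ × Euc d) :=
    { c := D.coef, c' := c', measurable_c := D.measurable_coef
      measurable_c' := fun i => (hc i).measurable, M := D.K + d * (D.K * D.K)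
      abs_c_le := D.abs_coef_le, abs_c'_le := hb } with hA
  refine ⟨A, rfl, hc, hcs, ?_⟩
  have hmeas : ∀ i, Measurable fun u => |D.coef i u - c' i u| := fun i =>
    ((D.measurable_coef i).sub (hc i).measurable).abs
  have hbd : ∀ i u, |(|D.coef i u - c' i u|)| ≤ (D.K + d * (D.K * D.K)) + (D.K + d * (D.K * D.K)) :=
    fun i u => by
      rw [abs_abs]; exact (abs_sub _ _).trans (add_le_add (D.abs_coef_le i u) (hb i u))
  have e1 : ∀ s, ∫ y, A.dev (s, y) (s, y) ∂(D.ν s)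
      = ∑ i, ∫ y, |D.coef i (s, y) - c' i (s, y)| ∂(D.ν s) := fun s =>
    integral_finsetSum _ fun i _ => integrable_of_abs_le
      ((hmeas i).comp measurable_prodMk_left) fun y => hbd i (s, y)
  simp only [e1]
  rw [intervalIntegral.integral_finsetSum fun i _ => intervalIntegrable_of_abs_le
    (D.measurable_integral_ν (hmeas i)) (fun s => abs_integral_le_of_abs_le fun y => hbd i (s, y))
    _ _]
  refine (Finset.sum_le_sum fun i _ => hi i).trans ?_
  rw [Finset.sum_const, Finset.card_univ, nsmul_eq_mul, ← hm, mul_div_assoc', div_le_iff₀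
    (by positivity)]
  nlinarith

theorem abs_integral_martingale_le (hT : 0 < T) {P : ℕ → Measure (PathSpace d T)}
    {N : ℕ → ℕ} (S : D.IsApproxSeq hT.le P N) {Pr : Measure (PathSpace d T)}
    [IsProbabilityMeasure Pr] {l : Filter ℕ} [l.NeBot] (hl : l ≤ Filter.atTop)
    (hlim : ∀ F : PathSpace d T → ℝ, Continuous F → (∃ C, ∀ ω, |F ω| ≤ C) →
      Filter.Tendsto (fun n => ∫ ω, F ω ∂(P n)) l (𝓝 (∫ ω, F ω ∂Pr)))
    {φ : Euc d → ℝ} (hφ : ContDiff ℝ 2 φ) (hφc : HasCompactSupport φ) {C : ℝ} (hC0 : 0 ≤ C)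
    (h0 : ∀ x, |φ x| ≤ C) (h1 : ∀ x, ‖fderiv ℝ φ x‖ ≤ C)
    (h2 : ∀ x, ‖fderiv ℝ (fderiv ℝ φ) x‖ ≤ C) {G : PathSpace d T → ℝ} (hG : Continuous G)
    (hG1 : ∀ ω, |G ω| ≤ 1) {s t : ℝ} (hs : 0 ≤ s) (hst : s ≤ t) (ht : t ≤ T)
    (hGs : DependsUpTo hT.le s G) {ε : ℝ} (hε : 0 < ε) :
    |∫ ω, G ω * (φ (evalAt hT.le t ω) - φ (evalAt hT.le s ω)
      - ∫ r in s..t, D.gen φ (r, evalAt hT.le r ω)) ∂Pr| ≤ C * ε + C * ε := by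
  obtain ⟨A, hAc, hcc, hcs, hdev⟩ := D.exists_coeffs hT.le hε
  have hmarg : ∀ r ∈ Icc 0 T, Pr.map (evalAt hT.le r) = D.ν r := fun r hr =>
    S.map_evalAt_limit (hT := hT) hl hlim hr.1 hr.2
  set g : ℝ × Euc d → ℝ := fun u => ∑ i, A.c' i u * derivs φ i u.2 with hg
  have hgcont : Continuous g := continuous_finsetSum _ fun i _ =>
    (hcc i).mul ((continuous_derivs hφ i).comp continuous_snd)
  have hgc : HasCompactSupport g := by
    have : ∀ s : Finset (Fin d ⊕ Fin d × Fin d),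
        HasCompactSupport fun u : ℝ × Euc d => ∑ i ∈ s, A.c' i u * derivs φ i u.2 := by
      intro s
      induction s using Finset.induction_on with
      | empty => simp only [Finset.sum_empty]; exact HasCompactSupport.zero
      | insert i s hi ih =>
        simp only [Finset.sum_insert hi]
        exact ((hcs i).mul_right).add ih
    exact this _
  have huc : ∀ i, UniformContinuous (A.c' i) := fun i =>
    (hcc i).uniformContinuous_of_tendsto_cocompact (x := 0) (hcs i).is_zero_at_infty
  have hgen : ∀ u x, diffOp (D.β u) (D.σ u) φ x = ∑ i, A.c i u * derivs φ i x := fun u x => by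
    rw [hAc]; exact D.diffOp_eq_sum_coef hφ u x
  have hle := S.abs_integral_limit_le (hT := hT) hl hlim hφ.continuous hφc hgcont hgc hG hG1 hs hst
    ht
    (B := C * (∫ s in (0:ℝ)..T + 1, ∫ y, A.dev (s, y) (s, y) ∂(D.ν s))) fun η hη => by
      filter_upwards [S.martingale _ A huc φ hφ hφc (derivs φ)
        (fun i => (continuous_derivs hφ i).measurable) hgen C (abs_derivs_le hφ h1 h2) h0 h2 η hη]
        with n hn k l hkl hl' hsk
      exact hn G hG.measurable hG1 k l hkl hl' (hGs.mono hT.le hsk)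
  have hdm : Measurable fun u : ℝ × Euc d => A.dev u u :=
    A.measurable_dev measurable_id measurable_id
  have hgm := hgcont.measurable
  have hGm := D.measurable_gen hφ
  have hGb := D.abs_gen_le h1 h2
  have hdiff : ∀ u, |D.gen φ u - g u| ≤ C * A.dev u u := fun u => by
    have : D.gen φ u - g u = ∑ i, (A.c i u - A.c' i u) * derivs φ i u.2 := by
      simp only [gen, hgen, hg, ← Finset.sum_sub_distrib, sub_mul]
    rw [this, Coeffs.dev, Finset.mul_sum]
    refine (Finset.abs_sum_le_sum_abs _ _).trans (Finset.sum_le_sum fun i _ => ?_)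
    rw [abs_mul, mul_comm]
    gcongr
    exact abs_derivs_le hφ h1 h2 i _
  obtain ⟨Cg, hCg⟩ := hgcont.bounded_above_of_compact_support hgc
  have hgi : ∀ ω : PathSpace d T, ∀ a b,
      IntervalIntegrable (fun r => g (r, evalAt hT.le r ω)) volume a b := fun ω =>
    intervalIntegrable_of_abs_le (measurable_slice hT.le hgm ω) fun r => hCg _
  have hGi : ∀ ω : PathSpace d T, ∀ a b,
      IntervalIntegrable (fun r => D.gen φ (r, evalAt hT.le r ω)) volume a b := fun ω =>
    intervalIntegrable_of_abs_le (measurable_slice hT.le hGm ω) fun r => hGb _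
  have hdi : ∀ ω : PathSpace d T, ∀ a b, IntervalIntegrable
      (fun r => A.dev (r, evalAt hT.le r ω) (r, evalAt hT.le r ω)) volume a b := fun ω =>
    intervalIntegrable_of_abs_le (measurable_slice hT.le hdm ω) fun r => A.abs_dev_le _ _
  have hIb : ∀ {F : ℝ × Euc d → ℝ} {c : ℝ}, (∀ u, |F u| ≤ c) → ∀ ω : PathSpace d T,
      |∫ r in s..t, F (r, evalAt hT.le r ω)| ≤ c * (t - s) := fun {F c} hF ω => by
    have := intervalIntegral.norm_integral_le_of_norm_le_const (a := s) (b := t) (C := c)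
      (f := fun r => F (r, evalAt hT.le r ω)) fun r _ => hF _
    rwa [abs_of_nonneg (by linarith : 0 ≤ t - s)] at this
  set I1 : PathSpace d T → ℝ := fun ω => ∫ r in s..t, D.gen φ (r, evalAt hT.le r ω) with hI1
  set I2 : PathSpace d T → ℝ := fun ω => ∫ r in s..t, g (r, evalAt hT.le r ω) with hI2
  set I3 : PathSpace d T → ℝ := fun ω =>
    ∫ r in s..t, A.dev (r, evalAt hT.le r ω) (r, evalAt hT.le r ω) with hI3
  have m1 : Measurable I1 := measurable_integral_path hT.le hGm hst
  have m2 : Measurable I2 := measurable_integral_path hT.le hgm hst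
  have m3 : Measurable I3 := measurable_integral_path hT.le hdm hst
  have i1 : Integrable I1 Pr := integrable_of_abs_le m1 (hIb hGb)
  have i2 : Integrable I2 Pr := integrable_of_abs_le m2 (hIb hCg)
  have i3 : Integrable I3 Pr := integrable_of_abs_le m3 (hIb (F := fun u => A.dev u u) fun u =>
    A.abs_dev_le _ _)
  have hGae : ∀ᵐ ω ∂Pr, ‖G ω‖ ≤ 1 := ae_of_all _ hG1
  have iφ : Integrable (fun ω => φ (evalAt hT.le t ω) - φ (evalAt hT.le s ω)) Pr := by
    refine Integrable.sub ?_ ?_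
    · exact integrable_of_abs_le (hφ.continuous.comp (continuous_evalAt _ _)).measurable
        fun ω => h0 _
    · exact integrable_of_abs_le (hφ.continuous.comp (continuous_evalAt _ _)).measurable
        fun ω => h0 _
  have j1 : Integrable (fun ω => G ω * (φ (evalAt hT.le t ω) - φ (evalAt hT.le s ω) - I2 ω)) Pr :=
    (iφ.sub i2).bdd_mul hG.aestronglyMeasurable hGae
  have j2 : Integrable (fun ω => G ω * (I1 ω - I2 ω)) Pr :=
    (i1.sub i2).bdd_mul hG.aestronglyMeasurable hGae
  have e : ∫ ω, G ω * (φ (evalAt hT.le t ω) - φ (evalAt hT.le s ω) - I1 ω) ∂Pr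
      = ∫ ω, G ω * (φ (evalAt hT.le t ω) - φ (evalAt hT.le s ω) - I2 ω) ∂Pr
        - ∫ ω, G ω * (I1 ω - I2 ω) ∂Pr := by
    rw [← integral_sub j1 j2]
    congr 1; ext ω; ring
  have hI : ∀ ω, |I1 ω - I2 ω| ≤ C * I3 ω := fun ω => by
    simp only [hI1, hI2, hI3]
    rw [← intervalIntegral.integral_sub (hGi ω _ _) (hgi ω _ _),
      ← intervalIntegral.integral_const_mul]
    refine (intervalIntegral.abs_integral_le_integral_abs hst).trans ?_
    exact intervalIntegral.integral_mono_on hst ((hGi ω _ _).sub (hgi ω _ _)).abs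
      ((hdi ω _ _).const_mul _) fun r _ => hdiff _
  have hsec : |∫ ω, G ω * (I1 ω - I2 ω) ∂Pr| ≤ C * ε := by
    have b1 : |∫ ω, G ω * (I1 ω - I2 ω) ∂Pr| ≤ ∫ ω, C * I3 ω ∂Pr := by
      refine abs_integral_le_integral_abs.trans
        (integral_mono j2.abs (i3.const_mul C) fun ω => ?_)
      dsimp only
      rw [abs_mul]
      exact (mul_le_of_le_one_left (abs_nonneg _) (hG1 ω)).trans (hI ω)
    refine b1.trans ?_
    rw [integral_const_mul]
    refine mul_le_mul_of_nonneg_left ?_ hC0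
    rw [hI3, D.integral_integral_path hT.le hmarg hdm (fun u => A.abs_dev_le _ _) hs hst ht]
    refine le_trans ?_ hdev
    refine intervalIntegral.integral_mono_interval hs hst (by linarith)
      (ae_of_all _ fun r => integral_nonneg fun y => A.dev_nonneg _ _) ?_
    exact intervalIntegrable_of_abs_le (D.measurable_integral_ν hdm)
      (fun r => abs_integral_le_of_abs_le fun y => A.abs_dev_le _ _) _ _
  rw [e]
  refine (abs_sub _ _).trans (add_le_add (hle.trans ?_) hsec)
  gcongr

/-- The superposition principle, with continuous test functionals of the past. -/
theorem exists_martingale_solution (hd : 1 ≤ d) (hT : 0 < T) :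
    ∃ Pr : Measure (PathSpace d T), IsProbabilityMeasure Pr ∧
      (∀ t ∈ Icc 0 T, Pr.map (evalAt hT.le t) = D.ν t) ∧
      ∀ φ : Euc d → ℝ, ContDiff ℝ 2 φ → HasCompactSupport φ → ∀ G : PathSpace d T → ℝ,
        Continuous G → (∀ ω, |G ω| ≤ 1) → ∀ s t, 0 ≤ s → s ≤ t → t ≤ T → DependsUpTo hT.le s G →
        ∫ ω, G ω * (φ (evalAt hT.le t ω) - φ (evalAt hT.le s ω)
          - ∫ r in s..t, D.gen φ (r, evalAt hT.le r ω)) ∂Pr = 0 := by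
  obtain ⟨P, N, S⟩ := D.exists_isApproxSeq hd hT
  obtain ⟨Pr, l, hPr, hln, hl, hlim⟩ := S.exists_limit (hT := hT)
  refine ⟨Pr, hPr, fun r hr => S.map_evalAt_limit (hT := hT) hl hlim hr.1 hr.2,
    fun φ hφ hφc G hG hG1 s t hs hst ht hGs => ?_⟩
  obtain ⟨C, hC0, h0, h1, h2⟩ := exists_bound_derivatives hφ hφc
  rw [← abs_nonpos_iff]
  refine le_of_forall_pos_le_add fun δ hδ => ?_
  have := D.abs_integral_martingale_le hT S hl hlim hφ hφc hC0 h0 h1 h2 hG hG1 hs hst ht hGs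
    (show 0 < δ / (2 * (C + 1)) by positivity)
  refine this.trans ?_
  rw [zero_add, ← two_mul, ← mul_assoc, mul_div_assoc', div_le_iff₀ (by positivity)]
  nlinarith

end FPFlow

section CanonicalFiltration

variable {d : ℕ} {T : ℝ} (hT : 0 ≤ T)

theorem canFilt_le (s : ℝ) : canFilt d T hT s ≤ borel (PathSpace d T) :=
  iSup₂_le fun r _ => (measurable_evalAt hT r).comap_le

theorem measurable_evalAt_canFilt {r s : ℝ} (hr : r ∈ Icc 0 s) :
    Measurable[canFilt d T hT s] (evalAt (d := d) hT r) := by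
  rw [measurable_iff_comap_le]
  exact le_iSup₂ (f := fun (r : ℝ) (_ : r ∈ Icc 0 s) =>
    MeasurableSpace.comap (evalAt (d := d) hT r) inferInstance) r hr

/-- Sets of paths whose position at time `r` lies in a closed set. -/
def closedCylinders (d : ℕ) (r : ℝ) : Set (Set (PathSpace d T)) :=
  preimage (evalAt hT r) '' {C | IsClosed C}

theorem comap_evalAt_eq (r : ℝ) : MeasurableSpace.comap (evalAt (d := d) hT r) inferInstance
    = MeasurableSpace.generateFrom (closedCylinders hT d r) := by
  rw [closedCylinders, ← MeasurableSpace.comap_generateFrom, ← borel_eq_generateFrom_isClosed,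
    BorelSpace.measurable_eq (α := Euc d)]

theorem canFilt_eq_generateFrom (s : ℝ) : canFilt d T hT s
    = MeasurableSpace.generateFrom (piiUnionInter (closedCylinders hT d) (Icc 0 s)) := by
  apply le_antisymm
  · refine iSup₂_le fun r hr => ?_
    rw [comap_evalAt_eq]
    exact le_generateFrom_piiUnionInter _ hr
  · refine MeasurableSpace.generateFrom_le ?_
    rintro A ⟨p, hp, f, hf, rfl⟩
    refine Finset.measurableSet_biInter _ fun r hr => ?_
    obtain ⟨C, hC, hCf⟩ := hf r hr
    rw [← hCf]
    exact measurable_evalAt_canFilt hT (hp hr) hC.measurableSet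

theorem isPiSystem_closedCylinders (r : ℝ) : IsPiSystem (closedCylinders hT d r) := by
  rintro _ ⟨C, hC, rfl⟩ _ ⟨C', hC', rfl⟩ _
  exact ⟨C ∩ C', IsClosed.inter hC hC', rfl⟩

theorem setIntegral_closedCylinder_eq_zero {Pr : Measure (PathSpace d T)} [IsFiniteMeasure Pr]
    {X : PathSpace d T → ℝ} (hX : Integrable X Pr) {s : ℝ}
    (h : ∀ G : PathSpace d T → ℝ, Continuous G → (∀ ω, |G ω| ≤ 1) → DependsUpTo hT s G →
      ∫ ω, G ω * X ω ∂Pr = 0) {p : Finset ℝ} (hp : ∀ r ∈ p, r ≤ s) {C : ℝ → Set (Euc d)}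
    (hC : ∀ r ∈ p, IsClosed (C r)) : ∫ ω in ⋂ r ∈ p, evalAt hT r ⁻¹' C r, X ω ∂Pr = 0 := by
  have hδ : ∀ n : ℕ, (0:ℝ) < 1 / (n + 1) := fun n => by positivity
  set G : ℕ → PathSpace d T → ℝ := fun n ω =>
    ∏ r ∈ p, ((thickenedIndicator (hδ n) (C r) (evalAt hT r ω) : ℝ≥0) : ℝ) with hG
  have hGc : ∀ n, Continuous (G n) := fun n => continuous_finsetProd _ fun r _ =>
    NNReal.continuous_coe.comp ((thickenedIndicator (hδ n) (C r)).continuous.comp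
      (continuous_evalAt hT r))
  have hG1 : ∀ n ω, |G n ω| ≤ 1 := fun n ω => by
    rw [hG, Finset.abs_prod]
    refine Finset.prod_le_one (fun r _ => abs_nonneg _) fun r _ => ?_
    rw [NNReal.abs_eq]
    exact_mod_cast thickenedIndicator_le_one (hδ n) (C r) _
  have hGd : ∀ n, DependsUpTo hT s (G n) := fun n ω ω' hω =>
    Finset.prod_congr rfl fun r hr => by rw [hω r (hp r hr)]
  set A : Set (PathSpace d T) := ⋂ r ∈ p, evalAt hT r ⁻¹' C r with hA
  have hAm : MeasurableSet A := Finset.measurableSet_biInter _ fun r hr =>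
    measurable_evalAt hT r (hC r hr).measurableSet
  have hlim : ∀ ω, Filter.Tendsto (fun n => G n ω) Filter.atTop (𝓝 (A.indicator 1 ω)) := by
    intro ω
    have e : A.indicator (1 : PathSpace d T → ℝ) ω
        = ∏ r ∈ p, (((C r).indicator (fun _ => (1:ℝ≥0)) (evalAt hT r ω) : ℝ≥0) : ℝ) := by
      by_cases hω : ω ∈ A
      · rw [indicator_of_mem hω, Finset.prod_eq_one]
        · rfl
        · intro r hr
          have : evalAt hT r ω ∈ C r := by
            rw [hA] at hω; exact mem_iInter₂.mp hω r hr
          simp [this]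
      · rw [indicator_of_notMem hω]
        rw [hA, mem_iInter₂] at hω
        push Not at hω
        obtain ⟨r, hr, hr'⟩ := hω
        refine (Finset.prod_eq_zero hr ?_).symm
        rw [mem_preimage] at hr'
        simp [hr']
    rw [e]
    refine tendsto_finsetProd _ fun r hr => ?_
    have := thickenedIndicator_tendsto_indicator_closure hδ
      tendsto_one_div_add_atTop_nhds_zero_nat (C r)
    rw [tendsto_pi_nhds, (hC r hr).closure_eq] at this
    exact (NNReal.continuous_coe.tendsto _).comp (this (evalAt hT r ω))
  have hconv : Filter.Tendsto (fun n => ∫ ω, G n ω * X ω ∂Pr) Filter.atTop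
      (𝓝 (∫ ω, A.indicator 1 ω * X ω ∂Pr)) := by
    refine tendsto_integral_of_dominated_convergence (fun ω => |X ω|)
      (fun n => (hGc n).aestronglyMeasurable.mul hX.aestronglyMeasurable) hX.abs
      (fun n => ae_of_all _ fun ω => ?_) (ae_of_all _ fun ω => (hlim ω).mul_const _)
    rw [Real.norm_eq_abs, abs_mul]
    exact mul_le_of_le_one_left (abs_nonneg _) (hG1 n ω)
  have h0 : ∀ n, ∫ ω, G n ω * X ω ∂Pr = 0 := fun n => h _ (hGc n) (hG1 n) (hGd n)
  simp only [h0] at hconv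
  have := tendsto_nhds_unique hconv tendsto_const_nhds
  rw [← integral_indicator hAm]
  rw [← this]
  refine integral_congr_ae (ae_of_all _ fun ω => ?_)
  by_cases hω : ω ∈ A <;> simp [hω]

theorem setIntegral_canFilt_eq_zero {Pr : Measure (PathSpace d T)} [IsFiniteMeasure Pr]
    {X : PathSpace d T → ℝ} (hX : Integrable X Pr) {s : ℝ}
    (h : ∀ G : PathSpace d T → ℝ, Continuous G → (∀ ω, |G ω| ≤ 1) → DependsUpTo hT s G →
      ∫ ω, G ω * X ω ∂Pr = 0) {A : Set (PathSpace d T)}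
    (hA : MeasurableSet[canFilt d T hT s] A) : ∫ ω in A, X ω ∂Pr = 0 := by
  have hle : canFilt d T hT s ≤ borel (PathSpace d T) := canFilt_le hT s
  induction A, hA using MeasurableSpace.induction_on_inter (canFilt_eq_generateFrom hT s)
    (isPiSystem_piiUnionInter _ (isPiSystem_closedCylinders hT) _) with
  | empty => simp
  | basic A hA =>
    obtain ⟨p, hp, f, hf, rfl⟩ := hA
    choose! C hC hCf using hf
    have e : ⋂ r ∈ p, f r = ⋂ r ∈ p, evalAt hT r ⁻¹' C r :=
      iInter₂_congr fun r hr => (hCf r hr).symm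
    rw [e]
    exact setIntegral_closedCylinder_eq_zero hT hX h (fun r hr => (hp hr).2) hC
  | compl A hA ih =>
    have h1 := h (fun _ => 1) continuous_const (by simp) fun _ _ _ => rfl
    simp only [one_mul] at h1
    have := integral_add_compl (hle _ hA) hX
    rw [ih, h1, zero_add] at this
    exact this
  | iUnion f hd hf ih =>
    rw [integral_iUnion (fun i => hle _ (hf i)) hd hX.integrableOn]
    simp [ih]

end CanonicalFiltration

theorem stronglyMeasurable_integral_comp {Ω E : Type*} {m : MeasurableSpace Ω}
    [TopologicalSpace E] [TopologicalSpace.PseudoMetrizableSpace E] [MeasurableSpace E]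
    [BorelSpace E] [SecondCountableTopology E] {Z : ℝ → Ω → E}
    (hc : ∀ ω, Continuous fun r => Z r ω) (hm : ∀ r, Measurable (Z r)) {F : ℝ × E → ℝ}
    (hF : Measurable F) (μ : Measure ℝ) [SFinite μ] :
    StronglyMeasurable fun ω => ∫ r, F (r, Z r ω) ∂μ := by
  have h := measurable_uncurry_of_continuous_of_measurable hc hm
  have h2 : Measurable fun p : Ω × ℝ => F (p.2, Z p.2 p.1) :=
    hF.comp (measurable_snd.prodMk (h.comp measurable_swap))
  exact StronglyMeasurable.integral_prod_right (f := fun ω r => F (r, Z r ω)) h2.stronglyMeasurable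

section MartingaleProcess

variable {d : ℕ} {T : ℝ} (hT : 0 ≤ T)

/-- The compensated process of a test function, with compensator density `F`. -/
def compProcess (φ : Euc d → ℝ) (F : ℝ × Euc d → ℝ) (t : ℝ) (ω : PathSpace d T) : ℝ :=
  φ (evalAt hT t ω) - φ (evalAt hT 0 ω) - ∫ r in (0:ℝ)..t, F (r, evalAt hT r ω)

variable {φ : Euc d → ℝ} {F : ℝ × Euc d → ℝ}

theorem stronglyMeasurable_compProcess (hφ : Continuous φ) (hF : Measurable F) {t : ℝ}
    (ht : 0 ≤ t) : StronglyMeasurable[canFilt d T hT t] (compProcess (T := T) hT φ F t) := by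
  have h1 : ∀ r ∈ Icc 0 t, StronglyMeasurable[canFilt d T hT t]
      fun ω : PathSpace d T => φ (evalAt hT r ω) := fun r hr =>
    (hφ.measurable.comp (measurable_evalAt_canFilt hT hr)).stronglyMeasurable
  have h2 : StronglyMeasurable[canFilt d T hT t]
      fun ω : PathSpace d T => ∫ r in (0:ℝ)..t, F (r, evalAt hT r ω) := by
    have := stronglyMeasurable_integral_comp (m := canFilt d T hT t)
      (Z := fun r (ω : PathSpace d T) => evalAt hT (max 0 (min r t)) ω)
      (fun ω => (continuous_evalAt_left hT ω).comp (by fun_prop))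
      (fun r => measurable_evalAt_canFilt hT ⟨le_max_left _ _, max_le ht (min_le_right _ _)⟩)
      hF (volume.restrict (Ioc 0 t))
    convert this using 2 with ω
    rw [intervalIntegral.integral_of_le ht]
    refine setIntegral_congr_fun measurableSet_Ioc fun r hr => ?_
    rw [min_eq_left hr.2, max_eq_right hr.1.le]
  exact ((h1 t ⟨ht, le_rfl⟩).sub (h1 0 ⟨le_rfl, ht⟩)).sub h2

theorem abs_integral_path_le {C : ℝ} (hC : ∀ u, |F u| ≤ C) (s t : ℝ) (ω : PathSpace d T) :
    |∫ r in s..t, F (r, evalAt hT r ω)| ≤ C * |t - s| := by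
  rw [← Real.norm_eq_abs]
  exact intervalIntegral.norm_integral_le_of_norm_le_const fun r _ => hC _

theorem integrable_compProcess (Pr : Measure (PathSpace d T)) [IsProbabilityMeasure Pr]
    (hφ : Continuous φ) (hF : Measurable F) {C C' : ℝ} (hC : ∀ x, |φ x| ≤ C)
    (hC' : ∀ u, |F u| ≤ C') {t : ℝ} (ht : 0 ≤ t) : Integrable (compProcess hT φ F t) Pr := by
  refine FPFlow.integrable_of_abs_le (C := C + C + C' * |t - 0|)
    ((stronglyMeasurable_compProcess hT hφ hF ht).measurable.mono (canFilt_le hT t) le_rfl)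
    fun ω => (abs_sub _ _).trans (add_le_add ((abs_sub _ _).trans (add_le_add (hC _) (hC _)))
      (abs_integral_path_le hT hC' _ _ ω))

theorem condExp_compProcess (Pr : Measure (PathSpace d T)) [IsProbabilityMeasure Pr]
    (hφ : Continuous φ) (hF : Measurable F) {C C' : ℝ} (hC : ∀ x, |φ x| ≤ C)
    (hC' : ∀ u, |F u| ≤ C') {s t : ℝ} (hs : 0 ≤ s) (hst : s ≤ t)
    (h : ∀ G : PathSpace d T → ℝ, Continuous G → (∀ ω, |G ω| ≤ 1) → DependsUpTo hT s G →
      ∫ ω, G ω * (φ (evalAt hT t ω) - φ (evalAt hT s ω)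
        - ∫ r in s..t, F (r, evalAt hT r ω)) ∂Pr = 0) :
    Pr[compProcess hT φ F t | canFilt d T hT s] =ᵐ[Pr] compProcess hT φ F s := by
  have hit := integrable_compProcess hT Pr hφ hF hC hC' (hs.trans hst)
  have his := integrable_compProcess hT Pr hφ hF hC hC' hs
  have e : ∀ ω, compProcess hT φ F t ω - compProcess hT φ F s ω
      = φ (evalAt hT t ω) - φ (evalAt hT s ω) - ∫ r in s..t, F (r, evalAt hT r ω) := fun ω => by
    have hi : ∀ a b, IntervalIntegrable (fun r => F (r, evalAt hT r ω)) volume a b :=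
      FPFlow.intervalIntegrable_of_abs_le (FPFlow.measurable_slice hT hF ω) fun r => hC' _
    unfold compProcess
    rw [← intervalIntegral.integral_add_adjacent_intervals (hi 0 s) (hi s t)]
    ring
  have key : ∀ A, MeasurableSet[canFilt d T hT s] A →
      ∫ ω in A, (compProcess hT φ F t ω - compProcess hT φ F s ω) ∂Pr = 0 := fun A hA =>
    setIntegral_canFilt_eq_zero hT (hit.sub his) (fun G hG hG1 hGs => by
      simp only [Pi.sub_apply, e]; exact h G hG hG1 hGs) hA
  refine (ae_eq_condExp_of_forall_setIntegral_eq (canFilt_le hT s) hit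
    (fun A _ _ => his.integrableOn) (fun A hA _ => ?_)
    (stronglyMeasurable_compProcess hT hφ hF hs).aestronglyMeasurable).symm
  have := key A hA
  rw [integral_sub hit.integrableOn his.integrableOn] at this
  linarith

end MartingaleProcess

namespace FPFlow

theorem exists_condExp_solution {d : ℕ} (D : FPFlow d) {T : ℝ} (hd : 1 ≤ d) (hT : 0 < T) :
    ∃ Pr : Measure (PathSpace d T), IsProbabilityMeasure Pr ∧
      (∀ t ∈ Icc 0 T, Pr.map (evalAt hT.le t) = D.ν t) ∧
      ∀ φ : Euc d → ℝ, ContDiff ℝ 2 φ → HasCompactSupport φ →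
        (∀ t ∈ Icc 0 T, Integrable (compProcess hT.le φ (D.gen φ) t) Pr) ∧
        (∀ t ∈ Icc 0 T, StronglyMeasurable[canFilt d T hT.le t]
          (compProcess (T := T) hT.le φ (D.gen φ) t)) ∧
        ∀ s ∈ Icc 0 T, ∀ t ∈ Icc 0 T, s ≤ t →
          Pr[compProcess hT.le φ (D.gen φ) t | canFilt d T hT.le s]
            =ᵐ[Pr] compProcess hT.le φ (D.gen φ) s := by
  obtain ⟨Pr, hPr, hm, hmart⟩ := D.exists_martingale_solution hd hT
  refine ⟨Pr, hPr, hm, fun φ hφ hφc => ?_⟩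
  obtain ⟨C, hC0, h0, h1, h2⟩ := exists_bound_derivatives hφ hφc
  have hgm := D.measurable_gen hφ
  have hgb := D.abs_gen_le h1 h2
  exact ⟨fun t ht => integrable_compProcess _ Pr hφ.continuous hgm h0 hgb ht.1,
    fun t ht => stronglyMeasurable_compProcess _ hφ.continuous hgm ht.1,
    fun s hs t ht hst => condExp_compProcess _ Pr hφ.continuous hgm h0 hgb hs.1 hst
      fun G hG hG1 hGs => hmart φ hφ hφc G hG hG1 s t hs.1 hst ht.2 hGs⟩

end FPFlow

section SquareRoot

theorem Matrix.PosSemidef.spectrum_subset_Icc {n : Type*} [Fintype n] [DecidableEq n]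
    {A : Matrix n n ℝ} (hA : A.PosSemidef) : spectrum ℝ A ⊆ Icc 0 A.trace := by
  rw [hA.isHermitian.spectrum_real_eq_range_eigenvalues]
  rintro _ ⟨i, rfl⟩
  refine ⟨hA.eigenvalues_nonneg i, ?_⟩
  have := hA.isHermitian.trace_eq_sum_eigenvalues
  rw [this]
  exact Finset.single_le_sum (f := fun i => ((hA.isHermitian.eigenvalues i : ℝ)))
    (fun j _ => hA.eigenvalues_nonneg j) (Finset.mem_univ i)

variable {d : ℕ} {U : Type*} [MeasurableSpace U] {a : U → Matrix (Fin d) (Fin d) ℝ}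

theorem measurable_matrix_pow (ha : ∀ i j, Measurable fun u => a u i j) (k : ℕ) (i j : Fin d) :
    Measurable fun u => (a u ^ k) i j := by
  induction k generalizing i j with
  | zero => simp
  | succ k ih =>
    simp only [pow_succ, Matrix.mul_apply]
    exact Finset.measurable_sum _ fun l _ => (ih i l).mul (ha l j)

theorem measurable_matrix_aeval (ha : ∀ i j, Measurable fun u => a u i j) (p : Polynomial ℝ)
    (i j : Fin d) : Measurable fun u => (Polynomial.aeval (a u) p) i j := by
  simp only [Polynomial.aeval_eq_sum_range, Matrix.sum_apply, Matrix.smul_apply, smul_eq_mul]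
  exact Finset.measurable_sum _ fun k _ => (measurable_matrix_pow ha k i j).const_mul _

theorem measurable_matrix_cfc (ha : ∀ i j, Measurable fun u => a u i j)
    (hsa : ∀ u, IsSelfAdjoint (a u)) {f : ℝ → ℝ} (hf : Continuous f) {R : ℝ}
    (hR : ∀ u, spectrum ℝ (a u) ⊆ Icc 0 R) (i j : Fin d) :
    Measurable fun u => cfc f (a u) i j := by
  choose p hp using fun n : ℕ => exists_polynomial_near_of_continuousOn 0 R f hf.continuousOn
    (1 / (n + 1)) (by positivity)
  refine measurable_of_tendsto_metrizable (f := fun n u => (Polynomial.aeval (a u) (p n)) i j)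
    (fun n => measurable_matrix_aeval ha (p n) i j) ?_
  rw [tendsto_pi_nhds]
  intro u
  have h : Filter.Tendsto (fun n => cfc (fun x => (p n).eval x) (a u)) Filter.atTop
      (𝓝 (cfc f (a u))) := by
    refine tendsto_cfc_fun ?_ (Filter.Eventually.of_forall fun n =>
      (p n).continuous.continuousOn)
    rw [Metric.tendstoUniformlyOn_iff]
    intro ε hε
    filter_upwards [tendsto_one_div_add_atTop_nhds_zero_nat.eventually_lt_const hε] with n hn x hx
    rw [dist_comm, Real.dist_eq]
    exact (hp n x (hR u hx)).trans hn
  have e : ∀ n, cfc (fun x => (p n).eval x) (a u) = Polynomial.aeval (a u) (p n) := fun n =>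
    cfc_polynomial (p n) (a u) (hsa u)
  simp only [e] at h
  exact ((continuous_apply_apply i j).tendsto _).comp h

/-- A bounded measurable field of positive semidefinite matrices has a bounded measurable
square root. -/
theorem exists_measurable_sqrt (ha : ∀ i j, Measurable fun u => a u i j)
    (hpsd : ∀ u, (a u).PosSemidef) {K : ℝ} (hK : ∀ u i j, |a u i j| ≤ K) :
    ∃ σ : U → Fin d → Euc d, (∀ k, Measurable fun u => σ u k) ∧ (∀ u k, ‖σ u k‖ ≤ √K) ∧
      ∀ u i j, ∑ k, σ u k i * σ u k j = a u i j := by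
  have hsa : ∀ u, IsSelfAdjoint (a u) := fun u => (hpsd u).isHermitian
  have hspec : ∀ u, spectrum ℝ (a u) ⊆ Icc 0 (d * K) := fun u x hx => by
    obtain ⟨h0, h1⟩ := (hpsd u).spectrum_subset_Icc hx
    refine ⟨h0, h1.trans ?_⟩
    have : (a u).trace ≤ ∑ _i : Fin d, K :=
      Finset.sum_le_sum fun i _ => (le_abs_self _).trans (hK u i i)
    simpa using this
  set S : U → Matrix (Fin d) (Fin d) ℝ := fun u => cfc Real.sqrt (a u) with hS
  have hSm : ∀ i j, Measurable fun u => S u i j :=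
    measurable_matrix_cfc ha hsa Real.continuous_sqrt hspec
  have hSsymm : ∀ u i j, S u i j = S u j i := fun u i j => by
    have h : IsSelfAdjoint (S u) := cfc_predicate _ _
    have := congrFun (congrFun h.star_eq j) i
    simpa [Matrix.star_apply] using this
  have hSS : ∀ u, S u * S u = a u := fun u => by
    rw [hS, ← cfc_mul _ _ (a u) Real.continuous_sqrt.continuousOn Real.continuous_sqrt.continuousOn]
    conv_rhs => rw [← cfc_id ℝ (a u) (hsa u)]
    exact cfc_congr fun x hx => Real.mul_self_sqrt (hspec u hx).1
  have hsum : ∀ u i j, ∑ k, S u k i * S u k j = a u i j := fun u i j => by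
    rw [← hSS u, Matrix.mul_apply]
    exact Finset.sum_congr rfl fun k _ => by rw [hSsymm u k i]
  refine ⟨fun u k => WithLp.toLp 2 (S u k), fun k => ?_, fun u k => ?_, hsum⟩
  · exact (MeasurableEquiv.toLp 2 (Fin d → ℝ)).measurable.comp
      (measurable_pi_lambda _ fun i => hSm k i)
  · rw [EuclideanSpace.norm_eq]
    refine Real.sqrt_le_sqrt ?_
    have : ∑ i, ‖S u k i‖ ^ 2 = a u k k := by
      rw [← hsum u k k]
      refine Finset.sum_congr rfl fun i _ => ?_
      rw [Real.norm_eq_abs, sq_abs, sq, hSsymm u k i]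
    simp only
    rw [this]
    exact (le_abs_self _).trans (hK u k k)

end SquareRoot

section McKeanVlasov

variable {d : ℕ}

theorem isProbabilityMeasure_withDensity_ofReal {f : Euc d → ℝ}
    (hf0 : ∀ x, 0 ≤ f x) (h1 : ∫ x, f x = 1) :
    IsProbabilityMeasure ((volume : Measure (Euc d)).withDensity fun x => ENNReal.ofReal (f x)) :=
      by
  have hi : Integrable f := by
    by_contra h
    rw [integral_undef h] at h1
    exact zero_ne_one h1
  constructor
  rw [withDensity_apply _ MeasurableSet.univ, Measure.restrict_univ,
    ← ofReal_integral_eq_lintegral_ofReal hi (ae_of_all _ hf0), h1, ENNReal.ofReal_one]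

theorem integral_withDensity_ofReal {f : Euc d → ℝ} (hf : Measurable f) (hf0 : ∀ x, 0 ≤ f x)
    (g : Euc d → ℝ) : ∫ x, g x ∂((volume : Measure (Euc d)).withDensity
      fun x => ENNReal.ofReal (f x)) = ∫ x, g x * f x := by
  refine (integral_withDensity_eq_integral_smul hf.real_toNNReal g).trans ?_
  refine integral_congr_ae (ae_of_all _ fun x => ?_)
  simp only [NNReal.smul_def, Real.coe_toNNReal _ (hf0 x), smul_eq_mul, mul_comm]

variable {T : ℝ} {b : ℝ → Euc d → ℝ → Euc d} {a : ℝ → Euc d → ℝ → Matrix (Fin d) (Fin d) ℝ}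
  {vbar : ℝ → Euc d → ℝ}

/-- A distributional solution of the nonlinear Fokker-Planck equation, with its own density
inserted into the coefficients, is a flow solving a linear Fokker-Planck equation. -/
theorem exists_fpFlow (hT : 0 ≤ T)
    (hb_meas : Measurable (fun p : ℝ × Euc d × ℝ => b p.1 p.2.1 p.2.2))
    (ha_meas : ∀ i j, Measurable (fun p : ℝ × Euc d × ℝ => a p.1 p.2.1 p.2.2 i j))
    (hb_bdd : ∃ K, ∀ t x r, ‖b t x r‖ ≤ K) (ha_bdd : ∃ K, ∀ t x r i j, |a t x r i j| ≤ K)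
    (ha_symm : ∀ t x r, (a t x r).PosSemidef)
    (hv_meas : Measurable (Function.uncurry vbar)) (hv_nn : ∀ t x, 0 ≤ vbar t x)
    (hv_prob : ∀ t ∈ Icc (0:ℝ) T, ∫ x, vbar t x = 1)
    (hFP : ∀ φ : SchwartzMap (Euc d) ℝ, ∀ t ∈ Icc (0:ℝ) T,
      ∫ x, φ x * vbar t x = (∫ x, φ x * vbar 0 x)
        + ∫ s in Icc (0:ℝ) t, ∫ x, mkGenAction b a vbar (⇑φ) s x * vbar s x) :
    ∃ D : FPFlow d, (∀ t ∈ Icc (0:ℝ) T,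
        D.ν t = volume.withDensity (fun x => ENNReal.ofReal (vbar t x))) ∧
      ∀ φ : Euc d → ℝ, ContDiff ℝ 2 φ → ∀ r ∈ Icc (0:ℝ) T, ∀ x,
        D.gen φ (r, x) = mkGenAction b a vbar φ r x := by
  obtain ⟨Kb, hKb⟩ := hb_bdd
  obtain ⟨Ka, hKa⟩ := ha_bdd
  obtain ⟨τ, hτm, hτK, hτ⟩ := exists_measurable_sqrt
    (a := fun p : ℝ × Euc d × ℝ => a p.1 p.2.1 p.2.2) ha_meas (fun p => ha_symm _ _ _)
    (fun p i j => hKa _ _ _ i j)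
  have hlift : Measurable fun u : ℝ × Euc d => (u.1, u.2, vbar u.1 u.2) :=
    measurable_fst.prodMk (measurable_snd.prodMk hv_meas)
  set c : ℝ → ℝ := fun s => max 0 (min s T) with hc
  have hcm : Measurable c := by fun_prop
  have hcI : ∀ s, c s ∈ Icc 0 T := fun s => ⟨le_max_left _ _, max_le hT (min_le_right _ _)⟩
  have hcid : ∀ s ∈ Icc 0 T, c s = s := fun s hs => by
    simp only [hc, min_eq_left hs.2, max_eq_right hs.1]
  have hvm : ∀ s, Measurable (vbar s) := fun s => hv_meas.comp measurable_prodMk_left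
  set ν : Kernel ℝ (Euc d) := (Kernel.const ℝ (volume : Measure (Euc d))).withDensity
    fun s x => ENNReal.ofReal (vbar (c s) x) with hν
  have hνs : ∀ s, ν s = volume.withDensity fun x => ENNReal.ofReal (vbar (c s) x) := fun s => by
    rw [hν, Kernel.withDensity_apply, Kernel.const_apply]
    exact (hv_meas.comp ((hcm.comp measurable_fst).prodMk measurable_snd)).ennreal_ofReal
  have hνm : IsMarkovKernel ν := ⟨fun s => by
    rw [hνs]
    exact isProbabilityMeasure_withDensity_ofReal (hv_nn _) (hv_prob _ (hcI s))⟩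
  set A : Set (ℝ × Euc d) := Prod.fst ⁻¹' Icc (0:ℝ) T with hA
  have hAm : MeasurableSet A := measurable_fst measurableSet_Icc
  set β : ℝ × Euc d → Euc d := A.indicator fun u => b u.1 u.2 (vbar u.1 u.2) with hβ
  set σ : ℝ × Euc d → Fin d → Euc d := A.indicator fun u => τ (u.1, u.2, vbar u.1 u.2) with hσ
  have hβm : Measurable β := (hb_meas.comp hlift).indicator hAm
  have hσm : ∀ i, Measurable fun u => σ u i := fun i => by
    have : (fun u => σ u i) = A.indicator fun u => τ (u.1, u.2, vbar u.1 u.2) i := by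
      ext1 u
      by_cases hu : u ∈ A <;> simp [hσ, hu]
    rw [this]
    exact ((hτm i).comp hlift).indicator hAm
  set K := max Kb √Ka with hK
  have hK0 : 0 ≤ K := (Real.sqrt_nonneg _).trans (le_max_right _ _)
  have hβK : ∀ u, ‖β u‖ ≤ K := fun u => by
    by_cases hu : u ∈ A
    · rw [hβ, indicator_of_mem hu]
      exact (hKb _ _ _).trans (le_max_left _ _)
    · simpa [hβ, hu] using hK0
  have hσK : ∀ u i, ‖σ u i‖ ≤ K := fun u i => by
    by_cases hu : u ∈ A
    · rw [hσ, indicator_of_mem hu]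
      exact (hτK _ i).trans (le_max_right _ _)
    · simpa [hσ, hu] using hK0
  have hgen : ∀ φ : Euc d → ℝ, ContDiff ℝ 2 φ → ∀ r ∈ Icc (0:ℝ) T, ∀ x,
      diffOp (β (r, x)) (σ (r, x)) φ x = mkGenAction b a vbar φ r x := by
    intro φ hφ r hr x
    have hu : (r, x) ∈ A := hr
    rw [diffOp_eq_sum _ _ hφ, mkGenAction, hβ, hσ, indicator_of_mem hu, indicator_of_mem hu]
    simp only [hτ]
  have hgen0 : ∀ φ : Euc d → ℝ, ∀ r ∉ Icc (0:ℝ) T, ∀ x,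
      diffOp (β (r, x)) (σ (r, x)) φ x = 0 := by
    intro φ r hr x
    have hu : (r, x) ∉ A := hr
    simp [diffOp, hβ, hσ, indicator_of_notMem hu]
  refine ⟨⟨ν, hνm, β, σ, hβm, hσm, K, hβK, hσK, ?_⟩, fun t ht => by rw [hνs, hcid t ht], hgen⟩
  intro φ hφ hφc s t hs hst
  have hφ2 : ContDiff ℝ 2 φ := hφ.of_le (by norm_cast)
  obtain ⟨C, -, -, hC1, hC2⟩ := exists_bound_derivatives hφ2 hφc
  set H : ℝ → ℝ := fun r => ∫ y, diffOp (β (r, y)) (σ (r, y)) φ y ∂(ν r) with hH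
  have hHm : Measurable H :=
    ((measurable_diffOp hβm hσm hφ2).stronglyMeasurable.integral_kernel_prod_right').measurable
  have hHi : ∀ p q, IntervalIntegrable H volume p q :=
    FPFlow.intervalIntegrable_of_abs_le hHm fun r => FPFlow.abs_integral_le_of_abs_le fun y =>
      abs_diffOp_le (hβK _) (hσK _) hC1 hC2 y
  have hH1 : ∀ r ∈ Icc (0:ℝ) T, H r = ∫ x, mkGenAction b a vbar φ r x * vbar r x := by
    intro r hr
    simp only [hH, hgen φ hφ2 r hr]
    rw [hνs, hcid r hr, integral_withDensity_ofReal (hvm _) (hv_nn _)]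
  have hH0 : ∀ r ∉ Icc (0:ℝ) T, H r = 0 := fun r hr => by simp [hH, hgen0 φ r hr]
  have hmain : ∀ t, 0 ≤ t → ∫ y, φ y ∂(ν t) = (∫ x, φ x * vbar 0 x) + ∫ r in (0:ℝ)..t, H r := by
    intro t ht
    have e : ∫ r in (0:ℝ)..t, H r = ∫ r in Icc 0 (c t), H r := by
      rw [intervalIntegral.integral_of_le ht, ← integral_Icc_eq_integral_Ioc]
      refine setIntegral_eq_of_subset_of_forall_sdiff_eq_zero measurableSet_Icc
        (Icc_subset_Icc_right ?_) fun r hr => hH0 r fun hr' => hr.2 ⟨hr'.1, ?_⟩ 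
      · exact max_le ht (min_le_left _ _)
      · exact le_max_of_le_right (le_min hr.1.2 hr'.2)
    rw [hνs, integral_withDensity_ofReal (hvm _) (hv_nn _), e]
    refine (hFP (hφc.toSchwartzMap hφ) (c t) (hcI t)).trans ?_
    congr 1
    refine setIntegral_congr_fun measurableSet_Icc fun r hr => ?_
    exact (hH1 r ⟨hr.1, hr.2.trans (hcI t).2⟩).symm
  rw [hmain t (hs.trans hst), hmain s hs, ← intervalIntegral.integral_add_adjacent_intervals
    (hHi 0 s) (hHi s t)]
  ring

theorem mkMgProcess_eq_compProcess (hT : 0 ≤ T) {φ : Euc d → ℝ} {F : ℝ × Euc d → ℝ}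
    (hF : ∀ r ∈ Icc (0:ℝ) T, ∀ x, F (r, x) = mkGenAction b a vbar φ r x) {t : ℝ}
    (ht : t ∈ Icc (0:ℝ) T) : mkMgProcess hT b a vbar φ t = compProcess hT φ F t := by
  ext1 ω
  rw [mkMgProcess, compProcess, intervalIntegral.integral_of_le ht.1,
    ← integral_Icc_eq_integral_Ioc]
  congr 1
  exact setIntegral_congr_fun measurableSet_Icc fun r hr => (hF r ⟨hr.1, hr.2.trans ht.2⟩ _).symm

theorem mkMgProcess_zero (hT : 0 ≤ T) (φ : Euc d → ℝ) : mkMgProcess hT b a vbar φ 0 = 0 := by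
  ext1 ω
  simp [mkMgProcess]

/-- A single density at time zero gives a law on constant paths. -/
theorem exists_law_of_constant_path (hT : 0 ≤ T) (μ : Measure (Euc d)) [IsProbabilityMeasure μ] :
    ∃ Pr : Measure (PathSpace d T), IsProbabilityMeasure Pr ∧
      ∀ t, Pr.map (evalAt hT t) = μ := by
  have hc : Measurable (ContinuousMap.const (Icc (0:ℝ) T) : Euc d → PathSpace d T) :=
    ContinuousMap.continuous_const'.measurable
  refine ⟨μ.map (ContinuousMap.const _), Measure.isProbabilityMeasure_map hc.aemeasurable,
    fun t => ?_⟩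
  rw [Measure.map_map (measurable_evalAt hT t) hc]
  exact Measure.map_id

end McKeanVlasov

end SuperpositionPrinciple

/-- **Probabilistic representation of the non-linear Fokker--Planck equation**
(Theorem 3.6 of the paper): a distributional solution `v̄` of the non-linear
Fokker--Planck equation with bounded measurable coefficients yields a solution in law of
the associated McKean--Vlasov SDE with pointwise dependence on the marginal law density:
there is a probability `ℙ` on path space whose time-marginals have density `v̄(t,·)` and
under which the associated processes are martingales for the canonical filtration. -/
theorem stmt6 (d : ℕ) (hd : 1 ≤ d) (T : ℝ) (hT : 0 ≤ T)
    (b : ℝ → Euc d → ℝ → Euc d) (a : ℝ → Euc d → ℝ → Matrix (Fin d) (Fin d) ℝ)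
    (hb_meas : Measurable (fun p : ℝ × Euc d × ℝ => b p.1 p.2.1 p.2.2))
    (ha_meas : ∀ i j, Measurable (fun p : ℝ × Euc d × ℝ => a p.1 p.2.1 p.2.2 i j))
    (hb_bdd : ∃ K, ∀ t x r, ‖b t x r‖ ≤ K)
    (ha_bdd : ∃ K, ∀ t x r i j, |a t x r i j| ≤ K)
    (ha_symm : ∀ t x r, (a t x r).PosSemidef)
    (vbar : ℝ → Euc d → ℝ)
    (hv_meas : Measurable (Function.uncurry vbar)) (hv_nn : ∀ t x, 0 ≤ vbar t x)
    (hv_L1 : Integrable (Function.uncurry vbar)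
      ((volume.restrict (Set.Icc (0:ℝ) T)).prod volume))
    (hv_prob : ∀ t ∈ Set.Icc (0:ℝ) T, ∫ x, vbar t x = 1)
    (hFP : ∀ φ : SchwartzMap (Euc d) ℝ, ∀ t ∈ Set.Icc (0:ℝ) T,
      ∫ x, φ x * vbar t x = (∫ x, φ x * vbar 0 x)
        + ∫ s in Set.Icc (0:ℝ) t, ∫ x, mkGenAction b a vbar (⇑φ) s x * vbar s x) :
    ∃ ℙ : Measure (PathSpace d T), IsProbabilityMeasure ℙ ∧
      (∀ t ∈ Set.Icc (0:ℝ) T,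
        ℙ.map (evalAt hT t) = volume.withDensity (fun x => ENNReal.ofReal (vbar t x))) ∧
      ∀ φ : Euc d → ℝ, ContDiff ℝ 2 φ → HasCompactSupport φ →
        (∀ t ∈ Set.Icc (0:ℝ) T, Integrable (mkMgProcess hT b a vbar φ t) ℙ) ∧
        (∀ t ∈ Set.Icc (0:ℝ) T,
          StronglyMeasurable[canFilt d T hT t] (mkMgProcess hT b a vbar φ t)) ∧
        (∀ s ∈ Set.Icc (0:ℝ) T, ∀ t ∈ Set.Icc (0:ℝ) T, s ≤ t →
          ℙ[mkMgProcess hT b a vbar φ t | canFilt d T hT s]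
            =ᵐ[ℙ] mkMgProcess hT b a vbar φ s) := by
  obtain ⟨D, hν, hgen⟩ := exists_fpFlow hT hb_meas ha_meas hb_bdd ha_bdd ha_symm hv_meas hv_nn
    hv_prob hFP
  rcases hT.eq_or_lt with rfl | hTpos
  · obtain ⟨Pr, hPr, hmarg⟩ := exists_law_of_constant_path hT (D.ν 0)
    refine ⟨Pr, hPr, fun t ht => ?_, fun φ _ _ => ⟨?_, ?_, ?_⟩⟩
    · obtain rfl : t = 0 := le_antisymm ht.2 ht.1
      rw [hmarg, hν 0 ht]
    · intro t ht
      rw [le_antisymm ht.2 ht.1, mkMgProcess_zero]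
      exact integrable_zero _ _ _
    · intro t ht
      rw [le_antisymm ht.2 ht.1, mkMgProcess_zero]
      exact stronglyMeasurable_zero
    · intro s hs t ht _
      rw [le_antisymm ht.2 ht.1, le_antisymm hs.2 hs.1, mkMgProcess_zero, condExp_zero]
  · obtain ⟨Pr, hPr, hmarg, hmart⟩ := D.exists_condExp_solution hd hTpos
    refine ⟨Pr, hPr, fun t ht => by rw [hmarg t ht, hν t ht], fun φ hφ hφc => ?_⟩
    obtain ⟨hi, hm, hc⟩ := hmart φ hφ hφc
    have e : ∀ t ∈ Icc 0 T, mkMgProcess hT b a vbar φ t = compProcess hT φ (D.gen φ) t :=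
      fun t ht => mkMgProcess_eq_compProcess hT (hgen φ hφ) ht
    refine ⟨fun t ht => ?_, fun t ht => ?_, fun s hs t ht hst => ?_⟩
    · rw [e t ht]; exact hi t ht
    · rw [e t ht]; exact hm t ht
    · rw [e t ht, e s hs]; exact hc s hs t ht hst

end
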